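/- arXiv:1403.5975 — 9 statements merged into one kernel-verified Lean document; each statement's English description precedes it below -/
import Mathlib

section
/- There exists an absolute constant C such that for every integer r ≥ 2 and every natural number n, if the edges of the complete graph K_n are coloured so that the colouring is r-local (every vertex is incident to edges of at most r distinct colours), then the vertex set of K_n can be partitioned into at most C·r²·log r pairwise disjoint monochromatic cycles. -/
/-- `S` is the vertex set of a monochromatic cycle of colour `col` in the complete graph `K_n`
whose edges are coloured by `χ`; single vertices and single edges count as degenerate cycles. -/
def IsMonoCycle {n : ℕ} (χ : Fin n → Fin n → ℕ) (col : ℕ) (S : Finset (Fin n)) : Prop :=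
  (∃ v, S = {v}) ∨
  (∃ v w : Fin n, v ≠ w ∧ S = {v, w} ∧ χ v w = col) ∨
  (∃ (v : Fin n) (p : (⊤ : SimpleGraph (Fin n)).Walk v v),
    p.IsCycle ∧ p.support.toFinset = S ∧ ∀ x y : Fin n, s(x, y) ∈ p.edges → χ x y = col)

namespace LCP
set_option linter.unusedSectionVars false

variable {V : Type*} [DecidableEq V]

/-- cyclic list for a relation -/
def CycL (R : V → V → Prop) (l : List V) : Prop :=
  ∃ a t, l = a :: t ∧ l.Nodup ∧ (t = [] ∨ List.IsChain R ((a :: t) ++ [a]))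

def MC (χ : V → V → ℕ) (S : Finset V) : Prop :=
  ∃ c l, l.toFinset = S ∧ CycL (fun u v => χ u v = c) l

theorem last_split (p : V → Prop) (t : List V) :
    (∀ x ∈ t, ¬ p x) ∨ ∃ t1 u t2, t = t1 ++ u :: t2 ∧ p u ∧ ∀ x ∈ t2, ¬ p x := by
  induction t with
  | nil => left; simp
  | cons a t ih =>
    rcases ih with h | ⟨t1, u, t2, rfl, hu, h2⟩
    · by_cases ha : p a
      · right; exact ⟨[], a, t, rfl, ha, h⟩
      · left; intro x hx; rcases List.mem_cons.1 hx with rfl | hx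
        · exact ha
        · exact h x hx
    · right; exact ⟨a :: t1, u, t2, rfl, hu, h2⟩

theorem exists_end_cycle (R : V → V → Prop) (hs : ∀ u v, R u v → R v u) (X : Finset V)
    (hX : X.Nonempty) : ∃ v ∈ X, ∃ l, CycL R l ∧ (∀ x ∈ l, x ∈ X) ∧ v ∈ l ∧
      ∀ w ∈ X, w ≠ v → R v w → w ∈ l := by
  classical
  let P : ℕ → Prop := fun m => ∃ l : List V, l.length = m ∧ l.Nodup ∧ l.IsChain R ∧ ∀ x ∈ l, x ∈ X
  obtain ⟨x0, hx0⟩ := hX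
  have hP1 : P 1 := ⟨[x0], rfl, by simp, by simp, by simpa using hx0⟩
  have hb : ∀ m, P m → m ≤ X.card := by
    rintro m ⟨l, rfl, hn, -, hl⟩
    rw [← List.toFinset_card_of_nodup hn]
    exact Finset.card_le_card (fun x hx => hl x (by simpa using hx))
  have hmax := Nat.findGreatest_spec (P := P) (hb 1 hP1) hP1
  have hge : ∀ m, P m → m ≤ Nat.findGreatest P X.card := fun m hm =>
    Nat.le_findGreatest (hb m hm) hm
  generalize Nat.findGreatest P X.card = M at hmax hge
  obtain ⟨l, hlen, hn, hc, hl⟩ := hmax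
  have h1 := hge 1 hP1
  obtain ⟨v, t, rfl⟩ : ∃ v t, l = v :: t := by
    cases l with
    | nil => simp at hlen; omega
    | cons v t => exact ⟨v, t, rfl⟩
  have hall : ∀ w ∈ X, w ≠ v → R v w → w ∈ t := by
    intro w hw hne hR
    by_contra hwt
    have := hge (M + 1) ⟨w :: v :: t, by simp [← hlen], by
      rw [List.nodup_cons]; exact ⟨by simp [hne, hwt], hn⟩, by
      rw [List.isChain_cons_cons]; exact ⟨hs _ _ hR, hc⟩, by
      intro x hx; rcases List.mem_cons.1 hx with rfl | hx
      · exact hw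
      · exact hl x hx⟩
    omega
  refine ⟨v, hl v (by simp), ?_⟩
  rcases last_split (fun w => R v w) t with h | ⟨t1, u, t2, rfl, hu, h2⟩
  · refine ⟨[v], ⟨v, [], rfl, by simp, Or.inl rfl⟩, ?_, by simp, ?_⟩
    · intro x hx; exact hl x (by simp at hx; simp [hx])
    · intro w hw hne hR; exact absurd hR (h w (hall w hw hne hR))
  · have e : v :: (t1 ++ u :: t2) = (v :: (t1 ++ [u])) ++ t2 := by simp
    rw [e] at hn hc hl
    refine ⟨v :: (t1 ++ [u]), ⟨v, t1 ++ [u], rfl, (List.nodup_append.1 hn).1, Or.inr ?_⟩, ?_, by simp, ?_⟩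
    · have hc1 := (List.isChain_append.1 hc).1
      rw [List.isChain_append]
      refine ⟨hc1, by simp, ?_⟩
      intro x hx y hy
      have : (v :: (t1 ++ [u])).getLast? = some u := by
        exact List.getLast?_concat (l := v :: t1)
      rw [this] at hx
      simp at hx hy
      subst hx hy
      exact hs _ _ hu
    · intro x hx; exact hl x (List.mem_append_left _ hx)
    · intro w hw hne hR
      have := hall w hw hne hR
      simp only [List.mem_append, List.mem_cons] at this ⊢
      rcases this with h | h | h
      · simp [h]
      · simp [h]
      · exact absurd hR (h2 w h)

theorem choose_g (H : V → V → Prop) (T : V → V → Finset V) (l : List V) (z : V) (k : ℕ)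
    (hn : l.Nodup) (hc : List.IsChain H (l ++ [z])) (hk : l.length ≤ k)
    (hT : ∀ u v, H u v → k ≤ (T u v).card) :
    ∃ g : V → V, List.IsChain (fun u v => u ∈ l ∧ H u v ∧ g u ∈ T u v) (l ++ [z]) ∧
      ∀ x ∈ l, ∀ y ∈ l, g x = g y → x = y := by
  induction l with
  | nil => exact ⟨id, by simp, by simp⟩
  | cons a l ih =>
    rw [List.nodup_cons] at hn
    obtain ⟨b, t, hbt⟩ : ∃ b t, l ++ [z] = b :: t := by
      cases l with
      | nil => exact ⟨z, [], rfl⟩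
      | cons b t => exact ⟨b, t ++ [z], rfl⟩
    rw [List.cons_append, hbt, List.isChain_cons_cons] at hc
    simp only [List.length_cons] at hk
    obtain ⟨g, hg, hinj⟩ := ih hn.2 (by rw [hbt]; exact hc.2) (by omega)
    have hlt : (l.toFinset.image g).card < (T a b).card := by
      have h1 := (Finset.card_image_le (s := l.toFinset) (f := g)).trans (List.toFinset_card_le l)
      have h2 := hT a b hc.1
      omega
    obtain ⟨x, hx, hx'⟩ := Finset.exists_mem_notMem_of_card_lt_card hlt
    have hne : ∀ u ∈ l, u ≠ a := fun u hu h => hn.1 (h ▸ hu)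
    refine ⟨Function.update g a x, ?_, ?_⟩
    · rw [List.cons_append, hbt, List.isChain_cons_cons]
      refine ⟨⟨by simp, hc.1, by simpa using hx⟩, ?_⟩
      rw [← hbt]
      refine hg.imp ?_
      rintro u v ⟨hu, h1, h2⟩
      refine ⟨List.mem_cons_of_mem _ hu, h1, ?_⟩
      rwa [Function.update_of_ne (hne u hu)]
    · have key : ∀ y ∈ l, x ≠ g y := by
        rintro y hy rfl
        exact hx' (Finset.mem_image_of_mem _ (by simpa using hy))
      intro y hy w hw he
      rcases List.mem_cons.1 hy with h1 | h1 <;> rcases List.mem_cons.1 hw with h2 | h2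
      · rw [h1, h2]
      · rw [h1, Function.update_self, Function.update_of_ne (hne w h2)] at he
        exact absurd he (key w h2)
      · rw [h2, Function.update_self, Function.update_of_ne (hne y h1)] at he
        exact absurd he.symm (key y h1)
      · rw [Function.update_of_ne (hne w h2), Function.update_of_ne (hne y h1)] at he
        exact hinj _ h1 _ h2 he

theorem interleave (Q R : V → V → Prop) (p : V → Prop) [DecidablePred p] (g : V → V) (l : List V) (z : V)
    (hQ : ∀ u v, Q u v → (¬ p u → R u v) ∧ (p u → R u (g u) ∧ R (g u) v))
    (hc : List.IsChain Q (l ++ [z])) :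
    List.IsChain R (l.flatMap (fun u => if p u then [u, g u] else [u]) ++ [z]) := by
  induction l with
  | nil => simp
  | cons a l ih =>
    obtain ⟨b, t, t', hbt, hbt'⟩ : ∃ b t t', l ++ [z] = b :: t ∧
        l.flatMap (fun u => if p u then [u, g u] else [u]) ++ [z] = b :: t' := by
      cases l with
      | nil => exact ⟨z, [], [], rfl, rfl⟩
      | cons b t =>
        refine ⟨b, t ++ [z], ?_⟩
        by_cases hb : p b <;> simp [hb]
    rw [List.cons_append, hbt, List.isChain_cons_cons] at hc
    have ih' := ih (by rw [hbt]; exact hc.2)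
    rw [List.flatMap_cons, List.append_assoc, hbt']
    rw [hbt'] at ih'
    have := hQ a b hc.1
    by_cases ha : p a
    · simp only [ha, if_true, List.cons_append, List.nil_append, List.isChain_cons_cons]
      exact ⟨(this.2 ha).1, (this.2 ha).2, ih'⟩
    · simp only [ha, if_false, List.cons_append, List.nil_append, List.isChain_cons_cons]
      exact ⟨this.1 ha, ih'⟩

theorem absorb (χ : V → V → ℕ) (c : ℕ) (H : V → V → Prop) (T : V → V → Finset V) (l : List V)
    (hl : CycL H l) (h2 : 2 ≤ l.length)
    (hT : ∀ u v, H u v → l.length ≤ (T u v).card)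
    (hd : ∀ u v, H u v → ∀ w ∈ T u v, w ∉ l ∧ χ u w = c ∧ χ w v = c) :
    ∃ A : Finset V, A.card = l.length ∧ (∀ x ∈ A, ∃ u v, u ∈ l ∧ H u v ∧ x ∈ T u v) ∧
      ∀ A' ⊆ A, (A' = A ∨ ∀ u v, H u v → χ u v = c) → MC χ (l.toFinset ∪ A') := by
  classical
  obtain ⟨a, t, rfl, hn, hc⟩ := hl
  have hc : List.IsChain H ((a :: t) ++ [a]) := by
    rcases hc with rfl | hc
    · simp at h2
    · exact hc
  obtain ⟨g, hg, hinj⟩ := choose_g H T (a :: t) a _ hn hc le_rfl hT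
  have hsucc : ∀ (l : List V) (z : V) (Q : V → V → Prop), List.IsChain Q (l ++ [z]) →
      ∀ x ∈ l, ∃ y, Q x y := by
    intro l z Q
    induction l with
    | nil => simp
    | cons a l ih =>
      intro h x hx
      obtain ⟨b, t, hbt⟩ : ∃ b t, l ++ [z] = b :: t := by
        cases l with
        | nil => exact ⟨z, [], rfl⟩
        | cons b t => exact ⟨b, t ++ [z], rfl⟩
      rw [List.cons_append, hbt, List.isChain_cons_cons] at h
      rcases List.mem_cons.1 hx with rfl | hx
      · exact ⟨b, h.1⟩
      · exact ih (by rw [hbt]; exact h.2) x hx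
  have hs := hsucc _ _ _ hg
  have hgl : ∀ x ∈ a :: t, g x ∉ a :: t := by
    intro x hx
    obtain ⟨y, -, h1, h3⟩ := hs x hx
    exact (hd _ _ h1 _ h3).1
  refine ⟨(a :: t).toFinset.image g, ?_, ?_, ?_⟩
  · rw [Finset.card_image_of_injOn, List.toFinset_card_of_nodup hn]
    intro x hx y hy h
    exact hinj x (by simpa using hx) y (by simpa using hy) h
  · intro x hx
    obtain ⟨u, hu, rfl⟩ := Finset.mem_image.1 hx
    obtain ⟨y, h1, h3, h4⟩ := hs u (by simpa using hu)
    exact ⟨u, y, h1, h3, h4⟩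
  · intro A' hA' hor
    let f : V → List V := fun u => if g u ∈ A' then [u, g u] else [u]
    have hf : ∀ u x, x ∈ f u → x = u ∨ (x = g u ∧ g u ∈ A') := by
      intro u x hx
      by_cases h : g u ∈ A' <;> simp [f, h] at hx <;> tauto
    have hnod : ((a :: t).flatMap f).Nodup := by
      rw [List.nodup_flatMap]
      refine ⟨?_, ?_⟩
      · intro x hx
        by_cases h : g x ∈ A'
        · simp only [f, h, if_true]
          simp only [List.nodup_cons, List.mem_singleton, List.not_mem_nil, not_false_eq_true, List.nodup_nil, and_self, and_true]
          intro h'; exact hgl x hx (h' ▸ hx)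
        · simp [f, h]
      · refine List.Pairwise.imp_of_mem ?_ hn
        intro x y hx hy hxy
        intro w hw hw'
        rcases hf _ _ hw with rfl | ⟨rfl, -⟩ <;> rcases hf _ _ hw' with h | ⟨h, -⟩
        · exact hxy h
        · exact hgl y hy (h ▸ hx)
        · exact hgl x hx (h ▸ hy)
        · exact hxy (hinj _ hx _ hy h)
    have hch : List.IsChain (fun u v => χ u v = c) ((a :: t).flatMap f ++ [a]) := by
      refine interleave _ _ (fun u => g u ∈ A') g _ _ ?_ hg
      rintro u v ⟨hu, h1, h3⟩
      refine ⟨fun hp => ?_, fun _ => (hd _ _ h1 _ h3).2⟩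
      rcases hor with rfl | hor
      · exact absurd (Finset.mem_image_of_mem g (by simpa using hu)) hp
      · exact hor _ _ h1
    obtain ⟨t', ht'⟩ : ∃ t', (a :: t).flatMap f = a :: t' := by
      rw [List.flatMap_cons]
      by_cases h : g a ∈ A' <;> simp [f, h]
    refine ⟨c, (a :: t).flatMap f, ?_, a, t', ht', hnod, Or.inr (ht' ▸ hch)⟩
    ext x
    simp only [List.mem_toFinset, List.mem_flatMap, Finset.mem_union]
    constructor
    · rintro ⟨u, hu, hx⟩
      rcases hf _ _ hx with rfl | ⟨rfl, h⟩
      · left; exact hu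
      · right; exact h
    · rintro (hx | hx)
      · exact ⟨x, hx, by by_cases h : g x ∈ A' <;> simp [f, h]⟩
      · obtain ⟨u, hu, rfl⟩ := Finset.mem_image.1 (hA' hx)
        exact ⟨u, by simpa using hu, by simp [f, hx]⟩

end LCP

namespace LCP
set_option linter.unusedSectionVars false
open Finset
variable {V : Type*} [DecidableEq V]

def deg (G : V → V → Prop) [DecidableRel G] (X : Finset V) (v : V) : ℕ := (X.filter (G v)).card
def ee (G : V → V → Prop) [DecidableRel G] (X : Finset V) : ℕ := ∑ v ∈ X, deg G X v

theorem ee_erase (G : V → V → Prop) [DecidableRel G] (hs : ∀ u v, G u v → G v u)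
    (X : Finset V) (v : V) (hv : v ∈ X) : ee G X ≤ ee G (X.erase v) + 2 * deg G X v := by
  have h1 : ee G X = deg G X v + ∑ u ∈ X.erase v, deg G X u := by
    unfold ee; rw [Finset.add_sum_erase _ _ hv]
  have h2 : ∀ u ∈ X.erase v, deg G X u ≤ deg G (X.erase v) u + if G u v then 1 else 0 := by
    intro u hu
    unfold deg
    rw [← Finset.insert_erase hv, Finset.filter_insert]
    split_ifs with h
    · refine (Finset.card_insert_le _ _).trans ?_
      simp
    · simp
  have h3 : ∑ u ∈ X.erase v, (if G u v then 1 else 0) ≤ deg G X v := by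
    rw [← Finset.card_filter]
    apply Finset.card_le_card
    intro u hu
    simp only [Finset.mem_filter, Finset.mem_erase] at hu ⊢
    exact ⟨hu.1.2, hs _ _ hu.2⟩
  have h4 := Finset.sum_le_sum h2
  rw [Finset.sum_add_distrib] at h4
  unfold ee at *
  omega

theorem min_deg (G : V → V → Prop) [DecidableRel G] (hs : ∀ u v, G u v → G v u) (q : ℝ)
    (X : Finset V) (h : q * X.card < ee G X) :
    ∃ Y ⊆ X, Y.Nonempty ∧ ∀ v ∈ Y, q ≤ 2 * (deg G Y v : ℝ) := by
  induction X using Finset.strongInduction with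
  | H X ih =>
    by_cases hall : ∀ v ∈ X, q ≤ 2 * (deg G X v : ℝ)
    · refine ⟨X, subset_rfl, ?_, hall⟩
      by_contra hne
      rw [Finset.not_nonempty_iff_eq_empty] at hne
      subst hne
      simp [ee] at h
    · push Not at hall
      obtain ⟨v, hv, hlt⟩ := hall
      have h1 := ee_erase G hs X v hv
      have h1' : (ee G X : ℝ) ≤ ee G (X.erase v) + 2 * deg G X v := by exact_mod_cast h1
      have h2 : ((X.erase v).card : ℝ) + 1 = X.card := by
        exact_mod_cast Finset.card_erase_add_one hv
      obtain ⟨Y, hY, h3⟩ := ih (X.erase v) (Finset.erase_ssubset hv) (by rw [← h2] at h; linarith)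
      exact ⟨Y, hY.trans (Finset.erase_subset _ _), h3⟩

/-- from average degree to a long cycle -/
theorem long_cycle (G : V → V → Prop) [DecidableRel G] (hs : ∀ u v, G u v → G v u)
    (hirr : ∀ u, ¬ G u u) (q : ℝ) (X : Finset V) (h : q * X.card < ee G X) :
    ∃ l, CycL G l ∧ (∀ x ∈ l, x ∈ X) ∧ q ≤ 2 * ((l.length : ℝ) - 1) := by
  obtain ⟨Y, hYX, hne, hd⟩ := min_deg G hs q X h
  obtain ⟨v, hv, l, hl, hlY, hvl, hN⟩ := exists_end_cycle G hs Y hne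
  refine ⟨l, hl, fun x hx => hYX (hlY x hx), (hd v hv).trans ?_⟩
  have : deg G Y v + 1 ≤ l.length := by
    have h1 : insert v (Y.filter (G v)) ⊆ l.toFinset := by
      intro w hw
      rw [Finset.mem_insert] at hw
      rcases hw with rfl | hw
      · simpa using hvl
      · rw [Finset.mem_filter] at hw
        have : w ≠ v := by rintro rfl; exact hirr _ hw.2
        simpa using hN w hw.1 this hw.2
    have h2 := (Finset.card_le_card h1).trans (List.toFinset_card_le l)
    rw [Finset.card_insert_of_notMem (by simp [hirr])] at h2
    exact h2
  have : (deg G Y v : ℝ) + 1 ≤ l.length := by exact_mod_cast this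
  linarith

theorem density (G : V → V → Prop) [DecidableRel G] (hs : ∀ u v, G u v → G v u) (ρ : ℝ)
    (X : Finset V) (h : ρ * (X.card * (X.card - 1)) ≤ ee G X) (m : ℕ) (hm1 : 1 ≤ m) (hm : m ≤ X.card) :
    ∃ Y ⊆ X, Y.card = m ∧ ρ * (m * (m - 1)) ≤ ee G Y := by
  induction X using Finset.strongInduction with
  | H X ih =>
    rcases hm.eq_or_lt with rfl | hlt
    · exact ⟨X, subset_rfl, rfl, h⟩
    · have hne : X.Nonempty := Finset.card_pos.1 (by omega)
      obtain ⟨v, hv, hmin⟩ := Finset.exists_min_image X (deg G X) hne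
      have h0 : X.card * deg G X v ≤ ee G X := by
        have := Finset.card_nsmul_le_sum X (deg G X) _ hmin
        simpa [ee] using this
      have h0' : (X.card : ℝ) * deg G X v ≤ ee G X := by exact_mod_cast h0
      have h1' : (ee G X : ℝ) ≤ ee G (X.erase v) + 2 * deg G X v := by
        exact_mod_cast ee_erase G hs X v hv
      have h2 : ((X.erase v).card : ℝ) = X.card - 1 := by
        have : ((X.erase v).card : ℝ) + 1 = X.card := by
          exact_mod_cast Finset.card_erase_add_one hv
        linarith
      have hx : (2 : ℝ) ≤ X.card := by exact_mod_cast (by omega : 2 ≤ X.card)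
      obtain ⟨Y, hY, h3⟩ := ih (X.erase v) (Finset.erase_ssubset hv) (by
        rw [h2]
        have hpos : (0 : ℝ) < X.card := by linarith
        refine le_of_mul_le_mul_left ?_ hpos
        have h5 : (X.card - 2 : ℝ) * (ρ * (X.card * (X.card - 1))) ≤ (X.card - 2 : ℝ) * ee G X :=
          mul_le_mul_of_nonneg_left h (by linarith)
        have h6 : (X.card : ℝ) * ee G X ≤ X.card * (ee G (X.erase v) + 2 * deg G X v) :=
          mul_le_mul_of_nonneg_left h1' hpos.le
        nlinarith) (by rw [Finset.card_erase_of_mem hv]; omega)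
      exact ⟨Y, hY.trans (Finset.erase_subset _ _), h3⟩

/-- pigeonhole over colours for local colourings -/
theorem colour_pigeon (χ : V → V → ℕ) (hsym : ∀ u v, χ u v = χ v u) (L : V → Finset ℕ) (r : ℕ)
    (hL : ∀ v, (L v).card ≤ r) (hχ : ∀ u v, u ≠ v → χ u v ∈ L u)
    (G : V → V → Prop) [DecidableRel G] (hirr : ∀ u, ¬ G u u) (q : ℝ) (hq : 0 ≤ q) (X : Finset V)
    (h : q * r * X.card < ee G X) :
    ∃ c, q * (X.filter (fun v => c ∈ L v)).card <
      ee (fun u v => G u v ∧ χ u v = c) (X.filter (fun v => c ∈ L v)) := by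
  by_contra hcon
  push Not at hcon
  let K := X.biUnion L
  have h1 : ee G X = ∑ c ∈ K, ee (fun u v => G u v ∧ χ u v = c) (X.filter (fun v => c ∈ L v)) := by
    unfold ee
    rw [Finset.sum_comm' (t' := X) (s' := fun v => L v)]
    · refine Finset.sum_congr rfl fun v hv => ?_
      unfold deg
      rw [← Finset.card_biUnion]
      · congr 1
        ext u
        simp only [mem_filter, mem_biUnion]
        constructor
        · rintro ⟨hu, hG⟩
          have hne : v ≠ u := by rintro rfl; exact hirr _ hG
          exact ⟨χ v u, hχ _ _ hne, ⟨hu, by rw [hsym]; exact hχ _ _ hne.symm⟩, hG, rfl⟩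
        · rintro ⟨c, _, ⟨hu, _⟩, hG, _⟩
          exact ⟨hu, hG⟩
      · intro c _ c' _ hne
        rw [Function.onFun, Finset.disjoint_left]
        intro u hu hu'
        simp only [mem_filter] at hu hu'
        exact hne (hu.2.2.symm.trans hu'.2.2)
    · intro c v
      simp only [K, mem_filter, mem_biUnion]
      constructor
      · rintro ⟨_, h1, h2⟩; exact ⟨h2, h1⟩
      · rintro ⟨h2, h1⟩; exact ⟨⟨v, h1, h2⟩, h1, h2⟩
  have h2 : ∑ c ∈ K, (X.filter (fun v => c ∈ L v)).card ≤ r * X.card := by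
    simp only [Finset.card_eq_sum_ones]
    rw [Finset.sum_comm' (t' := X) (s' := fun v => L v)]
    · calc ∑ v ∈ X, ∑ c ∈ L v, 1 ≤ ∑ v ∈ X, r := Finset.sum_le_sum fun v _ => by simpa using hL v
        _ = _ := by simp [mul_comm]
    · intro c v
      simp only [K, mem_filter, mem_biUnion]
      constructor
      · rintro ⟨_, h1, h2⟩; exact ⟨h2, h1⟩
      · rintro ⟨h2, h1⟩; exact ⟨⟨v, h1, h2⟩, h1, h2⟩
  have h3 : (ee G X : ℝ) ≤ ∑ c ∈ K, q * (X.filter (fun v => c ∈ L v)).card := by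
    rw [h1]; push_cast
    exact Finset.sum_le_sum fun c _ => hcon c
  rw [← Finset.mul_sum] at h3
  have h4 : (∑ c ∈ K, ((X.filter (fun v => c ∈ L v)).card : ℝ)) ≤ r * X.card := by exact_mod_cast h2
  have h5 := mul_le_mul_of_nonneg_left h4 hq
  nlinarith

theorem CycL.imp {R R' : V → V → Prop} {l : List V} (h : CycL R l) (hi : ∀ u v, R u v → R' u v) :
    CycL R' l := by
  obtain ⟨a, t, h1, h2, h3⟩ := h
  exact ⟨a, t, h1, h2, h3.imp id (fun h => h.imp (fun {_ _} => hi _ _))⟩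

/-- Step 2 -/
theorem large_mono (χ : V → V → ℕ) (hsym : ∀ u v, χ u v = χ v u) (L : V → Finset ℕ) (r : ℕ)
    (hr : 1 ≤ r)
    (hL : ∀ v, (L v).card ≤ r) (hχ : ∀ u v, u ≠ v → χ u v ∈ L u) (X : Finset V) (hX : X.Nonempty) :
    ∃ S ⊆ X, MC χ S ∧ X.card ≤ 4 * r * S.card := by
  have hr' : (1 : ℝ) ≤ r := by exact_mod_cast hr
  by_cases hx : X.card ≤ 4 * r
  · obtain ⟨v, hv⟩ := hX
    exact ⟨{v}, by simpa using hv, ⟨0, [v], by simp, v, [], rfl, by simp, Or.inl rfl⟩, by simpa using hx⟩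
  push Not at hx
  have hx' : (4 * r : ℝ) < X.card := by exact_mod_cast hx
  have he : (ee (fun u v : V => u ≠ v) X : ℝ) = X.card * (X.card - 1) := by
    have : ∀ v ∈ X, deg (fun u v : V => u ≠ v) X v = X.card - 1 := by
      intro v hv
      unfold deg
      rw [Finset.filter_ne, Finset.card_erase_of_mem hv]
    unfold ee
    rw [Finset.sum_congr rfl this, Finset.sum_const, smul_eq_mul, Nat.cast_mul, Nat.cast_sub (by omega)]
    simp
  obtain ⟨c, hc⟩ := colour_pigeon χ hsym L r hL hχ (fun u v => u ≠ v) (by simp) (X.card / (2 * r)) (by positivity) X (by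
    rw [he]
    have : (X.card : ℝ) / (2 * r) * r * X.card = X.card * (X.card / 2) := by field_simp
    rw [this]
    apply mul_lt_mul_of_pos_left <;> linarith)
  obtain ⟨l, hl, hlX, hlen⟩ := long_cycle _ (by
    rintro u v ⟨h1, h2⟩; exact ⟨h1.symm, by rw [hsym]; exact h2⟩) (by simp) _ _ hc
  have hnd : l.Nodup := by obtain ⟨_, _, _, h, _⟩ := hl; exact h
  refine ⟨l.toFinset, ?_, ⟨c, l, rfl, hl.imp fun u v h => h.2⟩, ?_⟩
  · intro x hx
    exact (Finset.mem_filter.1 (hlX x (by simpa using hx))).1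
  · rw [List.toFinset_card_of_nodup hnd]
    have : (X.card : ℝ) ≤ 4 * r * l.length := by
      rw [div_le_iff₀ (by positivity)] at hlen
      nlinarith
    exact_mod_cast this

end LCP

namespace LCP
set_option linter.unusedSectionVars false
open Finset
variable {V : Type*} [DecidableEq V]

inductive Cov (χ : V → V → ℕ) : ℕ → Finset V → Prop
  | nil (k : ℕ) : Cov χ k ∅
  | cons {k : ℕ} {S X : Finset V} : MC χ S → Disjoint S X → Cov χ k X → Cov χ (k + 1) (S ∪ X)

theorem Cov.union {χ : V → V → ℕ} {k m : ℕ} {X Y : Finset V} (hX : Cov χ k X) (hY : Cov χ m Y)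
    (hd : Disjoint X Y) : Cov χ (k + m) (X ∪ Y) := by
  induction hX with
  | nil k =>
    rw [Finset.empty_union]
    clear hd
    induction hY with
    | nil m => exact Cov.nil _
    | cons h1 h2 h3 ih => exact Cov.cons h1 h2 ih
  | cons h1 h2 h3 ih =>
    rw [Finset.disjoint_union_left] at hd
    rw [Finset.union_assoc, Nat.add_right_comm]
    exact Cov.cons h1 (Finset.disjoint_union_right.2 ⟨h2, hd.1⟩) (ih hd.2)

theorem greedy (χ : V → V → ℕ) (hsym : ∀ u v, χ u v = χ v u) (L : V → Finset ℕ) (r : ℕ)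
    (hr : 1 ≤ r)
    (hL : ∀ v, (L v).card ≤ r) (hχ : ∀ u v, u ≠ v → χ u v ∈ L u) (t : ℕ) (X : Finset V) :
    ∃ Y ⊆ X, Cov χ t (X \ Y) ∧ (Y.card : ℝ) ≤ (1 - 1 / (4 * r)) ^ t * X.card := by
  have hr' : (1 : ℝ) ≤ r := by exact_mod_cast hr
  have h0 : (0 : ℝ) ≤ 1 - 1 / (4 * r) := by
    rw [sub_nonneg, div_le_one (by positivity)]; linarith
  induction t generalizing X with
  | zero => exact ⟨X, subset_rfl, by simpa using Cov.nil 0, by simp⟩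
  | succ t ih =>
    rcases X.eq_empty_or_nonempty with rfl | hX
    · exact ⟨∅, subset_rfl, by simpa using Cov.nil _, by simp⟩
    obtain ⟨S, hS, hMC, hcard⟩ := large_mono χ hsym L r hr hL hχ X hX
    obtain ⟨Y, hY, hCov, hYc⟩ := ih (X \ S)
    refine ⟨Y, hY.trans Finset.sdiff_subset, ?_, ?_⟩
    · have : X \ Y = S ∪ ((X \ S) \ Y) := by
        ext x
        simp only [mem_sdiff, mem_union]
        constructor
        · rintro ⟨h1, h2⟩
          by_cases h : x ∈ S
          · exact Or.inl h
          · exact Or.inr ⟨⟨h1, h⟩, h2⟩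
        · rintro (h | h)
          · exact ⟨hS h, fun hy => (mem_sdiff.1 (hY hy)).2 h⟩
          · exact ⟨h.1.1, h.2⟩
      rw [this]
      refine Cov.cons hMC ?_ hCov
      rw [Finset.disjoint_left]
      intro x hx hx'
      simp only [mem_sdiff] at hx'
      exact hx'.1.2 hx
    · refine hYc.trans ?_
      rw [pow_succ, mul_assoc]
      refine mul_le_mul_of_nonneg_left ?_ (pow_nonneg h0 _)
      have h1 : ((X \ S).card : ℝ) + S.card = X.card := by
        exact_mod_cast Finset.card_sdiff_add_card_eq_card hS
      have h2 : (X.card : ℝ) ≤ 4 * r * S.card := by exact_mod_cast hcard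
      have h3 : (X.card : ℝ) / (4 * r) ≤ S.card := by
        rw [div_le_iff₀ (by positivity)]; linarith
      have : (1 - 1 / (4 * (r : ℝ))) * X.card = X.card - X.card / (4 * r) := by ring
      rw [this]; linarith

def comN (χ : V → V → ℕ) (c : ℕ) (A : Finset V) (u v : V) : Finset V :=
  A.filter (fun w => χ u w = c ∧ χ v w = c)

theorem posa_absorb (χ : V → V → ℕ) (hsym : ∀ u v, χ u v = χ v u) (c : ℕ) (A : Finset V) (y : ℕ)
    (α : ℕ) (B U : Finset V) (hd : Disjoint B A) (hc : U.card + B.card ≤ y)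
    (hZ : ∀ Z ⊆ B, (∀ u ∈ Z, ∀ v ∈ Z, u ≠ v → ¬ y ≤ (comN χ c A u v).card) → Z.card ≤ α) :
    ∃ A1 ⊆ A \ U, A1.card ≤ B.card ∧ Cov χ α (B ∪ A1) := by
  induction α generalizing B U with
  | zero =>
    rcases B.eq_empty_or_nonempty with rfl | ⟨b, hb⟩
    · exact ⟨∅, by simp, by simp, by simpa using Cov.nil _⟩
    · have := hZ {b} (by simpa using hb) (by simp)
      simp at this
  | succ α ih =>
    rcases B.eq_empty_or_nonempty with rfl | hB
    · exact ⟨∅, by simp, by simp, by simpa using Cov.nil _⟩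
    have hcs : ∀ u v, comN χ c A u v = comN χ c A v u := by
      intro u v; unfold comN; ext w; simp only [mem_filter]; tauto
    obtain ⟨v, hv, l, hl, hlB, hvl, hN⟩ := exists_end_cycle
      (fun u v => y ≤ (comN χ c A u v).card) (by intro u v h; rw [hcs]; exact h) B hB
    have hnd : l.Nodup := by obtain ⟨_, _, _, h, _⟩ := hl; exact h
    have hlB' : l.toFinset ⊆ B := fun x hx => hlB x (by simpa using hx)
    have hlc : l.toFinset.card = l.length := List.toFinset_card_of_nodup hnd
    have hle := Finset.card_le_card hlB'
    obtain ⟨A0, hA0, hA0c, hMC⟩ : ∃ A0 ⊆ A \ U, A0.card ≤ l.length ∧ MC χ (l.toFinset ∪ A0) := by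
      by_cases h2 : 2 ≤ l.length
      · obtain ⟨A0, h3, h4, h5⟩ := absorb χ c _ (fun u v => comN χ c A u v \ U) l hl h2 (by
          intro u v h
          have := Finset.le_card_sdiff U (comN χ c A u v)
          omega) (by
          intro u v h w hw
          simp only [comN, mem_sdiff, mem_filter] at hw
          refine ⟨fun hwl => Finset.disjoint_left.1 hd (hlB w hwl) hw.1.1, hw.1.2.1, ?_⟩
          rw [hsym]; exact hw.1.2.2)
        refine ⟨A0, ?_, h3.le, h5 A0 subset_rfl (Or.inl rfl)⟩
        intro x hx
        obtain ⟨u, w, _, _, hx⟩ := h4 x hx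
        simp only [comN, mem_sdiff, mem_filter] at hx ⊢
        exact ⟨hx.1.1, hx.2⟩
      · refine ⟨∅, by simp, by simp, ?_⟩
        obtain ⟨a, t, rfl, h4, h5⟩ := hl
        have : t = [] := by
          cases t with
          | nil => rfl
          | cons _ _ => simp at h2
        subst this
        exact ⟨0, [a], by simp, a, [], rfl, by simp, Or.inl rfl⟩
    have hBc : (B \ l.toFinset).card + l.toFinset.card = B.card :=
      Finset.card_sdiff_add_card_eq_card hlB'
    obtain ⟨A1, hA1, hA1c, hCov⟩ := ih (B \ l.toFinset) (U ∪ A0)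
      (hd.mono_left Finset.sdiff_subset) (by
        have := Finset.card_union_le U A0
        omega) (by
        intro Z hZB hind
        have hvZ : v ∉ Z := fun h => (mem_sdiff.1 (hZB h)).2 (by simpa using hvl)
        have hnon : ∀ w ∈ Z, ¬ y ≤ (comN χ c A v w).card := by
          intro w hw h
          have h1 := mem_sdiff.1 (hZB hw)
          exact h1.2 (by simpa using hN w h1.1 (by rintro rfl; exact hvZ hw) h)
        have := hZ (insert v Z) (by
          intro x hx
          rcases mem_insert.1 hx with rfl | hx
          · exact hv
          · exact (mem_sdiff.1 (hZB hx)).1) (by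
          intro x hx w hw hne
          rcases mem_insert.1 hx with h1 | h1 <;> rcases mem_insert.1 hw with h2 | h2
          · exact absurd (h1.trans h2.symm) hne
          · rw [h1]; exact hnon w h2
          · rw [h2, hcs]; exact hnon x h1
          · exact hind x h1 w h2 hne)
        rw [Finset.card_insert_of_notMem hvZ] at this
        omega)
    refine ⟨A0 ∪ A1, ?_, ?_, ?_⟩
    · refine Finset.union_subset hA0 (hA1.trans ?_)
      intro x hx
      simp only [mem_sdiff, mem_union] at hx ⊢
      tauto
    · have := Finset.card_union_le A0 A1
      omega
    · have : B ∪ (A0 ∪ A1) = (l.toFinset ∪ A0) ∪ ((B \ l.toFinset) ∪ A1) := by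
        ext x
        have := @hlB' x
        simp only [mem_union, mem_sdiff]
        tauto
      rw [this]
      refine Cov.cons hMC ?_ hCov
      rw [Finset.disjoint_left]
      intro x hx hx'
      have h1 := @hlB' x
      have h2 := @hA0 x
      have h3 := @hA1 x
      have h4 : x ∈ B → x ∉ A := fun h => Finset.disjoint_left.1 hd h
      simp only [mem_union, mem_sdiff] at *
      tauto

theorem colours_absorb (χ : V → V → ℕ) (hsym : ∀ u v, χ u v = χ v u) (A : Finset V) (y : ℕ)
    (col : V → ℕ) (α : ℕ → ℕ) (I : Finset ℕ) :
    ∀ (B U : Finset V), (∀ b ∈ B, col b ∈ I) → Disjoint B A → U.card + B.card ≤ y →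
    (∀ i ∈ I, ∀ Z ⊆ B.filter (fun b => col b = i),
      (∀ u ∈ Z, ∀ v ∈ Z, u ≠ v → ¬ y ≤ (comN χ i A u v).card) → Z.card ≤ α i) →
    ∃ A1 ⊆ A \ U, A1.card ≤ B.card ∧ Cov χ (∑ i ∈ I, α i) (B ∪ A1) := by
  induction I using Finset.induction_on with
  | empty =>
    intro B U hB _ _ _
    have : B = ∅ := Finset.eq_empty_of_forall_notMem (fun b hb => by simpa using hB b hb)
    subst this
    exact ⟨∅, by simp, by simp, by simpa using Cov.nil _⟩
  | insert i I hi ih =>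
    intro B U hB hd hc hZ
    have hcard := Finset.card_filter_add_card_filter_not (s := B) (fun b => col b = i)
    obtain ⟨A0, h1, h2, h3⟩ := posa_absorb χ hsym i A y (α i) (B.filter (fun b => col b = i)) U
      (hd.mono_left (Finset.filter_subset _ _)) (by omega) (hZ i (by simp))
    obtain ⟨A1, h4, h5, h6⟩ := ih (B.filter (fun b => ¬ col b = i)) (U ∪ A0) (by
        intro b hb
        rw [mem_filter] at hb
        exact (mem_insert.1 (hB b hb.1)).resolve_left hb.2)
      (hd.mono_left (Finset.filter_subset _ _)) (by
        have := Finset.card_union_le U A0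
        omega) (by
        intro j hj Z hZB
        refine hZ j (mem_insert_of_mem hj) Z (hZB.trans ?_)
        intro x; simp only [mem_filter]; tauto)
    refine ⟨A0 ∪ A1, ?_, ?_, ?_⟩
    · refine Finset.union_subset h1 (h4.trans ?_)
      intro x hx
      simp only [mem_sdiff, mem_union] at hx ⊢
      tauto
    · have := Finset.card_union_le A0 A1
      omega
    · rw [Finset.sum_insert hi]
      have : B ∪ (A0 ∪ A1) = (B.filter (fun b => col b = i) ∪ A0) ∪
          (B.filter (fun b => ¬ col b = i) ∪ A1) := by
        ext x
        simp only [mem_union, mem_filter]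
        tauto
      rw [this]
      refine h3.union h6 ?_
      rw [Finset.disjoint_left]
      intro x hx hx'
      have h1 := @h1 x
      have h3 := @h4 x
      have h4 : x ∈ B → x ∉ A := fun h => Finset.disjoint_left.1 hd h
      simp only [mem_union, mem_sdiff, mem_filter] at *
      tauto

theorem union_bound (N : V → Finset V) (p y : ℝ) (z : ℕ) (hy : 0 ≤ y) (Z : Finset V) (hz : Z.card ≤ z)
    (hp : ∀ b ∈ Z, p ≤ (N b).card)
    (hi : ∀ u ∈ Z, ∀ v ∈ Z, u ≠ v → ((N u ∩ N v).card : ℝ) ≤ y) :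
    Z.card * (p - z * y) ≤ (Z.biUnion N).card := by
  induction Z using Finset.induction_on with
  | empty => simp
  | insert b Z hb ih =>
    rw [Finset.card_insert_of_notMem hb] at hz
    have ih' := ih (by omega) (fun b hb => hp b (mem_insert_of_mem hb))
      (fun u hu v hv => hi u (mem_insert_of_mem hu) v (mem_insert_of_mem hv))
    rw [Finset.card_insert_of_notMem hb, Finset.biUnion_insert]
    have h1 : ((N b ∪ Z.biUnion N).card : ℝ) + (N b ∩ Z.biUnion N).card =
        (N b).card + (Z.biUnion N).card := by
      exact_mod_cast Finset.card_union_add_card_inter _ _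
    have h2 : ((N b ∩ Z.biUnion N).card : ℝ) ≤ z * y := by
      have h3 : (N b ∩ Z.biUnion N).card ≤ ∑ v ∈ Z, (N b ∩ N v).card := by
        rw [Finset.inter_biUnion]
        exact Finset.card_biUnion_le
      have h4 : ∑ v ∈ Z, ((N b ∩ N v).card : ℝ) ≤ ∑ v ∈ Z, y :=
        Finset.sum_le_sum fun v hv => hi b (by simp) v (mem_insert_of_mem hv)
          (by rintro rfl; exact hb hv)
      rw [Finset.sum_const, nsmul_eq_mul] at h4
      have h3' : ((N b ∩ Z.biUnion N).card : ℝ) ≤ ∑ v ∈ Z, ((N b ∩ N v).card : ℝ) := by exact_mod_cast h3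
      have h5 : (Z.card : ℝ) ≤ z := by exact_mod_cast (by omega)
      have := mul_le_mul_of_nonneg_right h5 hy
      linarith
    have h6 := hp b (by simp)
    push_cast
    linarith

theorem pigeon (S : Finset V) (hS : S.Nonempty) (f : V → ℕ) (J : Finset ℕ) (r : ℕ) (hJ : J.card ≤ r)
    (hf : ∀ s ∈ S, f s ∈ J) : ∃ c ∈ J, S.card ≤ r * (S.filter (fun s => f s = c)).card := by
  by_contra hcon
  push Not at hcon
  have h1 := Finset.card_eq_sum_card_fiberwise (f := f) (s := S) (t := J) hf
  have hJne : J.Nonempty := by obtain ⟨s, hs⟩ := hS; exact ⟨_, hf s hs⟩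
  have h2 : ∑ c ∈ J, r * (S.filter (fun s => f s = c)).card < ∑ c ∈ J, S.card :=
    Finset.sum_lt_sum_of_nonempty hJne hcon
  rw [← Finset.mul_sum, ← h1, Finset.sum_const, smul_eq_mul] at h2
  have := Nat.mul_le_mul_right S.card hJ
  omega

theorem sum_class (L : V → Finset ℕ) (r : ℕ) (hL : ∀ v, (L v).card ≤ r) (K : Finset ℕ) (X : Finset V) :
    ∑ c ∈ K, (X.filter (fun v => c ∈ L v)).card ≤ r * X.card := by
  simp only [Finset.card_filter]
  rw [Finset.sum_comm]
  calc ∑ v ∈ X, ∑ c ∈ K, (if c ∈ L v then 1 else 0) ≤ ∑ v ∈ X, r := by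
        refine Finset.sum_le_sum fun v _ => ?_
        rw [← Finset.card_filter]
        refine (Finset.card_le_card ?_).trans (hL v)
        intro c hc; exact (mem_filter.1 hc).2
    _ = _ := by simp [mul_comm]

theorem step3 (χ : V → V → ℕ) (hsym : ∀ u v, χ u v = χ v u) (L : V → Finset ℕ) (r : ℕ)
    (hr : 1 ≤ r) (hL : ∀ v, (L v).card ≤ r) (hχ : ∀ u v, u ≠ v → χ u v ∈ L u)
    (A B : Finset V) (hd : Disjoint B A) (hAB : 6 * r ^ 2 * B.card ≤ A.card) :
    ∃ A1 ⊆ A, Cov χ (2 * r ^ 2) (B ∪ A1) := by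
  rcases B.eq_empty_or_nonempty with rfl | hB
  · exact ⟨∅, by simp, by simpa using Cov.nil _⟩
  have hBpos := Finset.card_pos.2 hB
  have hApos : 0 < A.card := lt_of_lt_of_le (by positivity) hAB
  have hr' : (1 : ℝ) ≤ r := by exact_mod_cast hr
  have hmaj : ∀ b, ∃ c, b ∈ B → A.card ≤ r * (A.filter (fun w => χ b w = c)).card := by
    intro b
    by_cases hb : b ∈ B
    · obtain ⟨c, -, hc⟩ := pigeon A (Finset.card_pos.1 hApos) (χ b) (L b) r (hL b) (by
        intro w hw
        apply hχ
        rintro rfl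
        exact Finset.disjoint_left.1 hd hb hw)
      exact ⟨c, fun _ => hc⟩
    · exact ⟨0, fun h => absurd h hb⟩
  choose col hcol using hmaj
  obtain ⟨A1, h1, -, h3⟩ := colours_absorb χ hsym A B.card col
    (fun i => (2 * r * (A.filter (fun v => i ∈ L v)).card) / A.card) (B.image col) B ∅
    (fun b hb => mem_image_of_mem _ hb) hd (by simp) (by
      intro i _ 
      have key : ∀ Z ⊆ B.filter (fun b => col b = i), 
        (∀ u ∈ Z, ∀ v ∈ Z, u ≠ v → ¬ B.card ≤ (comN χ i A u v).card) → Z.card ≤ 2 * r + 1 → 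
          Z.card * A.card ≤ 2 * r * (A.filter (fun v => i ∈ L v)).card := by
        intro Z hZ hind hz
        have h1 := union_bound (fun b => A.filter (fun w => χ b w = i)) (A.card / r) B.card (2 * r + 1)
          (by positivity) Z hz (by
            intro b hb
            have hb' := mem_filter.1 (hZ hb)
            have := hcol b hb'.1
            rw [hb'.2] at this
            rw [div_le_iff₀ (by positivity), mul_comm]
            exact_mod_cast this) (by
            intro u hu v hv hne
            have := hind u hu v hv hne
            have e : A.filter (fun w => χ u w = i) ∩ A.filter (fun w => χ v w = i) = comN χ i A u v := by
              ext w; simp only [comN, mem_inter, mem_filter]; tauto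
            rw [e]
            exact_mod_cast (by omega : (comN χ i A u v).card ≤ B.card))
        have h2 : (Z.biUnion (fun b => A.filter (fun w => χ b w = i))).card ≤ (A.filter (fun v => i ∈ L v)).card := by
          apply Finset.card_le_card
          intro w hw
          simp only [mem_biUnion, mem_filter] at hw ⊢
          obtain ⟨b, hb, hw, he⟩ := hw
          refine ⟨hw, ?_⟩
          rw [← he, hsym]
          apply hχ
          rintro rfl
          exact Finset.disjoint_left.1 hd (mem_filter.1 (hZ hb)).1 hw
        have h2' : ((Z.biUnion (fun b => A.filter (fun w => χ b w = i))).card : ℝ) ≤ (A.filter (fun v => i ∈ L v)).card := by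
          exact_mod_cast h2
        have h3 : (6 * r ^ 2 * B.card : ℝ) ≤ A.card := by exact_mod_cast hAB
        have h4 : ((2 * r + 1 : ℕ) : ℝ) * B.card ≤ A.card / (2 * r) := by
          rw [le_div_iff₀ (by positivity)]
          push_cast
          have : (0 : ℝ) ≤ B.card := by positivity
          nlinarith [mul_nonneg this (by nlinarith : (0 : ℝ) ≤ (r : ℝ) ^ 2 - r)]
        have h5 : (A.card : ℝ) / r = A.card / (2 * r) + A.card / (2 * r) := by field_simp; ring
        have h6 : (Z.card : ℝ) * (A.card / (2 * r)) ≤ Z.card * (A.card / r - ((2 * r + 1 : ℕ) : ℝ) * B.card) :=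
          mul_le_mul_of_nonneg_left (by linarith) (by positivity)
        have h7 : (Z.card : ℝ) * (A.card / (2 * r)) ≤ (A.filter (fun v => i ∈ L v)).card := by linarith
        rw [← mul_div_assoc, div_le_iff₀ (by positivity)] at h7
        have : (Z.card * A.card : ℝ) ≤ 2 * r * (A.filter (fun v => i ∈ L v)).card := by linarith
        exact_mod_cast this
      intro Z hZ hind
      have hAi : (A.filter (fun v => i ∈ L v)).card ≤ A.card := Finset.card_le_card (Finset.filter_subset _ _)
      rw [Nat.le_div_iff_mul_le hApos]
      by_cases hz : Z.card ≤ 2 * r + 1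
      · exact key Z hZ hind hz
      · exfalso
        obtain ⟨Z', hZ', hc⟩ := Finset.exists_subset_card_eq (show 2 * r + 1 ≤ Z.card by omega)
        have := key Z' (hZ'.trans hZ) (fun u hu v hv => hind u (hZ' hu) v (hZ' hv)) hc.le
        rw [hc] at this
        have h8 := Nat.mul_le_mul_left (2 * r) hAi
        nlinarith)
  refine ⟨A1, h1.trans Finset.sdiff_subset, ?_⟩
  have hsum : ∑ i ∈ B.image col, (2 * r * (A.filter (fun v => i ∈ L v)).card) / A.card ≤ 2 * r ^ 2 := by
    refine Nat.le_of_mul_le_mul_right ?_ hApos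
    rw [Finset.sum_mul]
    calc _ ≤ ∑ i ∈ B.image col, 2 * r * (A.filter (fun v => i ∈ L v)).card :=
          Finset.sum_le_sum fun i _ => Nat.div_mul_le_self _ _
      _ = 2 * r * ∑ i ∈ B.image col, (A.filter (fun v => i ∈ L v)).card := by rw [Finset.mul_sum]
      _ ≤ 2 * r * (r * A.card) := Nat.mul_le_mul_left _ (sum_class L r hL _ A)
      _ = _ := by ring
  have := h3.union (Cov.nil (χ := χ) (2 * r ^ 2 - ∑ i ∈ B.image col, (2 * r * (A.filter (fun v => i ∈ L v)).card) / A.card)) (by simp)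
  rwa [Finset.union_empty, Nat.add_sub_cancel' hsum] at this

end LCP

namespace LCP
set_option linter.unusedSectionVars false
open Finset
variable {V : Type*} [DecidableEq V]

theorem ee_mono (G : V → V → Prop) [DecidableRel G] {X Y : Finset V} (h : X ⊆ Y) : ee G X ≤ ee G Y := by
  unfold ee
  calc ∑ v ∈ X, deg G X v ≤ ∑ v ∈ X, deg G Y v :=
        Finset.sum_le_sum fun v _ => Finset.card_le_card (Finset.filter_subset_filter _ h)
    _ ≤ _ := Finset.sum_le_sum_of_subset h

theorem ramsey_step (χ : V → V → ℕ) (L : V → Finset ℕ) (r : ℕ)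
    (hr : 1 ≤ r) (hL : ∀ v, (L v).card ≤ r) (hχ : ∀ u v, u ≠ v → χ u v ∈ L u)
    (D τ : ℝ) (hD : 0 ≤ D) (hτ4 : 4 ≤ τ) (hτ : 4 * r * D ≤ τ ^ 2)
    (K : Finset ℕ) (X : Finset V) (hKL : ∀ v ∈ X, K ⊆ L v)
    (hee : (ee (fun u w => u ≠ w ∧ χ u w ∈ K) X : ℝ) ≤ K.card * D) (hx : τ ≤ X.card) :
    ∃ v ∈ X, ∃ c ∈ L v \ K, (X.card : ℝ) ≤ 2 * r * (X.filter (fun u => u ≠ v ∧ χ v u = c)).card := by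
  have hr' : (1 : ℝ) ≤ r := by exact_mod_cast hr
  have hne : X.Nonempty := by
    rw [← Finset.card_pos]
    have : (0 : ℝ) < X.card := by linarith
    exact_mod_cast this
  obtain ⟨v, hv, hmin⟩ := Finset.exists_min_image X (deg (fun u w => u ≠ w ∧ χ u w ∈ K) X) hne
  set d := deg (fun u w => u ≠ w ∧ χ u w ∈ K) X v with hd
  have h0 : X.card * d ≤ ee (fun u w => u ≠ w ∧ χ u w ∈ K) X := by
    have := Finset.card_nsmul_le_sum X (deg (fun u w => u ≠ w ∧ χ u w ∈ K) X) _ hmin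
    simpa [ee] using this
  have h0' : (X.card : ℝ) * d ≤ ee (fun u w => u ≠ w ∧ χ u w ∈ K) X := by exact_mod_cast h0
  have hK : (K.card : ℝ) ≤ r := by exact_mod_cast (Finset.card_le_card (hKL v hv)).trans (hL v)
  have h1 : (d : ℝ) ≤ X.card / 4 := by
    have h2 : (X.card : ℝ) * d ≤ X.card * (X.card / 4) := by
      have := mul_le_mul_of_nonneg_right hK hD
      nlinarith
    exact le_of_mul_le_mul_left h2 (by linarith)
  set N := X.filter (fun u => u ≠ v ∧ χ v u ∉ K) with hN
  have hcount : X.card ≤ 1 + d + N.card := by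
    have : X ⊆ ({v} ∪ X.filter (fun w => v ≠ w ∧ χ v w ∈ K)) ∪ N := by
      intro w hw
      by_cases h : w = v
      · simp [h]
      · by_cases h' : χ v w ∈ K
        · simp only [mem_union, mem_filter]
          exact Or.inl (Or.inr ⟨hw, fun e => h e.symm, h'⟩)
        · simp only [mem_union, hN, mem_filter]
          exact Or.inr ⟨hw, h, h'⟩
    refine (Finset.card_le_card this).trans ((Finset.card_union_le _ _).trans ?_)
    gcongr
    refine (Finset.card_union_le _ _).trans ?_
    simp [hd, deg]
  have hcount' : (X.card : ℝ) ≤ 1 + d + N.card := by exact_mod_cast hcount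
  have hNc : (X.card : ℝ) / 2 ≤ N.card := by linarith
  have hNne : N.Nonempty := by
    rw [← Finset.card_pos]
    have : (0 : ℝ) < N.card := by linarith
    exact_mod_cast this
  obtain ⟨c, hc, hcc⟩ := pigeon N hNne (χ v) (L v \ K) r
    ((Finset.card_le_card Finset.sdiff_subset).trans (hL v)) (by
      intro u hu
      simp only [hN, mem_filter] at hu
      exact mem_sdiff.2 ⟨hχ _ _ (Ne.symm hu.2.1), hu.2.2⟩)
  refine ⟨v, hv, c, hc, ?_⟩
  have h5 : (N.filter (fun s => χ v s = c)).card ≤ (X.filter (fun u => u ≠ v ∧ χ v u = c)).card := by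
    apply Finset.card_le_card
    intro u hu
    simp only [hN, mem_filter] at hu ⊢
    exact ⟨hu.1.1, hu.1.2.1, hu.2⟩
  have h6 : (N.card : ℝ) ≤ r * (X.filter (fun u => u ≠ v ∧ χ v u = c)).card := by
    exact_mod_cast hcc.trans (Nat.mul_le_mul_left r h5)
  linarith

theorem ramsey (χ : V → V → ℕ) (hsym : ∀ u v, χ u v = χ v u) (L : V → Finset ℕ) (r : ℕ)
    (hr : 1 ≤ r) (hL : ∀ v, (L v).card ≤ r) (hχ : ∀ u v, u ≠ v → χ u v ∈ L u)
    (V' : Finset V) (D τ : ℝ) (hD : 0 ≤ D) (hτ4 : 4 ≤ τ) (hτ : 4 * r * D ≤ τ ^ 2)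
    (hV : ∀ v ∈ V', ∀ c, (ee (fun u w => u ≠ w ∧ χ u w = c) (V'.filter (fun u => u ≠ v ∧ χ v u = c)) : ℝ) ≤ D)
    (i : ℕ) : ∀ (K : Finset ℕ) (X : Finset V), X ⊆ V' → r ≤ K.card + i → (∀ v ∈ X, K ⊆ L v) →
      (ee (fun u w => u ≠ w ∧ χ u w ∈ K) X : ℝ) ≤ K.card * D → (X.card : ℝ) < (2 * r) ^ i * τ := by
  have hr' : (1 : ℝ) ≤ r := by exact_mod_cast hr
  induction i with
  | zero =>
    intro K X hXV hK hKL hee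
    by_contra hcon
    push Not at hcon
    have hx : τ ≤ X.card := by simpa using hcon
    obtain ⟨v, hv, c, hc, -⟩ := ramsey_step χ L r hr hL hχ D τ hD hτ4 hτ K X hKL hee hx
    have := Finset.eq_of_subset_of_card_le (hKL v hv) ((hL v).trans (by omega))
    rw [mem_sdiff, this] at hc
    exact hc.2 hc.1
  | succ i ih =>
    intro K X hXV hK hKL hee
    by_contra hcon
    push Not at hcon
    have hx : τ ≤ X.card := by
      refine le_trans ?_ hcon
      have : (1 : ℝ) ≤ (2 * r) ^ (i + 1) := one_le_pow₀ (by linarith)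
      nlinarith
    obtain ⟨v, hv, c, hc, hcard⟩ := ramsey_step χ L r hr hL hχ D τ hD hτ4 hτ K X hKL hee hx
    rw [mem_sdiff] at hc
    set N := X.filter (fun u => u ≠ v ∧ χ v u = c) with hN
    have := ih (insert c K) N ((Finset.filter_subset _ _).trans hXV)
      (by rw [Finset.card_insert_of_notMem hc.2]; omega) (by
        intro u hu
        simp only [hN, mem_filter] at hu
        refine Finset.insert_subset ?_ (hKL u hu.1)
        rw [← hu.2.2, hsym]
        exact hχ _ _ hu.2.1) (by
        have h1 : ee (fun u w => u ≠ w ∧ χ u w ∈ insert c K) N ≤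
            ee (fun u w => u ≠ w ∧ χ u w ∈ K) N + ee (fun u w => u ≠ w ∧ χ u w = c) N := by
          unfold ee
          rw [← Finset.sum_add_distrib]
          refine Finset.sum_le_sum fun u _ => ?_
          unfold deg
          refine (Finset.card_le_card ?_).trans (Finset.card_union_le _ _)
          intro w
          simp only [mem_filter, mem_union, mem_insert]
          tauto
        have h2 := ee_mono (fun u w => u ≠ w ∧ χ u w ∈ K) (show N ⊆ X from Finset.filter_subset _ _)
        have h3 := ee_mono (fun u w => u ≠ w ∧ χ u w = c)
          (show N ⊆ V'.filter (fun u => u ≠ v ∧ χ v u = c) from Finset.filter_subset_filter _ hXV)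
        have h4 := hV v (hXV hv) c
        rw [Finset.card_insert_of_notMem hc.2]
        have h1' : (ee (fun u w => u ≠ w ∧ χ u w ∈ insert c K) N : ℝ) ≤
          ee (fun u w => u ≠ w ∧ χ u w ∈ K) N + ee (fun u w => u ≠ w ∧ χ u w = c) N := by exact_mod_cast h1
        have h2' : (ee (fun u w => u ≠ w ∧ χ u w ∈ K) N : ℝ) ≤ ee (fun u w => u ≠ w ∧ χ u w ∈ K) X := by
          exact_mod_cast h2
        have h3' : (ee (fun u w => u ≠ w ∧ χ u w = c) N : ℝ) ≤ 
          ee (fun u w => u ≠ w ∧ χ u w = c) (V'.filter (fun u => u ≠ v ∧ χ v u = c)) := by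
          exact_mod_cast h3
        push_cast
        linarith)
    have h7 : 2 * r * (N.card : ℝ) < 2 * r * ((2 * r) ^ i * τ) :=
      mul_lt_mul_of_pos_left this (by linarith)
    rw [pow_succ] at hcon
    nlinarith

section
variable [Fintype V]

def comm (χ : V → V → ℕ) (u v : V) : Finset V :=
  univ.filter (fun w => w ≠ u ∧ w ≠ v ∧ χ u w = χ u v ∧ χ v w = χ u v)

theorem step1 (χ : V → V → ℕ) (hsym : ∀ u v, χ u v = χ v u) (L : V → Finset ℕ) (r : ℕ)
    (hr : 2 ≤ r) (hL : ∀ v, (L v).card ≤ r) (hχ : ∀ u v, u ≠ v → χ u v ∈ L u)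
    (W n : ℝ) (hW : W = (2 * r) ^ r) (hn : n = Fintype.card V)
    (hbig : 1024 * r ^ 2 * W ^ 2 ≤ n) :
    ∃ S A : Finset V, Disjoint S A ∧ n ≤ 2 ^ 19 * r ^ 4 * W ^ 4 * A.card ∧
      ∀ A' ⊆ A, MC χ (S ∪ A') := by
  classical
  have hr' : (2 : ℝ) ≤ r := by exact_mod_cast hr
  have hW1 : 1 ≤ W := by rw [hW]; exact one_le_pow₀ (by linarith)
  have hWpos : 0 < W := by linarith
  have hrpos : (0 : ℝ) < r := by linarith
  have hnpos : 0 < n := lt_of_lt_of_le (by positivity) hbig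
  obtain ⟨κ, hκ⟩ : ∃ κ, κ = n / (128 * r * W ^ 2) := ⟨_, rfl⟩
  have hκpos : 0 < κ := by rw [hκ]; positivity
  have hcs : ∀ u v, comm χ u v = comm χ v u := by
    intro u v; unfold comm; ext w; simp only [mem_filter, hsym v u]; tauto
  let Hv : V → V → Prop := fun u v => u ≠ v ∧ κ ≤ (comm χ u v).card
  have hHs : ∀ u v, Hv u v → Hv v u := by
    rintro u v ⟨h1, h2⟩; exact ⟨h1.symm, by rw [hcs]; exact h2⟩
  let V' : Finset V := univ.filter (fun v => (deg Hv univ v : ℝ) ≤ κ)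
  have hV'lt : (V'.card : ℝ) < n / 2 := by
    have := ramsey χ hsym L r (by omega) hL hχ V' (2 * κ * n) (n / (2 * W)) (by positivity)
      (by 
        rw [le_div_iff₀ (by positivity)]
        refine le_trans ?_ hbig
        have : W ≤ W ^ 2 := by nlinarith
        have : 1 ≤ (r : ℝ) ^ 2 := by nlinarith
        nlinarith)
      (by
        have e1 : 4 * r * (2 * κ * n) = n ^ 2 / (16 * W ^ 2) := by rw [hκ]; field_simp; norm_num
        have e2 : (n / (2 * W)) ^ 2 = n ^ 2 / (4 * W ^ 2) := by field_simp; norm_num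
        rw [e1, e2]
        gcongr; norm_num)
      (by
        intro v hv c
        set M := V'.filter (fun u => u ≠ v ∧ χ v u = c) with hM
        have hb : ∀ u ∈ M, (deg (fun u w => u ≠ w ∧ χ u w = c) M u : ℝ) ≤ κ + n * (if Hv v u then 1 else 0) := by
          intro u hu
          have hu' := (mem_filter.1 hu).2
          have h1 : deg (fun u w => u ≠ w ∧ χ u w = c) M u ≤ (comm χ v u).card := by
            apply Finset.card_le_card
            intro w hw
            simp only [hM, mem_filter, comm, mem_univ, true_and] at hw ⊢
            refine ⟨hw.1.2.1, hw.2.1.symm, ?_, ?_⟩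
            · rw [hw.1.2.2, hu'.2]
            · rw [hw.2.2, hu'.2]
          have h1' : (deg (fun u w => u ≠ w ∧ χ u w = c) M u : ℝ) ≤ (comm χ v u).card := by exact_mod_cast h1
          split_ifs with h
          · have : ((comm χ v u).card : ℝ) ≤ n := by
              rw [hn]; exact_mod_cast Finset.card_le_univ _
            linarith
          · have : (comm χ v u).card < κ := by
              by_contra hc
              exact h ⟨hu'.1.symm, not_lt.1 hc⟩
            linarith
        have h2 : (ee (fun u w => u ≠ w ∧ χ u w = c) M : ℝ) ≤ ∑ u ∈ M, (κ + n * (if Hv v u then 1 else 0)) := by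
          unfold ee
          push_cast
          exact Finset.sum_le_sum hb
        rw [Finset.sum_add_distrib, ← Finset.mul_sum, Finset.sum_const, nsmul_eq_mul] at h2
        have h3 : (M.card : ℝ) ≤ n := by rw [hn]; exact_mod_cast Finset.card_le_univ _
        have h4 : (∑ u ∈ M, (if Hv v u then (1 : ℝ) else 0)) ≤ κ := by
          refine le_trans ?_ (mem_filter.1 hv).2
          rw [Finset.sum_boole]
          unfold deg
          exact_mod_cast Finset.card_le_card (Finset.filter_subset_filter _ (Finset.subset_univ _))
        have h5 := mul_le_mul_of_nonneg_left h4 hnpos.le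
        have h6 := mul_le_mul_of_nonneg_right h3 hκpos.le
        linarith)
      r ∅ V' subset_rfl (by simp) (by simp) (by simp [ee, deg])
    refine this.trans_eq ?_
    rw [← hW]; field_simp
  obtain ⟨q, hq⟩ : ∃ q, q = κ / (2 * r) := ⟨_, rfl⟩
  have hqpos : 0 < q := by rw [hq]; positivity
  have hκq : κ = 2 * r * q := by rw [hq]; field_simp
  have hq4 : 4 ≤ q := by
    rw [hq, hκ, div_div, le_div_iff₀ (by positivity)]
    linarith
  have hqn : q ≤ n := by
    have : κ ≤ n := by 
      rw [hκ]; apply div_le_self hnpos.le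
      nlinarith [one_le_pow₀ (n := 2) hW1]
    nlinarith
  have heH : q * r * (univ : Finset V).card < ee Hv univ := by
    have h1 : (∑ v ∈ univ \ V', κ) ≤ ∑ v ∈ univ \ V', (deg Hv univ v : ℝ) := by
      refine Finset.sum_le_sum fun v hv => ?_
      simp only [V', mem_sdiff, mem_filter, mem_univ, true_and, not_le] at hv
      exact hv.le
    have h2 : (∑ v ∈ univ \ V', (deg Hv univ v : ℝ)) ≤ ee Hv univ := by
      unfold ee
      push_cast
      exact Finset.sum_le_sum_of_subset_of_nonneg Finset.sdiff_subset (by intros; positivity)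
    rw [Finset.sum_const, nsmul_eq_mul] at h1
    have h3 : ((univ \ V').card : ℝ) + V'.card = n := by
      rw [hn]; exact_mod_cast Finset.card_sdiff_add_card_eq_card (Finset.subset_univ V')
    rw [Finset.card_univ, ← hn]
    have h4 : n / 2 * κ < ((univ \ V').card : ℝ) * κ :=
      mul_lt_mul_of_pos_right (by linarith) hκpos
    have h5 : q * r * n = n / 2 * κ := by rw [hκq]; ring
    linarith
  obtain ⟨c, hc⟩ := colour_pigeon χ hsym L r hL hχ Hv (fun u h => h.1 rfl) q hqpos.le univ heH
  set X := univ.filter (fun v => c ∈ L v) with hX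
  let G : V → V → Prop := fun u v => Hv u v ∧ χ u v = c
  have hGs : ∀ u v, G u v → G v u := by
    rintro u v ⟨h1, h2⟩; exact ⟨hHs _ _ h1, by rw [hsym]; exact h2⟩
  have hc : q * X.card < ee G X := hc
  have hXn : (X.card : ℝ) ≤ n := by rw [hn]; exact_mod_cast Finset.card_le_univ _
  have hqX : q < X.card := by
    have h1 : ee G X ≤ X.card * X.card := by
      unfold ee
      calc ∑ v ∈ X, deg G X v ≤ ∑ v ∈ X, X.card := Finset.sum_le_sum fun v _ => Finset.card_filter_le _ _
        _ = _ := by simp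
    have h1' : (ee G X : ℝ) ≤ X.card * X.card := by exact_mod_cast h1
    by_contra hcon
    push Not at hcon
    have := mul_le_mul_of_nonneg_right hcon (Nat.cast_nonneg (α := ℝ) X.card)
    linarith
  obtain ⟨m, hm⟩ : ∃ m, m = ⌊q⌋₊ := ⟨_, rfl⟩
  have hmq : (m : ℝ) ≤ q := by rw [hm]; exact Nat.floor_le hqpos.le
  have hmq' : q < m + 1 := by rw [hm]; exact Nat.lt_floor_add_one q
  have hmX : m ≤ X.card := by
    have : (m : ℝ) ≤ X.card := by linarith
    exact_mod_cast this
  have hm1 : 1 ≤ m := by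
    have : (1 : ℝ) ≤ m := by linarith
    exact_mod_cast this
  obtain ⟨Y, hYX, hYm, hYe⟩ := density G hGs (q / n) X (by
    refine le_trans ?_ hc.le
    rw [div_mul_eq_mul_div, div_le_iff₀ hnpos]
    have : (X.card : ℝ) * (X.card - 1) ≤ X.card * n := by
      apply mul_le_mul_of_nonneg_left <;> linarith
    have := mul_le_mul_of_nonneg_left this hqpos.le
    linarith) m hm1 hmX
  obtain ⟨l, hl, hlY, hlen⟩ := long_cycle G hGs (fun u h => h.1.1 rfl) (q ^ 2 / (4 * n)) Y (by
    refine lt_of_lt_of_le ?_ hYe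
    rw [hYm, div_mul_eq_mul_div, div_mul_eq_mul_div, div_lt_div_iff₀ (by positivity) hnpos]
    have h1 : q < 4 * ((m : ℝ) - 1) := by linarith
    have h2 : 0 < q * m * n := by
      have : (0 : ℝ) < m := by linarith
      positivity
    nlinarith [mul_lt_mul_of_pos_left h1 h2])
  have hqq : 0 < q ^ 2 / (4 * n) := by positivity
  have hl2 : 2 ≤ l.length := by
    have : (1 : ℝ) < l.length := by linarith
    exact_mod_cast this
  have hnd : l.Nodup := by obtain ⟨_, _, _, h, _⟩ := hl; exact h
  have hlm : l.length ≤ m := by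
    rw [← hYm, ← List.toFinset_card_of_nodup hnd]
    exact Finset.card_le_card fun x hx => hlY x (by simpa using hx)
  obtain ⟨A, hA1, hA2, hA3⟩ := absorb χ c G (fun u v => comm χ u v \ Y) l hl hl2 (by
    rintro u v ⟨⟨h1, h2⟩, h3⟩
    have h4 := Finset.le_card_sdiff Y (comm χ u v)
    rw [hYm] at h4
    have h5 : (2 * m : ℝ) ≤ (comm χ u v).card := by
      refine le_trans ?_ h2
      rw [hκq]; nlinarith
    have h5' : 2 * m ≤ (comm χ u v).card := by exact_mod_cast h5
    omega) (by
    rintro u v ⟨⟨h1, h2⟩, h3⟩ w hw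
    simp only [comm, mem_sdiff, mem_filter, mem_univ, true_and] at hw
    refine ⟨fun h => hw.2 (hlY w h), by rw [hw.1.2.2.1, h3], by rw [hsym, hw.1.2.2.2, h3]⟩)
  refine ⟨l.toFinset, A, ?_, ?_, fun A' hA' => hA3 A' hA' (Or.inr fun u v h => h.2)⟩
  · rw [Finset.disjoint_left]
    intro x hx hxA
    obtain ⟨u, v, _, _, h⟩ := hA2 x hxA
    exact (mem_sdiff.1 h).2 (hlY x (by simpa using hx))
  · rw [hA1]
    have h1 : q ^ 2 / (8 * n) ≤ l.length := by
      have : q ^ 2 / (8 * n) = q ^ 2 / (4 * n) / 2 := by field_simp; norm_num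
      rw [this]; linarith
    have h2 : n = 2 ^ 19 * r ^ 4 * W ^ 4 * (q ^ 2 / (8 * n)) := by
      rw [hq, hκ]; field_simp; norm_num
    calc n = 2 ^ 19 * r ^ 4 * W ^ 4 * (q ^ 2 / (8 * n)) := h2
      _ ≤ _ := by gcongr
end
end LCP

namespace LCP
open Finset

theorem walk_of_chain {V : Type*} (χ : V → V → ℕ) (hsym : ∀ u v, χ u v = χ v u) (c : ℕ) (t : List V) :
    ∀ (a z : V), (a :: (t ++ [z])).Nodup → List.IsChain (fun u v => χ u v = c) (a :: (t ++ [z])) →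
      ∃ p : (⊤ : SimpleGraph V).Walk a z, p.support = a :: (t ++ [z]) ∧
        ∀ x y : V, s(x, y) ∈ p.edges → χ x y = c := by
  induction t with
  | nil =>
    intro a z hn hc
    simp only [List.nil_append, List.nodup_cons, List.mem_singleton, List.isChain_cons_cons] at hn hc
    refine ⟨SimpleGraph.Walk.cons (by simpa using hn.1) SimpleGraph.Walk.nil, by simp, ?_⟩
    intro x y h
    simp at h
    rcases h with ⟨rfl, rfl⟩ | ⟨rfl, rfl⟩
    · exact hc.1
    · rw [hsym]; exact hc.1
  | cons b t ih =>
    intro a z hn hc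
    rw [List.cons_append, List.nodup_cons] at hn
    rw [List.cons_append, List.isChain_cons_cons] at hc
    obtain ⟨p, hp, he⟩ := ih b z hn.2 hc.2
    refine ⟨SimpleGraph.Walk.cons (by
      rw [SimpleGraph.top_adj]; rintro rfl; exact hn.1 (by simp)) p, by simp [hp], ?_⟩
    intro x y h
    rw [SimpleGraph.Walk.edges_cons, List.mem_cons] at h
    rcases h with h | h
    · rw [Sym2.eq_iff] at h
      rcases h with ⟨rfl, rfl⟩ | ⟨rfl, rfl⟩
      · exact hc.1
      · rw [hsym]; exact hc.1
    · exact he x y h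

theorem MC.isMono {n : ℕ} {χ : Fin n → Fin n → ℕ} (hsym : ∀ u v, χ u v = χ v u) {S : Finset (Fin n)}
    (h : MC χ S) : ∃ col, IsMonoCycle χ col S := by
  obtain ⟨c, l, rfl, a, t, rfl, hn, hc⟩ := h
  refine ⟨c, ?_⟩
  rcases hc with rfl | hc
  · left; exact ⟨a, by simp⟩
  rcases t with _ | ⟨b, t⟩
  · left; exact ⟨a, by simp⟩
  rcases List.eq_nil_or_concat t with rfl | ⟨t', z, rfl⟩
  · right; left
    simp only [List.cons_append, List.nil_append, List.isChain_cons_cons] at hc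
    refine ⟨a, b, ?_, by simp, hc.1⟩
    rintro rfl; simp at hn
  · right; right
    rw [List.concat_eq_append] at *
    have hn2 := hn
    rw [List.nodup_cons] at hn2
    have hc1 : List.IsChain (fun u v => χ u v = c) (b :: (t' ++ [z])) := by
      rw [List.isChain_append] at hc
      exact (List.isChain_cons_cons.1 hc.1).2
    have hab : χ a b = c := by
      simp only [List.cons_append, List.isChain_cons_cons] at hc
      exact hc.1
    have hza : χ z a = c := by
      rw [List.isChain_append] at hc
      refine hc.2.2 z ?_ a (by simp)
      have : (a :: b :: (t' ++ [z])).getLast? = some z := List.getLast?_concat (l := a :: b :: t')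
      rw [this]; simp
    obtain ⟨p, hp, he⟩ := walk_of_chain χ hsym c t' b z hn2.2 hc1
    have hap : a ∉ p.support := by rw [hp]; exact hn2.1
    have haz : a ≠ z := by rintro rfl; exact hn2.1 (by simp)
    have hab' : a ≠ b := by rintro rfl; exact hn2.1 (by simp)
    have hbz : b ≠ z := by
      rintro rfl; exact (List.nodup_cons.1 hn2.2).1 (by simp)
    have hpath : p.IsPath := by rw [SimpleGraph.Walk.isPath_def, hp]; exact hn2.2
    have hpath2 : (SimpleGraph.Walk.cons (show (⊤ : SimpleGraph (Fin n)).Adj a b from hab') p).IsPath := by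
      rw [SimpleGraph.Walk.cons_isPath_iff]; exact ⟨hpath, hap⟩
    refine ⟨z, SimpleGraph.Walk.cons (show (⊤ : SimpleGraph (Fin n)).Adj z a from haz.symm)
      (SimpleGraph.Walk.cons (show (⊤ : SimpleGraph (Fin n)).Adj a b from hab') p), ?_, ?_, ?_⟩
    · rw [SimpleGraph.Walk.cons_isCycle_iff]
      refine ⟨hpath2, ?_⟩
      rw [SimpleGraph.Walk.edges_cons, List.mem_cons]
      rintro (h | h)
      · rw [Sym2.eq_iff] at h
        rcases h with ⟨h, -⟩ | ⟨h, -⟩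
        · exact haz h.symm
        · exact hbz h.symm
      · exact hap (SimpleGraph.Walk.snd_mem_support_of_mem_edges p h)
    · ext x
      simp [hp]
    · intro x y h
      rw [SimpleGraph.Walk.edges_cons, List.mem_cons, SimpleGraph.Walk.edges_cons, List.mem_cons] at h
      rcases h with h | h | h
      · rw [Sym2.eq_iff] at h
        rcases h with ⟨rfl, rfl⟩ | ⟨rfl, rfl⟩
        · exact hza
        · rw [hsym]; exact hza
      · rw [Sym2.eq_iff] at h
        rcases h with ⟨rfl, rfl⟩ | ⟨rfl, rfl⟩
        · exact hab
        · rw [hsym]; exact hab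
      · exact he x y h

theorem Cov.family {V : Type*} [DecidableEq V] {χ : V → V → ℕ} {k : ℕ} {X : Finset V} (h : Cov χ k X) :
    ∃ k' ≤ k, ∃ S : Fin k' → Finset V, (∀ i, MC χ (S i)) ∧ (∀ i j, i ≠ j → Disjoint (S i) (S j)) ∧
      (∀ v, v ∈ X ↔ ∃ i, v ∈ S i) := by
  induction h with
  | nil k => exact ⟨0, by omega, fun i => i.elim0, fun i => i.elim0, fun i => i.elim0, by simp⟩
  | @cons k S X h1 h2 h3 ih =>
    obtain ⟨k', hk, F, hF1, hF2, hF3⟩ := ih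
    have hd : ∀ i, Disjoint S (F i) := by
      intro i
      rw [Finset.disjoint_left] at h2 ⊢
      intro x hx hxi
      exact h2 hx ((hF3 x).2 ⟨i, hxi⟩)
    refine ⟨k' + 1, by omega, Fin.cons S F, ?_, ?_, ?_⟩
    · intro i
      refine Fin.cases ?_ ?_ i
      · simpa using h1
      · intro i; simpa using hF1 i
    · intro i j
      refine Fin.cases ?_ (fun i => ?_) i <;> refine Fin.cases ?_ (fun j => ?_) j
      · intro h; exact absurd rfl h
      · intro _; simpa using hd j
      · intro _; simpa using (hd i).symm
      · intro h; simpa using hF2 i j (fun e => h (by rw [e]))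
    · intro v
      rw [Finset.mem_union, hF3, Fin.exists_fin_succ]
      simp

theorem numbers (r : ℕ) (hr : 2 ≤ r) (W : ℝ) (hW : W = (2 * r) ^ r) :
    6 * r ^ 2 * (2 ^ 19 * r ^ 4 * W ^ 4) ≤ (r : ℝ) ^ (40 * r) := by
  have hr' : (2 : ℝ) ≤ r := by exact_mod_cast hr
  have h1 : (6 * 2 ^ 19 : ℝ) ≤ r ^ 22 := by
    calc (6 * 2 ^ 19 : ℝ) ≤ 2 ^ 22 := by norm_num
      _ ≤ _ := by gcongr
  have h2 : W ≤ (r : ℝ) ^ (2 * r) := by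
    rw [hW, pow_mul]
    gcongr
    nlinarith
  have hWp : 0 ≤ W := by rw [hW]; positivity
  calc 6 * r ^ 2 * (2 ^ 19 * r ^ 4 * W ^ 4) = (6 * 2 ^ 19) * r ^ 6 * W ^ 4 := by ring
    _ ≤ r ^ 22 * r ^ 6 * ((r : ℝ) ^ (2 * r)) ^ 4 := by gcongr
    _ = (r : ℝ) ^ (28 + 8 * r) := by ring
    _ ≤ _ := pow_le_pow_right₀ (by linarith) (by omega)

theorem main {V : Type*} [DecidableEq V] [Fintype V] (χ : V → V → ℕ) (hsym : ∀ u v, χ u v = χ v u)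
    (L : V → Finset ℕ) (r : ℕ)
    (hr : 2 ≤ r) (hL : ∀ v, (L v).card ≤ r) (hχ : ∀ u v, u ≠ v → χ u v ∈ L u) (t : ℕ)
    (ht : 160 * (r : ℝ) ^ 2 * Real.log r ≤ t) :
    Cov χ (t + 2 * r ^ 2 + 1) (univ : Finset V) := by
  have hr' : (2 : ℝ) ≤ r := by exact_mod_cast hr
  have hrpos : (0 : ℝ) < r := by linarith
  obtain ⟨W, hW⟩ : ∃ W : ℝ, W = (2 * r) ^ r := ⟨_, rfl⟩
  have hW1 : 1 ≤ W := by rw [hW]; exact one_le_pow₀ (by linarith)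
  have hnum := numbers r hr W hW
  set N : ℝ := (r : ℝ) ^ (40 * r) with hN
  have hNpos : 0 < N := by positivity
  have hpow : (1 - 1 / (4 * (r : ℝ))) ^ t * N ≤ Real.exp 0 := by
    have h0 : (0 : ℝ) ≤ 1 - 1 / (4 * r) := by
      rw [sub_nonneg, div_le_one (by positivity)]; linarith
    have h1 : 1 - 1 / (4 * (r : ℝ)) ≤ Real.exp (-(1 / (4 * r))) := by
      have := Real.add_one_le_exp (-(1 / (4 * (r : ℝ))))
      linarith
    have h2 : N = Real.exp (40 * r * Real.log r) := by
      rw [hN, ← Real.exp_log (pow_pos hrpos (40 * r)), Real.log_pow]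
      push_cast; rfl
    calc (1 - 1 / (4 * (r : ℝ))) ^ t * N ≤ (Real.exp (-(1 / (4 * r)))) ^ t * N := by gcongr
      _ = Real.exp (t * (-(1 / (4 * r))) + 40 * r * Real.log r) := by
          rw [← Real.exp_nat_mul, Real.exp_add, ← h2]
      _ ≤ _ := by
          apply Real.exp_le_exp.2
          have : 40 * r * Real.log r ≤ t * (1 / (4 * r)) := by
            rw [mul_one_div, le_div_iff₀ (by positivity)]
            nlinarith
          linarith
  rw [Real.exp_zero] at hpow
  by_cases hbig : N ≤ Fintype.card V
  · obtain ⟨S, A, hSA, hAc, hMC⟩ := step1 χ hsym L r hr hL hχ W (Fintype.card V) hW rfl (by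
      refine le_trans ?_ (hnum.trans hbig)
      have h1 : 1 ≤ (r : ℝ) ^ 4 := one_le_pow₀ (by linarith)
      have h2 : W ^ 2 ≤ W ^ 4 := pow_le_pow_right₀ hW1 (by norm_num)
      calc 1024 * (r : ℝ) ^ 2 * W ^ 2 = 1024 * (r ^ 2 * (1 * W ^ 2)) := by ring
        _ ≤ (6 * 2 ^ 19) * (r ^ 2 * (r ^ 4 * W ^ 4)) := by gcongr; norm_num
        _ = _ := by ring)
    obtain ⟨B, hB, hCov, hBc⟩ := greedy χ hsym L r (by omega) hL hχ t (univ \ (S ∪ A))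
    have hBS : Disjoint B S := by
      rw [Finset.disjoint_left]; intro x hx hx'
      have := hB hx; simp [hx'] at this
    have hBA : Disjoint B A := by
      rw [Finset.disjoint_left]; intro x hx hx'
      have := hB hx; simp [hx'] at this
    have h6 : 6 * r ^ 2 * B.card ≤ A.card := by
      have h1 : ((univ \ (S ∪ A)).card : ℝ) ≤ Fintype.card V := by exact_mod_cast Finset.card_le_univ _
      set Q : ℝ := 2 ^ 19 * r ^ 4 * W ^ 4 with hQ
      have hQpos : 0 < Q := by positivity
      have h2 : (B.card : ℝ) * N ≤ Q * A.card := by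
        have h0 : (0 : ℝ) ≤ 1 - 1 / (4 * r) := by
          rw [sub_nonneg, div_le_one (by positivity)]; linarith
        calc (B.card : ℝ) * N ≤ ((1 - 1 / (4 * (r : ℝ))) ^ t * (univ \ (S ∪ A)).card) * N := by gcongr
          _ = ((1 - 1 / (4 * (r : ℝ))) ^ t * N) * (univ \ (S ∪ A)).card := by ring
          _ ≤ 1 * Fintype.card V := by gcongr
          _ ≤ _ := by linarith
      have h3 : Q * (6 * r ^ 2 * B.card) ≤ Q * A.card := by
        refine le_trans ?_ h2
        have := mul_le_mul_of_nonneg_left hnum (Nat.cast_nonneg (α := ℝ) B.card)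
        linarith
      exact_mod_cast le_of_mul_le_mul_left h3 hQpos
    obtain ⟨A1, hA1, hCov2⟩ := step3 χ hsym L r (by omega) hL hχ A B hBA h6
    have hC3 : Cov χ 1 (S ∪ (A \ A1)) := by
      have := Cov.cons (hMC (A \ A1) Finset.sdiff_subset) (Finset.disjoint_empty_right _) (Cov.nil 0)
      simpa using this
    have hC4 := (hCov.union hCov2 (by
      rw [Finset.disjoint_left]; intro x hx hx'
      have := @hA1 x
      simp only [mem_sdiff, mem_union, mem_univ, true_and] at hx hx'
      tauto)).union hC3 (by
      rw [Finset.disjoint_left]; intro x hx hx'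
      have h1 := @hA1 x
      have h2 : x ∈ B → x ∉ S := fun h => Finset.disjoint_left.1 hBS h
      have h3 : x ∈ B → x ∉ A := fun h => Finset.disjoint_left.1 hBA h
      have h4 : x ∈ S → x ∉ A := fun h => Finset.disjoint_left.1 hSA h
      simp only [mem_sdiff, mem_union, mem_univ, true_and] at hx hx'
      tauto)
    convert hC4 using 1
    ext x
    simp only [mem_sdiff, mem_union, mem_univ, true_and]
    tauto
  · obtain ⟨B, hB, hCov, hBc⟩ := greedy χ hsym L r (by omega) hL hχ t univ
    have : B = ∅ := by
      rw [← Finset.card_eq_zero]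
      by_contra hne
      have h1 : (1 : ℝ) ≤ B.card := by exact_mod_cast Nat.one_le_iff_ne_zero.2 hne
      push Not at hbig
      rw [Finset.card_univ] at hBc
      have h0 : (0 : ℝ) < 1 - 1 / (4 * r) := by
        rw [sub_pos, div_lt_one (by positivity)]; linarith
      have : (1 - 1 / (4 * (r : ℝ))) ^ t * Fintype.card V < (1 - 1 / (4 * (r : ℝ))) ^ t * N :=
        mul_lt_mul_of_pos_left hbig (pow_pos h0 t)
      linarith
    rw [this, Finset.sdiff_empty] at hCov
    have := hCov.union (Cov.nil (χ := χ) (2 * r ^ 2 + 1)) (by simp)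
    rwa [Finset.union_empty] at this

end LCP

/-- There is an absolute constant `C` such that for every `r ≥ 2`, the vertex set of any
`r`-locally coloured complete graph `K_n` can be partitioned into at most `C · r² · log r`
disjoint monochromatic cycles. -/
theorem local_colouring_cycle_partition :
    ∃ C : ℝ, 0 < C ∧ ∀ (r n : ℕ), 2 ≤ r →
      ∀ χ : Fin n → Fin n → ℕ,
        (∀ u v, χ u v = χ v u) →
        (∀ v : Fin n, ((Finset.univ.erase v).image (χ v)).card ≤ r) →
        ∃ (k : ℕ) (S : Fin k → Finset (Fin n)),
          (k : ℝ) ≤ C * (r : ℝ) ^ 2 * Real.log r ∧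
          (∀ i, ∃ col, IsMonoCycle χ col (S i)) ∧
          (∀ i j, i ≠ j → Disjoint (S i) (S j)) ∧
          (∀ v : Fin n, ∃ i, v ∈ S i) := by
  refine ⟨200, by norm_num, ?_⟩
  intro r n hr χ hsym hloc
  have hr' : (2 : ℝ) ≤ r := by exact_mod_cast hr
  have hlog : (1 / 2 : ℝ) ≤ Real.log r := by
    have h1 := Real.log_two_gt_d9
    have h2 := Real.log_le_log (by norm_num) hr'
    linarith
  have hcov := LCP.main χ hsym (fun v => (Finset.univ.erase v).image (χ v)) r hr hloc
    (fun u v h => Finset.mem_image_of_mem _ (by simp [h.symm])) ⌈160 * (r : ℝ) ^ 2 * Real.log r⌉₊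
    (Nat.le_ceil _)
  obtain ⟨k, hk, S, h1, h2, h3⟩ := hcov.family
  refine ⟨k, S, ?_, fun i => (h1 i).isMono hsym, h2, fun v => (h3 v).1 (Finset.mem_univ v)⟩
  have hc := Nat.ceil_lt_add_one (show 0 ≤ 160 * (r : ℝ) ^ 2 * Real.log r by positivity)
  have hk' : (k : ℝ) ≤ ⌈160 * (r : ℝ) ^ 2 * Real.log r⌉₊ + 2 * (r : ℝ) ^ 2 + 1 := by exact_mod_cast hk
  have h5 : (r : ℝ) ^ 2 * (1 / 2) ≤ (r : ℝ) ^ 2 * Real.log r := by gcongr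
  have h6 : (4 : ℝ) ≤ (r : ℝ) ^ 2 := by nlinarith
  linarith
end

section
/- If a finite graph G has independence number α (i.e., every independent set of vertices in G has size at most α), then the vertex set of G can be partitioned into at most α pairwise disjoint cycles of G, where single vertices and single edges count as cycles. -/
/-- `S` is the vertex set of a cycle of the graph `G`, where single vertices and single
edges count as degenerate cycles. -/
def IsCycleSet {V : Type*} [DecidableEq V] (G : SimpleGraph V) (S : Finset V) : Prop :=
  (∃ v, S = {v}) ∨
  (∃ v w : V, G.Adj v w ∧ S = {v, w}) ∨
  (∃ (v : V) (p : G.Walk v v), p.IsCycle ∧ p.support.toFinset = S)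

open SimpleGraph in
theorem posa_key {V : Type*} [Fintype V] [DecidableEq V] (G : SimpleGraph V)
    (W : Finset V) (hW : W.Nonempty) :
    ∃ v ∈ W, ∃ C : Finset V, C ⊆ W ∧ IsCycleSet G C ∧ v ∈ C ∧
      ∀ x ∈ W, G.Adj v x → x ∈ C := by
  classical
  -- longest path
  have h1 : ∃ (n : ℕ) (u v : V) (p : G.Walk u v), p.length = n ∧ p.IsPath ∧
      (∀ x ∈ p.support, x ∈ W) ∧ ∀ x ∈ W, G.Adj v x → x ∈ p.support := by
    by_contra hcon
    have key : ∀ n : ℕ, ∃ (u v : V) (p : G.Walk u v), p.length = n ∧ p.IsPath ∧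
        (∀ x ∈ p.support, x ∈ W) := by
      intro n
      induction n with
      | zero =>
        obtain ⟨w, hw⟩ := hW
        exact ⟨w, w, Walk.nil, by simp, by simp, by simpa using hw⟩
      | succ n ih =>
        obtain ⟨u, v, p, hn, hp, hs⟩ := ih
        by_cases hx : ∀ x ∈ W, G.Adj v x → x ∈ p.support
        · exact absurd ⟨n, u, v, p, hn, hp, hs, hx⟩ hcon
        · push Not at hx
          obtain ⟨x, hxW, hvx, hxp⟩ := hx
          refine ⟨x, u, Walk.cons hvx.symm p.reverse, by simp [hn], ?_, ?_⟩
          · rw [Walk.cons_isPath_iff]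
            exact ⟨hp.reverse, by simpa using hxp⟩
          · intro y hy
            simp only [Walk.support_cons, List.mem_cons, Walk.support_reverse,
              List.mem_reverse] at hy
            rcases hy with rfl | hy
            · exact hxW
            · exact hs y hy
    obtain ⟨u, v, p, hn, hp, -⟩ := key (Fintype.card V)
    have := hp.length_lt
    omega
  obtain ⟨u, v, p, hn, hp, hs, hx⟩ := Nat.find_spec h1
  have hmin := fun m => @Nat.find_min _ _ h1 m
  generalize Nat.find h1 = N at hn hmin
  refine ⟨v, hs v p.end_mem_support, p.support.toFinset, ?_, ?_, by simp, ?_⟩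
  · intro y hy
    exact hs y (by simpa using hy)
  · cases p with
    | nil => left; exact ⟨u, by simp⟩
    | @cons _ u' _ h q =>
      have hq := hmin q.length (by simp at hn; omega)
      have hp' := (Walk.cons_isPath_iff h q).1 hp
      have huv : G.Adj v u := by
        by_contra hnad
        apply hq
        refine ⟨u', v, q, rfl, hp'.1, fun x hxq => hs x (by simp [hxq]), ?_⟩
        intro x hxW hvx
        have := hx x hxW hvx
        simp only [Walk.support_cons, List.mem_cons] at this
        rcases this with rfl | h'
        · exact absurd hvx hnad
        · exact h'
      right
      by_cases he : s(v, u) ∈ (Walk.cons h q).edges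
      · left
        simp only [Walk.edges_cons, List.mem_cons] at he
        rcases he with he | he
        · have hu' : v = u' := by
            have := huv.ne
            simp only [Sym2.eq_iff] at he
            tauto
          subst hu'
          have : q = Walk.nil := by
            simpa using hp'.1
          subst this
          exact ⟨u, v, huv.symm, by simp⟩
        · exact absurd (q.snd_mem_support_of_mem_edges he) hp'.2
      · right
        refine ⟨v, Walk.cons huv (Walk.cons h q), ?_, ?_⟩
        · rw [Walk.cons_isCycle_iff]
          exact ⟨hp, he⟩
        · rw [Walk.support_cons, List.toFinset_cons, Finset.insert_eq_self]
          simp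
  · intro x hxW hvx
    simpa using hx x hxW hvx

theorem posa_aux {V : Type*} [Fintype V] [DecidableEq V] (G : SimpleGraph V) (n : ℕ) :
    ∀ (W : Finset V) (_ : W.card ≤ n) (α : ℕ)
    (_ : ∀ s ⊆ W, (∀ u ∈ s, ∀ v ∈ s, u ≠ v → ¬ G.Adj u v) → s.card ≤ α),
    ∃ L : List (Finset V), L.length ≤ α ∧ (∀ S ∈ L, IsCycleSet G S ∧ S ⊆ W) ∧
      L.Pairwise Disjoint ∧ ∀ v ∈ W, ∃ S ∈ L, v ∈ S := by
  induction n with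
  | zero =>
    intro W hW α _
    have : W = ∅ := by simpa using hW
    subst this
    exact ⟨[], by simp, by simp, by simp, by simp⟩
  | succ n ih =>
    intro W hWn α hα
    rcases W.eq_empty_or_nonempty with rfl | hW
    · exact ⟨[], by simp, by simp, by simp, by simp⟩
    obtain ⟨v, hv, C, hCW, hC, hvC, hN⟩ := posa_key G W hW
    have hins : ∀ s ⊆ W \ C, (∀ u ∈ s, ∀ v ∈ s, u ≠ v → ¬ G.Adj u v) → s.card + 1 ≤ α := by
      intro s hs hind
      have hvs : v ∉ s := fun h => (Finset.mem_sdiff.1 (hs h)).2 hvC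
      rw [← Finset.card_insert_of_notMem hvs]
      have hna : ∀ x ∈ s, ¬ G.Adj v x := fun x hx hvx =>
        (Finset.mem_sdiff.1 (hs hx)).2 (hN x (Finset.mem_sdiff.1 (hs hx)).1 hvx)
      apply hα
      · intro x hx
        rcases Finset.mem_insert.1 hx with rfl | hx
        · exact hv
        · exact (Finset.mem_sdiff.1 (hs hx)).1
      · intro x hx y hy hxy
        rcases Finset.mem_insert.1 hx with rfl | hx2 <;>
          rcases Finset.mem_insert.1 hy with rfl | hy2
        · exact absurd rfl hxy
        · exact hna y hy2
        · exact fun h => hna x hx2 h.symm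
        · exact hind x hx2 y hy2 hxy
    have h1 : 1 ≤ α := by simpa using hins ∅ (by simp) (by simp)
    have hlt : (W \ C).card < W.card :=
      Finset.card_lt_card ⟨Finset.sdiff_subset, fun h => (Finset.mem_sdiff.1 (h hv)).2 hvC⟩
    obtain ⟨L, hL, hcy, hd, hcov⟩ := ih (W \ C) (by omega) (α - 1)
      (fun s hs hi => by have := hins s hs hi; omega)
    refine ⟨C :: L, by simp; omega, ?_, ?_, ?_⟩
    · intro S hS
      rcases List.mem_cons.1 hS with rfl | hS
      · exact ⟨hC, hCW⟩
      · exact ⟨(hcy S hS).1, (hcy S hS).2.trans Finset.sdiff_subset⟩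
    · rw [List.pairwise_cons]
      exact ⟨fun S hS => Finset.disjoint_of_subset_right (hcy S hS).2 Finset.disjoint_sdiff, hd⟩
    · intro x hx
      by_cases hxC : x ∈ C
      · exact ⟨C, by simp, hxC⟩
      · obtain ⟨S, hS, hxS⟩ := hcov x (Finset.mem_sdiff.2 ⟨hx, hxC⟩)
        exact ⟨S, by simp [hS], hxS⟩

/-- P\'osa's lemma: if every independent set of a finite graph `G` has size at most `α`,
then the vertex set of `G` can be partitioned into at most `α` pairwise disjoint cycles. -/
theorem posa_cycle_partition {V : Type*} [Fintype V] [DecidableEq V]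
    (G : SimpleGraph V) (α : ℕ)
    (hα : ∀ s : Finset V, (∀ u ∈ s, ∀ v ∈ s, u ≠ v → ¬ G.Adj u v) → s.card ≤ α) :
    ∃ (k : ℕ) (S : Fin k → Finset V), k ≤ α ∧
      (∀ i, IsCycleSet G (S i)) ∧
      (∀ i j, i ≠ j → Disjoint (S i) (S j)) ∧
      (∀ v : V, ∃ i, v ∈ S i) := by
  obtain ⟨L, hL, hcy, hd, hcov⟩ := posa_aux G _ Finset.univ le_rfl α (fun s _ h => hα s h)
  refine ⟨L.length, L.get, hL, fun i => (hcy _ (L.get_mem i)).1, ?_, ?_⟩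
  · intro i j hij
    rw [List.pairwise_iff_get] at hd
    rcases lt_or_gt_of_ne hij with h | h
    · exact hd i j h
    · exact (hd j i h).symm
  · intro v
    obtain ⟨S, hS, hv⟩ := hcov v (Finset.mem_univ v)
    obtain ⟨i, rfl⟩ := List.get_of_mem hS
    exact ⟨i, hv⟩
end

section
/- Let H be a connected finite graph and let r ≥ 1 and m be such that every colouring of the edges of the complete graph K_m with at most r colours contains a monochromatic copy of H. Then every r-local edge colouring of the complete graph K_n with n ≥ (r^r / r!)·m contains a monochromatic copy of H. In particular, since r^r/r! ≤ e^r, every r-local colouring of K_n with n ≥ e^r·m contains a monochromatic copy of H. -/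
/-- The edge colouring `χ` of the complete graph `K_n` contains a monochromatic copy
of the graph `H`. -/
def HasMonoCopy {W β : Type*} {n : ℕ} (H : SimpleGraph W) (χ : Fin n → Fin n → β) : Prop :=
  ∃ (col : β) (f : W ↪ Fin n), ∀ u v : W, H.Adj u v → χ (f u) (f v) = col

open Classical in
theorem inj_count {α : Type*} [Fintype α] (r : ℕ) (S : Finset α) (hS : S.card = r) :
    r.factorial * Fintype.card (α → Fin r) ≤
      r ^ r * (Finset.univ.filter (fun φ : α → Fin r => Set.InjOn φ (S : Set α))).card := by
  have h1 : Fintype.card ((S ↪ Fin r) × ({x // x ∉ S} → Fin r)) ≤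
      Fintype.card {φ : α → Fin r // Set.InjOn φ (S : Set α)} := by
    refine Fintype.card_le_of_injective
      (fun p => ⟨fun x => if h : x ∈ S then p.1 ⟨x, h⟩ else p.2 ⟨x, h⟩, ?_⟩) ?_
    · intro x hx y hy hxy
      have hx' : x ∈ S := hx
      have hy' : y ∈ S := hy
      simp only [hx', hy', dif_pos] at hxy
      simpa using p.1.injective hxy
    · intro p q hpq
      have hpq' := congrArg Subtype.val hpq
      refine Prod.ext ?_ ?_
      · ext ⟨x, hx⟩
        have := congrFun hpq' x
        simp only [hx, dif_pos] at this
        rw [this]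
      · funext ⟨x, hx⟩
        have := congrFun hpq' x
        simpa only [hx, dif_neg, not_false_eq_true] using this
  rw [Fintype.card_subtype] at h1
  have h2 : Fintype.card ((S ↪ Fin r) × ({x // x ∉ S} → Fin r)) =
      r.factorial * r ^ (Fintype.card α - r) := by
    rw [Fintype.card_prod, Fintype.card_embedding_eq, Fintype.card_fun]
    simp [hS, Nat.descFactorial_self, Fintype.card_subtype_compl]
  have h3 : r ≤ Fintype.card α := hS ▸ Finset.card_le_univ S
  calc r.factorial * Fintype.card (α → Fin r)
      = r ^ r * (r.factorial * r ^ (Fintype.card α - r)) := by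
        rw [Fintype.card_fun, Fintype.card_fin]
        conv_lhs => rw [← Nat.add_sub_cancel' h3, pow_add]
        ring
    _ ≤ _ := by rw [← h2]; exact Nat.mul_le_mul_left _ h1

open Classical in
theorem exists_good {α : Type*} [Fintype α] (r m n : ℕ) (hr : 1 ≤ r)
    (hn : r ^ r * m ≤ n * r.factorial) (S : Fin n → Finset α) (hS : ∀ v, (S v).card = r) :
    ∃ φ : α → Fin r, m ≤ (Finset.univ.filter
      (fun v : Fin n => Set.InjOn φ (S v : Set α))).card := by
  by_contra! hcon
  have : Nonempty (Fin r) := ⟨⟨0, hr⟩⟩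
  have h1 : ∑ φ : α → Fin r, (Finset.univ.filter
      (fun v : Fin n => Set.InjOn φ (S v : Set α))).card < ∑ φ : α → Fin r, m :=
    Finset.sum_lt_sum_of_nonempty Finset.univ_nonempty (fun φ _ => hcon φ)
  have h2 : ∑ φ : α → Fin r, (Finset.univ.filter
      (fun v : Fin n => Set.InjOn φ (S v : Set α))).card =
      ∑ v : Fin n, (Finset.univ.filter
        (fun φ : α → Fin r => Set.InjOn φ (S v : Set α))).card := by
    simp only [Finset.card_filter]
    exact Finset.sum_comm
  have h3 : ∑ v : Fin n, r.factorial * Fintype.card (α → Fin r) ≤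
      ∑ v : Fin n, r ^ r * (Finset.univ.filter
        (fun φ : α → Fin r => Set.InjOn φ (S v : Set α))).card :=
    Finset.sum_le_sum (fun v _ => inj_count r (S v) (hS v))
  rw [← Finset.mul_sum Finset.univ _ (r ^ r), ← h2] at h3
  simp only [Finset.sum_const, Finset.card_univ, smul_eq_mul, Fintype.card_fin] at h3 h1
  have h4 := Nat.mul_lt_mul_of_pos_left h1 (show 0 < r ^ r by positivity)
  have h5 := Nat.mul_le_mul_right (Fintype.card (α → Fin r)) hn
  nlinarith

theorem core_nat {W : Type*} (H : SimpleGraph W)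
    (hconn : H.Connected) (r m : ℕ) (hr : 1 ≤ r)
    (hRam : ∀ χ : Fin m → Fin m → Fin r, (∀ u v, χ u v = χ v u) → HasMonoCopy H χ)
    (n : ℕ) (hn : r ^ r * m ≤ n * r.factorial)
    (χ : Fin n → Fin n → ℕ) (hs : ∀ u v, χ u v = χ v u)
    (hl : ∀ v : Fin n, ((Finset.univ.erase v).image (χ v)).card ≤ r) :
    HasMonoCopy H χ := by
  classical
  let B : ℕ := Finset.univ.sup (fun p : Fin n × Fin n => χ p.1 p.2)
  have hB : ∀ u v, χ u v < B + 1 + r := fun u v => by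
    have : χ u v ≤ B := Finset.le_sup (f := fun p : Fin n × Fin n => χ p.1 p.2)
      (Finset.mem_univ (u, v))
    omega
  let κ : Fin n → Fin n → Fin (B + 1 + r) := fun u v => ⟨χ u v, hB u v⟩
  have hκ : ∀ v, ∃ S : Finset (Fin (B + 1 + r)),
      (Finset.univ.erase v).image (κ v) ⊆ S ∧ S.card = r := by
    intro v
    apply Finset.exists_superset_card_eq
    · refine le_trans (le_of_eq ?_) (hl v)
      rw [← Finset.card_image_of_injective _ Fin.val_injective, Finset.image_image]
      rfl
    · simp
  choose S hS hSc using hκ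
  obtain ⟨φ, hφ⟩ := exists_good r m n hr hn S hSc
  obtain ⟨T, hT, hTc⟩ := Finset.exists_subset_card_eq hφ
  let g : Fin m ↪ Fin n := (T.orderEmbOfFin hTc).toEmbedding
  have hg : ∀ i, Set.InjOn φ (S (g i) : Set (Fin (B + 1 + r))) := fun i =>
    (Finset.mem_filter.1 (hT (Finset.orderEmbOfFin_mem T hTc i))).2
  obtain ⟨c, f, hf⟩ := hRam (fun i j => φ (κ (g i) (g j))) (by
    intro u v
    simp only [κ, hs (g u) (g v)])
  have hstar : ∀ u v w, H.Adj u v → H.Adj u w → χ (g (f u)) (g (f v)) = χ (g (f u)) (g (f w)) := by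
    intro u v w huv huw
    have mem : ∀ x, H.Adj u x → κ (g (f u)) (g (f x)) ∈ S (g (f u)) := by
      intro x hx
      apply hS
      refine Finset.mem_image_of_mem _ (Finset.mem_erase.2 ⟨?_, Finset.mem_univ _⟩)
      intro h
      exact hx.ne (f.injective (g.injective h)).symm
    have := hg (f u) (mem v huv) (mem w huw) ((hf u v huv).trans (hf u w huw).symm)
    exact congrArg Fin.val this
  by_cases hE : ∃ a b, H.Adj a b
  · obtain ⟨a, b, hab⟩ := hE
    refine ⟨χ (g (f a)) (g (f b)), f.trans g, fun u v huv => ?_⟩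
    obtain ⟨p⟩ := hconn.preconnected u a
    have key : ∀ x y (_ : H.Walk x y), (∀ w, H.Adj y w →
        χ (g (f y)) (g (f w)) = χ (g (f a)) (g (f b))) →
        ∀ w, H.Adj x w → χ (g (f x)) (g (f w)) = χ (g (f a)) (g (f b)) := by
      intro x y p
      induction p with
      | nil => exact fun h => h
      | cons h q ih =>
        intro hy w hw
        rw [hstar _ _ _ hw h, hs]
        exact ih hy _ h.symm
    exact key u a p (fun w hw => hstar _ _ _ hw hab) v huv
  · exact ⟨0, f.trans g, fun u v huv => absurd ⟨u, v, huv⟩ hE⟩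

/-- If every `r`-colouring of `K_m` contains a monochromatic copy of the connected graph `H`,
then every `r`-local colouring of `K_n` with `n ≥ (r^r/r!)·m` contains a monochromatic copy
of `H`; in particular, since `r^r/r! ≤ e^r`, so does every `r`-local colouring of `K_n` with
`n ≥ e^r·m`. -/
theorem local_ramsey_from_ramsey {W : Type*} [Fintype W] (H : SimpleGraph W)
    (hconn : H.Connected) (r m : ℕ) (hr : 1 ≤ r)
    (hRam : ∀ χ : Fin m → Fin m → Fin r, (∀ u v, χ u v = χ v u) → HasMonoCopy H χ) :
    (∀ n : ℕ, ((r : ℝ) ^ r / (Nat.factorial r : ℝ)) * (m : ℝ) ≤ (n : ℝ) →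
      ∀ χ : Fin n → Fin n → ℕ, (∀ u v, χ u v = χ v u) →
        (∀ v : Fin n, ((Finset.univ.erase v).image (χ v)).card ≤ r) →
        HasMonoCopy H χ) ∧
    (∀ n : ℕ, Real.exp r * (m : ℝ) ≤ (n : ℝ) →
      ∀ χ : Fin n → Fin n → ℕ, (∀ u v, χ u v = χ v u) →
        (∀ v : Fin n, ((Finset.univ.erase v).image (χ v)).card ≤ r) →
        HasMonoCopy H χ) := by
  have core : ∀ n : ℕ, ((r : ℝ) ^ r / (Nat.factorial r : ℝ)) * (m : ℝ) ≤ (n : ℝ) →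
      ∀ χ : Fin n → Fin n → ℕ, (∀ u v, χ u v = χ v u) →
        (∀ v : Fin n, ((Finset.univ.erase v).image (χ v)).card ≤ r) →
        HasMonoCopy H χ := by
    intro n hn χ hs hl
    refine core_nat H hconn r m hr hRam n ?_ χ hs hl
    have hpos : (0 : ℝ) < (r.factorial : ℝ) := by positivity
    rw [div_mul_eq_mul_div, div_le_iff₀ hpos] at hn
    exact_mod_cast hn
  refine ⟨core, fun n hn => core n (le_trans ?_ hn)⟩
  gcongr
  exact Real.pow_div_factorial_le_exp (r : ℝ) (by positivity) r
end

section
/- There exists an absolute constant C such that for every k ≥ 3 and every r ≥ 1, every colouring of the edges of the complete graph K_n with at most r colours, where n ≥ C·k·r^{3r}, contains a monochromatic copy of the triangle cycle T_k. -/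
/-- The triangle cycle `T_k`: vertices `u_0, …, u_(k-1)` (the left summands) form a cycle of
length `k`, and each `v_i` (a right summand) is joined to `u_i` and `u_(i+1)` (indices
modulo `k`). -/
def triangleCycle (k : ℕ) : SimpleGraph (Fin k ⊕ Fin k) :=
  SimpleGraph.fromRel (fun a b =>
    match a, b with
    | Sum.inl i, Sum.inl j => (j : ℕ) = ((i : ℕ) + 1) % k
    | Sum.inl i, Sum.inr j => i = j ∨ (i : ℕ) = ((j : ℕ) + 1) % k
    | _, _ => False)

theorem tc_greedy {V : Type*} [Fintype V] [DecidableEq V] (k : ℕ) (hk : 3 ≤ k)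
    (A : V → V → Prop) (hs : ∀ x y, A x y → A y x) (hi : ∀ x, ¬ A x x)
    (hd : ∀ x y, A x y → ∃ N : Finset V, 2 * k ≤ N.card ∧ ∀ z ∈ N, A x z ∧ A y z)
    (v w : V) (hvw : A v w) :
    ∃ f : (Fin k ⊕ Fin k) ↪ V, ∀ a b, (triangleCycle k).Adj a b → A (f a) (f b) := by
  have path : ∀ m, m + 2 ≤ k → ∃ u : ℕ → V, u 0 = v ∧ (∀ i ≤ m + 1, ∀ j < i, u i ≠ u j) ∧
      (∀ i ≤ m + 1, 1 ≤ i → A v (u i)) ∧ (∀ i ≤ m, 1 ≤ i → A (u i) (u (i + 1))) := by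
    intro m
    induction m with
    | zero =>
      intro _
      refine ⟨fun i => if i = 0 then v else w, by simp, ?_, ?_, ?_⟩
      · intro i h1 j h2
        have : i = 1 := by omega
        have : j = 0 := by omega
        subst_vars
        simp only [one_ne_zero, if_false, if_true]
        rintro rfl
        exact hi _ hvw
      · intro i _ h2
        have : i ≠ 0 := by omega
        simpa [this] using hvw
      · intro i h1 h2
        omega
    | succ m ih =>
      intro hm
      obtain ⟨u, h0, hinj, hv, hp⟩ := ih (by omega)
      obtain ⟨N, hN, hz⟩ := hd _ _ (hv (m + 1) le_rfl (by omega))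
      obtain ⟨z, hzN, hzu⟩ := Finset.exists_mem_notMem_of_card_lt_card
        (s := (Finset.range (m + 2)).image u) (t := N)
        (lt_of_le_of_lt Finset.card_image_le (by rw [Finset.card_range]; omega))
      have hzu' : ∀ j < m + 2, z ≠ u j := by
        intro j hj h
        exact hzu (Finset.mem_image.2 ⟨j, Finset.mem_range.2 hj, h.symm⟩)
      refine ⟨fun i => if i = m + 2 then z else u i, by simp [h0], ?_, ?_, ?_⟩
      · intro i h1 j h2
        have hj : j ≠ m + 2 := by omega
        by_cases h : i = m + 2
        · simp only [h, hj, if_true, if_false]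
          exact hzu' j (by omega)
        · simp only [h, hj, if_false]
          exact hinj i (by omega) j h2
      · intro i h1 h2
        by_cases h : i = m + 2
        · simp only [h, if_true]
          exact (hz z hzN).1
        · simp only [h, if_false]
          exact hv i (by omega) h2
      · intro i h1 h2
        have hj : i ≠ m + 2 := by omega
        by_cases h : i = m + 1
        · subst h
          simp only [hj, if_true, if_false]
          exact (hz z hzN).2
        · have : i + 1 ≠ m + 2 := by omega
          simp only [hj, this, if_false]
          exact hp i (by omega) h2
  obtain ⟨u, h0, hinj, hv, hp⟩ := path (k - 2) (by omega)
  have cyc : ∀ i < k, A (u i) (u ((i + 1) % k)) := by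
    intro i hik
    by_cases h : i + 1 = k
    · rw [h, Nat.mod_self, h0]
      exact hs _ _ (hv i (by omega) (by omega))
    · rw [Nat.mod_eq_of_lt (by omega)]
      by_cases h' : i = 0
      · subst h'
        rw [h0]
        exact hv 1 (by omega) le_rfl
      · exact hp i (by omega) (by omega)
  have ext : ∀ m ≤ k, ∃ q : ℕ → V, (∀ i < m, ∀ j < i, q i ≠ q j) ∧
      (∀ i < m, ∀ j < k, q i ≠ u j) ∧
      (∀ i < m, A (u i) (q i) ∧ A (u ((i + 1) % k)) (q i)) := by
    intro m
    induction m with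
    | zero => intro _; exact ⟨u, by simp, by simp, by simp⟩
    | succ m ih =>
      intro hm
      obtain ⟨q, h1, h2, h3⟩ := ih (by omega)
      obtain ⟨N, hN, hz⟩ := hd _ _ (cyc m (by omega))
      obtain ⟨z, hzN, hzu⟩ := Finset.exists_mem_notMem_of_card_lt_card
        (s := (Finset.range k).image u ∪ (Finset.range m).image q) (t := N) (by
          have a1 := Finset.card_union_le ((Finset.range k).image u) ((Finset.range m).image q)
          have a2 := Finset.card_image_le (s := Finset.range k) (f := u)
          have a3 := Finset.card_image_le (s := Finset.range m) (f := q)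
          rw [Finset.card_range] at a2 a3
          omega)
      rw [Finset.mem_union, not_or] at hzu
      have hzu' : ∀ j < k, z ≠ u j := by
        intro j hj h
        exact hzu.1 (Finset.mem_image.2 ⟨j, Finset.mem_range.2 hj, h.symm⟩)
      have hzq : ∀ j < m, z ≠ q j := by
        intro j hj h
        exact hzu.2 (Finset.mem_image.2 ⟨j, Finset.mem_range.2 hj, h.symm⟩)
      refine ⟨fun i => if i = m then z else q i, ?_, ?_, ?_⟩
      · intro i hi j hj
        have hj' : j ≠ m := by omega
        by_cases h : i = m
        · simp only [h, hj', if_true, if_false]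
          exact hzq j (by omega)
        · simp only [h, hj', if_false]
          exact h1 i (by omega) j hj
      · intro i hi j hj
        by_cases h : i = m
        · simp only [h, if_true]
          exact hzu' j hj
        · simp only [h, if_false]
          exact h2 i (by omega) j hj
      · intro i hi
        by_cases h : i = m
        · simp only [h, if_true]
          exact hz z hzN
        · simp only [h, if_false]
          exact h3 i (by omega)
  obtain ⟨q, h1, h2, h3⟩ := ext k le_rfl
  refine ⟨⟨Sum.elim (fun i => u i) (fun i => q i), ?_⟩, ?_⟩
  · rintro (a | a) (b | b) hab
    · simp only [Sum.elim_inl] at hab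
      rcases lt_trichotomy (a : ℕ) b with h | h | h
      · exact absurd hab.symm (hinj b (by omega) a h)
      · rw [Fin.ext h]
      · exact absurd hab (hinj a (by omega) b h)
    · exact absurd hab.symm (h2 b b.2 a a.2)
    · exact absurd hab (h2 a a.2 b b.2)
    · simp only [Sum.elim_inr] at hab
      rcases lt_trichotomy (a : ℕ) b with h | h | h
      · exact absurd hab.symm (h1 b b.2 a h)
      · rw [Fin.ext h]
      · exact absurd hab (h1 a a.2 b h)
  · intro a b hab
    rw [triangleCycle, SimpleGraph.fromRel_adj] at hab
    obtain ⟨_, hab⟩ := hab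
    rcases a with a | a <;> rcases b with b | b <;> simp only [or_false, false_or] at hab
    · rcases hab with h | h
      · have := cyc a a.2
        rw [← h] at this
        exact this
      · have := cyc b b.2
        rw [← h] at this
        exact hs _ _ this
    · rcases hab with h | h
      · subst h
        exact (h3 a a.2).1
      · have := (h3 b b.2).2
        rw [← h] at this
        exact this
    · rcases hab with h | h
      · subst h
        exact hs _ _ (h3 b b.2).1
      · have := (h3 a a.2).2
        rw [← h] at this
        exact hs _ _ this

theorem tc_prune {V : Type*} [DecidableEq V] (t : ℕ) (M : Finset (Finset V))
    (hM : t * (M.biUnion (Finset.powersetCard 2)).card < M.card) :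
    ∃ M' ⊆ M, M'.Nonempty ∧ ∀ p : Finset V, p.card = 2 → (∃ T ∈ M', p ⊆ T) →
      t ≤ (M'.filter (fun T => p ⊆ T)).card := by
  induction M using Finset.strongInduction with
  | H M ih =>
    by_cases h : ∀ p : Finset V, p.card = 2 → (∃ T ∈ M, p ⊆ T) →
      t ≤ (M.filter (fun T => p ⊆ T)).card
    · exact ⟨M, subset_rfl, Finset.card_pos.1 (by omega), h⟩
    · push Not at h
      obtain ⟨p, hp, ⟨T, hT, hpT⟩, hlt⟩ := h
      have hss : M.filter (fun T => ¬ p ⊆ T) ⊂ M := by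
        rw [Finset.filter_ssubset]
        exact ⟨T, hT, by simpa using hpT⟩
      obtain ⟨M', h1, h2⟩ := ih _ hss (by
        have e := Finset.card_filter_add_card_filter_not (s := M) (fun T => p ⊆ T)
        have lt : ((M.filter (fun T => ¬ p ⊆ T)).biUnion (Finset.powersetCard 2)).card <
            (M.biUnion (Finset.powersetCard 2)).card := by
          apply Finset.card_lt_card
          rw [Finset.ssubset_iff_of_subset
            (Finset.biUnion_subset_biUnion_of_subset_left _ hss.subset)]
          refine ⟨p, Finset.mem_biUnion.2 ⟨T, hT, Finset.mem_powersetCard.2 ⟨hpT, hp⟩⟩, ?_⟩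
          intro hmem
          obtain ⟨S, hS, hpS⟩ := Finset.mem_biUnion.1 hmem
          exact (Finset.mem_filter.1 hS).2 (Finset.mem_powersetCard.1 hpS).1
        have := Nat.mul_le_mul_left t (Nat.succ_le_of_lt lt)
        rw [Nat.succ_eq_add_one, mul_add] at this
        omega)
      exact ⟨M', h1.trans hss.subset, h2⟩

/-- Ramsey bound for triangles. -/
def tcG : ℕ → ℕ
  | 0 => 1
  | d + 1 => (d + 1) * tcG d + 1

theorem tcG_le (d : ℕ) : tcG d + 1 ≤ 3 * d.factorial := by
  induction d with
  | zero => simp [tcG]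
  | succ d ih =>
    rcases Nat.eq_zero_or_pos d with h | h
    · subst h; simp [tcG]
    · rw [tcG, Nat.factorial_succ]
      nlinarith [Nat.mul_le_mul_left (d + 1) ih]

theorem tcG_pos (d : ℕ) : 1 ≤ tcG d := by
  cases d <;> simp [tcG]

theorem tc_ramsey {V K : Type*} [DecidableEq V] [DecidableEq K] (χ : V → V → K)
    (hχ : ∀ u v, χ u v = χ v u) (d : ℕ) :
    ∀ (D : Finset K) (S : Finset V), D.card = d →
    (∀ x ∈ S, ∀ y ∈ S, x ≠ y → χ x y ∈ D) → tcG d < S.card →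
    ∃ c, ∃ T ⊆ S, T.card = 3 ∧ ∀ x ∈ T, ∀ y ∈ T, x ≠ y → χ x y = c := by
  induction d with
  | zero =>
    intro D S hD hS hc
    obtain ⟨x, hx, y, hy, hxy⟩ := Finset.one_lt_card.1 (show 1 < S.card from hc)
    have := hS x hx y hy hxy
    rw [Finset.card_eq_zero.1 hD] at this
    simp at this
  | succ d ih =>
    intro D S hD hS hc
    obtain ⟨v, hv⟩ := Finset.card_pos.1 (by omega : 0 < S.card)
    have hce := Finset.card_erase_of_mem hv
    rw [tcG] at hc
    obtain ⟨c, hcD, hcc⟩ := Finset.exists_lt_card_fiber_of_mul_lt_card_of_maps_to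
      (s := S.erase v) (t := D) (f := χ v) (n := tcG d)
      (fun x hx => hS v hv x (Finset.mem_of_mem_erase hx) (Finset.ne_of_mem_erase hx).symm)
      (by rw [hD]; omega)
    set N := (S.erase v).filter (fun x => χ v x = c) with hN
    have hNm : ∀ x ∈ N, x ∈ S ∧ x ≠ v ∧ χ v x = c := by
      intro x hx
      rw [hN, Finset.mem_filter, Finset.mem_erase] at hx
      tauto
    have hNS : N ⊆ S := fun x hx => (hNm x hx).1
    by_cases h : ∃ x ∈ N, ∃ y ∈ N, x ≠ y ∧ χ x y = c
    · obtain ⟨x, hx, y, hy, hxy, hcol⟩ := h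
      obtain ⟨a1, a2, a3⟩ := hNm x hx
      obtain ⟨b1, b2, b3⟩ := hNm y hy
      refine ⟨c, {v, x, y}, ?_, Finset.card_eq_three.2 ⟨v, x, y, a2.symm, b2.symm, hxy, rfl⟩, ?_⟩
      · intro z hz
        simp only [Finset.mem_insert, Finset.mem_singleton] at hz
        rcases hz with rfl | rfl | rfl <;> assumption
      · intro z hz w hw hne
        simp only [Finset.mem_insert, Finset.mem_singleton] at hz hw
        rcases hz with rfl | rfl | rfl <;> rcases hw with rfl | rfl | rfl <;>
          first | exact absurd rfl hne | assumption | (rw [hχ]; assumption)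
    · push Not at h
      obtain ⟨c', T, hT, hT'⟩ := ih (D.erase c) N (by rw [Finset.card_erase_of_mem hcD]; omega)
        (fun x hx y hy hxy => Finset.mem_erase.2
          ⟨h x hx y hy hxy, hS x (hNS hx) y (hNS hy) hxy⟩) hcc
      exact ⟨c', T, hT.trans hNS, hT'⟩

theorem tc_count (n R : ℕ) (hR3 : 3 ≤ R) (hRn : R ≤ n) (M : Finset (Finset (Fin n)))
    (hM3 : ∀ T ∈ M, T.card = 3)
    (hM : ∀ S : Finset (Fin n), S.card = R → ∃ T ∈ M, T ⊆ S) :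
    n.choose 3 ≤ M.card * R.choose 3 := by
  have hsub : Finset.powersetCard R (Finset.univ : Finset (Fin n)) ⊆
      M.biUnion (fun T => (Finset.powersetCard R (Finset.univ : Finset (Fin n))).filter
        (fun S => T ⊆ S)) := by
    intro S hS
    obtain ⟨T, hT, hTS⟩ := hM S (Finset.mem_powersetCard.1 hS).2
    exact Finset.mem_biUnion.2 ⟨T, hT, Finset.mem_filter.2 ⟨hS, hTS⟩⟩
  have h1 := Finset.card_le_card hsub
  rw [Finset.card_powersetCard, Finset.card_univ, Fintype.card_fin] at h1
  have h2 : n.choose R ≤ M.card * (n - 3).choose (R - 3) := by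
    refine h1.trans (Finset.card_biUnion_le_card_mul _ _ _ ?_)
    intro T hT
    have : (n - 3).choose (R - 3) = (Finset.powersetCard (R - 3) (Finset.univ \ T)).card := by
      rw [Finset.card_powersetCard, Finset.card_sdiff_of_subset (Finset.subset_univ _),
        Finset.card_univ, Fintype.card_fin, hM3 T hT]
    rw [this]
    apply Finset.card_le_card_of_injOn (fun S => S \ T)
    · intro S hS
      simp only [Finset.mem_coe, Finset.mem_filter, Finset.mem_powersetCard] at hS
      simp only [Finset.mem_coe, Finset.mem_powersetCard]
      refine ⟨Finset.sdiff_subset_sdiff (Finset.subset_univ _) subset_rfl, ?_⟩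
      rw [Finset.card_sdiff_of_subset hS.2, hM3 T hT, hS.1.2]
    · intro S hS S' hS' h
      simp only [Finset.mem_coe, Finset.mem_filter] at hS hS'
      simp only at h
      rw [← Finset.sdiff_union_of_subset hS.2, h, Finset.sdiff_union_of_subset hS'.2]
  have h3 := Nat.choose_mul (n := n) (k := R) (s := 3) hR3
  have hpos : 0 < (n - 3).choose (R - 3) := Nat.choose_pos (by omega)
  refine Nat.le_of_mul_le_mul_right ?_ hpos
  rw [← h3]
  calc n.choose R * R.choose 3 ≤ (M.card * (n - 3).choose (R - 3)) * R.choose 3 :=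
        Nat.mul_le_mul_right _ h2
    _ = _ := by ring

theorem tc_main (k r n : ℕ) (hk : 3 ≤ k) (hr : 1 ≤ r) (hn : 100 * k * r ^ (3 * r) ≤ n)
    (χ : Fin n → Fin n → Fin r) (hχ : ∀ u v, χ u v = χ v u) :
    ∃ (col : Fin r) (f : (Fin k ⊕ Fin k) ↪ Fin n),
      ∀ a b : Fin k ⊕ Fin k, (triangleCycle k).Adj a b → χ (f a) (f b) = col := by
  classical
  set R := tcG r + 1 with hR
  set X := r ^ (3 * r) with hX
  have hXpos : 1 ≤ X := Nat.one_le_pow _ _ hr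
  have hR3 : 3 ≤ R := by
    obtain ⟨d, rfl⟩ : ∃ d, r = d + 1 := ⟨r - 1, by omega⟩
    rw [hR, tcG]
    nlinarith [tcG_pos d]
  have hRle : R ≤ 3 * r ^ r :=
    (tcG_le r).trans (Nat.mul_le_mul_left 3 (Nat.factorial_le_pow r))
  have hRX : R ^ 3 ≤ 27 * X := by
    calc R ^ 3 ≤ (3 * r ^ r) ^ 3 := Nat.pow_le_pow_left hRle 3
      _ = 27 * X := by rw [hX, mul_pow, ← pow_mul, mul_comm r 3]; norm_num
  have hkX : X ≤ k * X := Nat.le_mul_of_pos_left _ (by omega)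
  have hn' : 100 * (k * X) ≤ n := by rw [← mul_assoc]; exact hn
  have hRn : R ≤ n := by
    have : R ≤ R ^ 3 := Nat.le_self_pow (by norm_num) R
    omega
  set M := (Finset.powersetCard 3 (Finset.univ : Finset (Fin n))).filter
    (fun T => ∃ c, ∀ x ∈ T, ∀ y ∈ T, x ≠ y → χ x y = c) with hM
  have hcount := tc_count n R hR3 hRn M
    (fun T hT => (Finset.mem_powersetCard.1 (Finset.mem_filter.1 hT).1).2) (by
      intro S hS
      obtain ⟨c, T, hTS, hT3, hTc⟩ := tc_ramsey χ hχ r Finset.univ S (by simp)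
        (fun _ _ _ _ _ => Finset.mem_univ _) (by omega)
      exact ⟨T, Finset.mem_filter.2 ⟨Finset.mem_powersetCard.2
        ⟨Finset.subset_univ _, hT3⟩, c, hTc⟩, hTS⟩)
  have hbig : 2 * k * (M.biUnion (Finset.powersetCard 2)).card < M.card := by
    have hP : (M.biUnion (Finset.powersetCard 2)).card ≤ n.choose 2 := by
      have : M.biUnion (Finset.powersetCard 2) ⊆
          Finset.powersetCard 2 (Finset.univ : Finset (Fin n)) := by
        intro p hp
        obtain ⟨T, _, hT⟩ := Finset.mem_biUnion.1 hp
        exact Finset.mem_powersetCard.2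
          ⟨Finset.subset_univ _, (Finset.mem_powersetCard.1 hT).2⟩
      have := Finset.card_le_card this
      rwa [Finset.card_powersetCard, Finset.card_univ, Fintype.card_fin] at this
    by_contra hcon
    push Not at hcon
    have h1 : M.card ≤ 2 * k * n.choose 2 := hcon.trans (Nat.mul_le_mul_left _ hP)
    have h2 : n.choose 3 * 3 = n.choose 2 * (n - 2) := Nat.choose_succ_right_eq n 2
    have h4 : 6 * R.choose 3 ≤ R ^ 3 := by
      have h := Nat.descFactorial_le_pow R 3
      rw [Nat.descFactorial_eq_factorial_mul_choose] at h
      exact h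
    have hpos : 0 < n.choose 2 := Nat.choose_pos (by omega)
    have h5 : n.choose 2 * (n - 2) ≤ n.choose 2 * (27 * (k * X)) := by
      calc n.choose 2 * (n - 2) = n.choose 3 * 3 := h2.symm
        _ ≤ (M.card * R.choose 3) * 3 := Nat.mul_le_mul_right _ hcount
        _ ≤ (2 * k * n.choose 2 * R.choose 3) * 3 := by gcongr
        _ = n.choose 2 * (k * (6 * R.choose 3)) := by ring
        _ ≤ n.choose 2 * (k * (27 * X)) := 
          Nat.mul_le_mul_left _ (Nat.mul_le_mul_left _ (h4.trans hRX))
        _ = _ := by ring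
    have := Nat.le_of_mul_le_mul_left h5 hpos
    omega
  obtain ⟨M', hM'M, ⟨T₀, hT₀⟩, hdeg⟩ := tc_prune (2 * k) M hbig
  have hmono : ∀ T ∈ M', T.card = 3 ∧ ∃ c, ∀ x ∈ T, ∀ y ∈ T, x ≠ y → χ x y = c := by
    intro T hT
    have := Finset.mem_filter.1 (hM'M hT)
    exact ⟨(Finset.mem_powersetCard.1 this.1).2, this.2⟩
  obtain ⟨hT3, c, hc⟩ := hmono T₀ hT₀
  obtain ⟨a, b, e, hab, -, -, hTe⟩ := Finset.card_eq_three.1 hT3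
  have haT : a ∈ T₀ := by simp [hTe]
  have hbT : b ∈ T₀ := by simp [hTe]
  obtain ⟨f, hf⟩ := tc_greedy k hk
    (fun x y => x ≠ y ∧ χ x y = c ∧ ∃ T ∈ M', x ∈ T ∧ y ∈ T)
    (fun x y h => ⟨h.1.symm, (hχ y x).trans h.2.1, by
      obtain ⟨T, h1, h2, h3⟩ := h.2.2
      exact ⟨T, h1, h3, h2⟩⟩)
    (fun x h => h.1 rfl)
    (by
      rintro x y ⟨hxy, hcol, T, hT, hxT, hyT⟩
      have hd := hdeg {x, y} (Finset.card_pair hxy) ⟨T, hT, by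
        simp [Finset.insert_subset_iff, hxT, hyT]⟩
      refine ⟨Finset.univ.filter (fun z => z ≠ x ∧ z ≠ y ∧ {x, y, z} ∈ M'), ?_, ?_⟩
      · refine hd.trans ?_
        refine (Finset.card_le_card (t := (Finset.univ.filter
          (fun z => z ≠ x ∧ z ≠ y ∧ {x, y, z} ∈ M')).image (fun z => {x, y, z})) ?_).trans
          Finset.card_image_le
        intro S hS
        obtain ⟨hS1, hS2⟩ := Finset.mem_filter.1 hS
        have hS3 := (hmono S hS1).1
        obtain ⟨z, hzS, hz⟩ := Finset.exists_mem_notMem_of_card_lt_card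
          (s := {x, y}) (t := S) (by rw [Finset.card_pair hxy]; omega)
        simp only [Finset.mem_insert, Finset.mem_singleton, not_or] at hz
        have hEq : ({x, y, z} : Finset (Fin n)) = S := by
          apply Finset.eq_of_subset_of_card_le
          · simp only [Finset.insert_subset_iff, Finset.singleton_subset_iff] at hS2 ⊢
            exact ⟨hS2.1, hS2.2, hzS⟩
          · rw [hS3, Finset.card_eq_three.2
              ⟨x, y, z, hxy, Ne.symm hz.1, Ne.symm hz.2, rfl⟩]
        refine Finset.mem_image.2 ⟨z, Finset.mem_filter.2
          ⟨Finset.mem_univ _, hz.1, hz.2, ?_⟩, hEq⟩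
        rw [hEq]
        exact hS1
      · intro z hz
        obtain ⟨-, hzx, hzy, hzM⟩ := Finset.mem_filter.1 hz
        obtain ⟨-, c', hc'⟩ := hmono _ hzM
        have e1 := hc' x (by simp) y (by simp) hxy
        have e2 := hc' x (by simp) z (by simp) hzx.symm
        have e3 := hc' y (by simp) z (by simp) hzy.symm
        have : c' = c := e1.symm.trans hcol
        subst this
        exact ⟨⟨hzx.symm, e2, _, hzM, by simp, by simp⟩,
          ⟨hzy.symm, e3, _, hzM, by simp, by simp⟩⟩)
    a b ⟨hab, hc a haT b hbT hab, T₀, hT₀, haT, hbT⟩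
  exact ⟨c, f, fun a b h => (hf a b h).2.1⟩

/-- There is an absolute constant `C` such that for every `k ≥ 3` and `r ≥ 1`, every
colouring of the edges of `K_n` with at most `r` colours, where `n ≥ C·k·r^(3r)`, contains
a monochromatic copy of the triangle cycle `T_k`. -/
theorem ramsey_triangle_cycle :
    ∃ C : ℝ, 0 < C ∧ ∀ (k r n : ℕ), 3 ≤ k → 1 ≤ r →
      C * (k : ℝ) * (r : ℝ) ^ (3 * r) ≤ (n : ℝ) →
      ∀ χ : Fin n → Fin n → Fin r, (∀ u v, χ u v = χ v u) →
        ∃ (col : Fin r) (f : (Fin k ⊕ Fin k) ↪ Fin n),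
          ∀ a b : Fin k ⊕ Fin k, (triangleCycle k).Adj a b → χ (f a) (f b) = col := by
  refine ⟨100, by norm_num, ?_⟩
  intro k r n hk hr hn χ hχ
  exact tc_main k r n hk hr (by exact_mod_cast hn) χ hχ
end

section
/- There exists an absolute constant C such that for every k ≥ 3 and every r ≥ 1, every r-local edge colouring of the complete graph K_n, where n ≥ C·k·r^{4r}, contains a monochromatic copy of the triangle cycle T_k. -/
namespace LRT

def MonoSet {V : Type*} (χ : V → V → ℕ) (T : Finset V) : Prop :=
  ∃ c, ∀ a ∈ T, ∀ b ∈ T, a ≠ b → χ a b = c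

def N : ℕ → ℕ
  | 0 => 1
  | r + 1 => (r + 1) * N r + 1

lemma N_le (r : ℕ) : N r ≤ 2 * r ^ r := by
  induction r with
  | zero => simp [N]
  | succ r ih =>
    rcases Nat.eq_zero_or_pos r with rfl | hr
    · simp [N]
    · have h : r ^ r < (r + 1) ^ r := Nat.pow_lt_pow_left (by omega) (by omega)
      have h2 : (r + 1) * N r ≤ (r + 1) * (2 * r ^ r) := Nat.mul_le_mul_left _ ih
      have h3 : (r + 1) * (r ^ r + 1) ≤ (r + 1) * (r + 1) ^ r := Nat.mul_le_mul_left _ h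
      rw [N, pow_succ]
      nlinarith

lemma exists_mono {V : Type*} [DecidableEq V] (χ : V → V → ℕ) (hs : ∀ u v, χ u v = χ v u)
    (r : ℕ) : ∀ S : Finset V, N r < S.card →
      (∀ v ∈ S, ((S.erase v).image (χ v)).card ≤ r) →
      ∃ T ⊆ S, T.card = 3 ∧ MonoSet χ T := by
  induction r with
  | zero =>
    intro S hS hl
    obtain ⟨a, ha, b, hb, hab⟩ := Finset.one_lt_card.1 hS
    have := hl a ha
    have h2 : χ a b ∈ (S.erase a).image (χ a) :=
      Finset.mem_image_of_mem _ (Finset.mem_erase.2 ⟨hab.symm, hb⟩)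
    have := Finset.card_pos.2 ⟨_, h2⟩
    omega
  | succ r ih =>
    intro S hS hl
    obtain ⟨v, hv⟩ : S.Nonempty := Finset.card_pos.1 (by omega)
    have h1 : ((S.erase v).image (χ v)).card * N r < (S.erase v).card := by
      rw [Finset.card_erase_of_mem hv]
      have := Nat.mul_le_mul_right (N r) (hl v hv)
      rw [N] at hS
      omega
    obtain ⟨c, hc, hlt⟩ := Finset.exists_lt_card_fiber_of_mul_lt_card_of_maps_to
      (fun x hx => Finset.mem_image_of_mem (χ v) hx) h1
    set S' := (S.erase v).filter (fun x => χ v x = c) with hS'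
    have hmem : ∀ x ∈ S', x ≠ v ∧ x ∈ S ∧ χ v x = c := by
      intro x hx
      simp only [hS', Finset.mem_filter, Finset.mem_erase] at hx
      exact ⟨hx.1.1, hx.1.2, hx.2⟩
    by_cases hex : ∃ a ∈ S', ∃ b ∈ S', a ≠ b ∧ χ a b = c
    · obtain ⟨a, ha, b, hb, hab, hcab⟩ := hex
      obtain ⟨a1, a2, a3⟩ := hmem a ha
      obtain ⟨b1, b2, b3⟩ := hmem b hb
      refine ⟨{v, a, b}, ?_, ?_, c, ?_⟩
      · intro x hx
        simp only [Finset.mem_insert, Finset.mem_singleton] at hx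
        rcases hx with rfl | rfl | rfl <;> assumption
      · rw [Finset.card_eq_three]
        exact ⟨v, a, b, a1.symm, b1.symm, hab, rfl⟩
      · intro x hx y hy hxy
        simp only [Finset.mem_insert, Finset.mem_singleton] at hx hy
        have := hs a v
        have := hs b v
        have := hs b a
        rcases hx with rfl | rfl | rfl <;> rcases hy with rfl | rfl | rfl <;>
          first
          | exact absurd rfl hxy
          | omega
    · push Not at hex
      obtain ⟨T, hT, h3, hm⟩ := ih S' hlt (by
        intro w hw
        obtain ⟨w1, w2, w3⟩ := hmem w hw
        have hsub : (S'.erase w).image (χ w) ⊆ ((S.erase w).image (χ w)).erase c := by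
          intro z hz
          obtain ⟨x, hx, rfl⟩ := Finset.mem_image.1 hz
          obtain ⟨hxw, hx⟩ := Finset.mem_erase.1 hx
          refine Finset.mem_erase.2 ⟨hex w hw x hx hxw.symm, Finset.mem_image_of_mem _ ?_⟩
          exact Finset.mem_erase.2 ⟨hxw, (hmem x hx).2.1⟩
        have hcm : c ∈ (S.erase w).image (χ w) := by
          rw [← w3, hs v w]
          exact Finset.mem_image_of_mem _ (Finset.mem_erase.2 ⟨w1.symm, hv⟩)
        have h5 := Finset.card_le_card hsub
        rw [Finset.card_erase_of_mem hcm] at h5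
        have := hl w w2
        omega)
      exact ⟨T, fun x hx => (hmem x (hT hx)).2.1, h3, hm⟩

/-- path in the neighbourhood of a vertex -/
lemma exists_path {V : Type*} [Fintype V] [DecidableEq V] (A : V → V → Prop)
    [DecidableRel A] (hi : ∀ a, ¬ A a a) (k : ℕ)
    (hc : ∀ a b, A a b → 2 * k ≤ (Finset.univ.filter (fun x => A a x ∧ A b x)).card)
    (v w : V) (hvw : A v w) (j : ℕ) (hj : j + 1 < 2 * k) :
    ∃ u : ℕ → V, (∀ i < j + 1, A (u i) (u (i + 1))) ∧
      (∀ i, 1 ≤ i → i ≤ j + 1 → A (u 0) (u i)) ∧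
      (∀ i ≤ j + 1, ∀ l ≤ j + 1, u i = u l → i = l) := by
  induction j with
  | zero =>
    have hne : v ≠ w := fun h => hi v (by rw [← h] at hvw; exact hvw)
    refine ⟨fun i => if i = 0 then v else w, ?_, ?_, ?_⟩
    · intro i h
      have : i = 0 := by omega
      subst this; simpa using hvw
    · intro i h h'
      have : i = 1 := by omega
      subst this; simpa using hvw
    · intro i h l h' he
      by_cases h1 : i = 0 <;> by_cases h2 : l = 0 <;> simp [h1, h2] at he ⊢ <;>
        first
        | omega
        | exact absurd he hne
        | exact absurd he.symm hne
  | succ j ih =>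
    obtain ⟨u, h1, h2, h3⟩ := ih (by omega)
    have hcard := hc _ _ (h2 (j + 1) (by omega) le_rfl)
    have himg : ((Finset.range (j + 2)).image u).card <
        (Finset.univ.filter (fun x => A (u 0) x ∧ A (u (j + 1)) x)).card := by
      have := Finset.card_image_le (s := Finset.range (j + 2)) (f := u)
      rw [Finset.card_range] at this
      omega
    obtain ⟨y, hy, hyn⟩ := Finset.exists_mem_notMem_of_card_lt_card himg
    simp only [Finset.mem_filter, Finset.mem_univ, true_and] at hy
    have hyn' : ∀ i ≤ j + 1, u i ≠ y := by
      intro i hi he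
      exact hyn (Finset.mem_image.2 ⟨i, Finset.mem_range.2 (by omega), he⟩)
    refine ⟨fun i => if i ≤ j + 1 then u i else y, ?_, ?_, ?_⟩
    · intro i h
      by_cases hij : i = j + 1
      · subst hij
        simpa using hy.2
      · have e1 : i ≤ j + 1 := by omega
        have e2 : i + 1 ≤ j + 1 := by omega
        simp only [e1, e2, if_true]
        exact h1 i (by omega)
    · intro i h h'
      by_cases hij : i ≤ j + 1
      · simp only [hij, if_true, Nat.zero_le]
        exact h2 i h hij
      · simp only [hij, if_false, if_true, Nat.zero_le]
        exact hy.1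
    · intro i h l h' he
      by_cases e1 : i ≤ j + 1 <;> by_cases e2 : l ≤ j + 1 <;>
        simp only [e1, e2, if_true, if_false] at he
      · exact h3 i e1 l e2 he
      · exact absurd he (hyn' i e1)
      · exact absurd he.symm (hyn' l e2)
      · omega

lemma embed {V : Type*} [Fintype V] [DecidableEq V] (A : V → V → Prop)
    [DecidableRel A] (hi : ∀ a, ¬ A a a) (hsym : ∀ a b, A a b → A b a) (k : ℕ) (hk : 3 ≤ k)
    (hc : ∀ a b, A a b → 2 * k ≤ (Finset.univ.filter (fun x => A a x ∧ A b x)).card)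
    (v w : V) (hvw : A v w) :
    ∃ f : (Fin k ⊕ Fin k) ↪ V, ∀ a b, (triangleCycle k).Adj a b → A (f a) (f b) := by
  obtain ⟨u, h1, h2, h3⟩ := exists_path A hi k hc v w hvw (k - 2) (by omega)
  have hcyc : ∀ i < k, A (u i) (u ((i + 1) % k)) := by
    intro i hik
    by_cases h : i + 1 = k
    · rw [h, Nat.mod_self]
      exact hsym _ _ (h2 i (by omega) (by omega))
    · rw [Nat.mod_eq_of_lt (by omega)]
      exact h1 i (by omega)
  set U : Finset V := (Finset.range k).image u with hU
  have hUc : U.card ≤ k := by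
    have := Finset.card_image_le (s := Finset.range k) (f := u)
    rwa [Finset.card_range] at this
  let S : Fin k → Finset V := fun i =>
    (Finset.univ.filter (fun x => A (u i) x ∧ A (u ((i + 1) % k)) x)) \ U
  have hS : ∀ i, k ≤ (S i).card := by
    intro i
    have e1 := hc _ _ (hcyc i i.2)
    have e2 := Finset.le_card_sdiff U
      (Finset.univ.filter (fun x => A (u i) x ∧ A (u ((i + 1) % k)) x))
    show k ≤ (_ \ U).card
    omega
  obtain ⟨g, hg, hgS⟩ := (Finset.all_card_le_biUnion_card_iff_exists_injective S).1 (by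
    intro s
    rcases s.eq_empty_or_nonempty with rfl | ⟨i, his⟩
    · simp
    · calc s.card ≤ k := by simpa using Finset.card_le_univ s
        _ ≤ (S i).card := hS i
        _ ≤ _ := Finset.card_le_card (Finset.subset_biUnion_of_mem S his))
  have hgA : ∀ i : Fin k, A (u i) (g i) ∧ A (u ((i + 1) % k)) (g i) := by
    intro i
    have := hgS i
    simp only [S, Finset.mem_sdiff, Finset.mem_filter, Finset.mem_univ, true_and] at this
    exact this.1
  have hgU : ∀ i j : Fin k, u i ≠ g j := by
    intro i j he
    have := hgS j
    simp only [S, Finset.mem_sdiff] at this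
    exact this.2 (Finset.mem_image.2 ⟨i, Finset.mem_range.2 i.2, he⟩)
  refine ⟨⟨Sum.elim (fun i => u i) g, ?_⟩, ?_⟩
  · rintro (i | i) (j | j) h
    · have := h3 i (by omega) j (by omega) h
      rw [Fin.ext this]
    · exact absurd h (hgU i j)
    · exact absurd h.symm (hgU j i)
    · rw [hg h]
  · have key : ∀ i j : Fin k, (i = j ∨ (i : ℕ) = ((j : ℕ) + 1) % k) → A (u i) (g j) := by
      rintro i j (rfl | h)
      · exact (hgA i).1
      · rw [h]; exact (hgA j).2
    rintro (i | i) (j | j) h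
    · rw [triangleCycle, SimpleGraph.fromRel_adj] at h
      obtain ⟨-, h | h⟩ := h
      · have := hcyc i i.2
        simp only at h
        rw [← h] at this
        exact this
      · have := hcyc j j.2
        simp only at h
        rw [← h] at this
        exact hsym _ _ this
    · rw [triangleCycle, SimpleGraph.fromRel_adj] at h
      obtain ⟨-, h | h⟩ := h
      · exact key i j h
      · exact h.elim
    · rw [triangleCycle, SimpleGraph.fromRel_adj] at h
      obtain ⟨-, h | h⟩ := h
      · exact h.elim
      · exact hsym _ _ (key j i h)
    · rw [triangleCycle, SimpleGraph.fromRel_adj] at h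
      obtain ⟨-, h | h⟩ := h
      · exact h.elim
      · exact h.elim

open Classical in
/-- mono triangles with all edges in `E` -/
noncomputable def tri {n : ℕ} (χ : Fin n → Fin n → ℕ) (E : Finset (Finset (Fin n))) :
    Finset (Finset (Fin n)) :=
  (Finset.univ.powersetCard 3).filter (fun T => MonoSet χ T ∧ ∀ e ⊆ T, e.card = 2 → e ∈ E)

open Classical in
lemma many {n : ℕ} (χ : Fin n → Fin n → ℕ) (hs : ∀ u v, χ u v = χ v u) (k : ℕ) (hk : 3 ≤ k)
    (E₀ : Finset (Finset (Fin n))) (hE : 2 * k * E₀.card < (tri χ E₀).card) :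
    ∃ (col : ℕ) (f : (Fin k ⊕ Fin k) ↪ Fin n),
      ∀ a b : Fin k ⊕ Fin k, (triangleCycle k).Adj a b → χ (f a) (f b) = col := by
  obtain ⟨E, hEmem, hmax⟩ := Finset.exists_max_image E₀.powerset
    (fun E => ((tri χ E).card : ℤ) - 2 * k * E.card) ⟨E₀, Finset.mem_powerset_self _⟩
  have h0 := hmax E₀ (Finset.mem_powerset_self _)
  have hpos : 0 < (tri χ E).card := by
    have : (2 * k * E₀.card : ℤ) < (tri χ E₀).card := by exact_mod_cast hE
    have h' : (0 : ℤ) ≤ 2 * k * E.card := by positivity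
    have : (0 : ℤ) < (tri χ E).card := by linarith
    exact_mod_cast this
  have hmemtri : ∀ (F : Finset (Finset (Fin n))) (T : Finset (Fin n)),
      T ∈ tri χ F ↔ T.card = 3 ∧ MonoSet χ T ∧ ∀ e ⊆ T, e.card = 2 → e ∈ F := by
    intro F T
    simp [tri, Finset.mem_filter, Finset.mem_powersetCard]
  obtain ⟨T, hT⟩ := Finset.card_pos.1 hpos
  obtain ⟨hT3, -, hTE⟩ := (hmemtri _ _).1 hT
  obtain ⟨p, q, s, hpq, -, -, rfl⟩ := Finset.card_eq_three.1 hT3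
  have hpqE : {p, q} ∈ E := by
    apply hTE _ _ (Finset.card_pair hpq)
    intro x hx
    simp only [Finset.mem_insert, Finset.mem_singleton] at hx ⊢
    tauto
  let A : Fin n → Fin n → Prop := fun a b => a ≠ b ∧ {a, b} ∈ E ∧ χ a b = χ p q
  have hA := embed A (fun a h => h.1 rfl)
    (fun a b h => ⟨h.1.symm, by rw [Finset.pair_comm]; exact h.2.1, by rw [hs]; exact h.2.2⟩)
    k hk ?_ p q ⟨hpq, hpqE, rfl⟩
  · obtain ⟨f, hf⟩ := hA
    exact ⟨χ p q, f, fun a b h => (hf a b h).2.2⟩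
  rintro a b ⟨hab, habE, hcol⟩
  have hsubE : E ⊆ E₀ := Finset.mem_powerset.1 hEmem
  have h1 := hmax (E.erase {a, b})
    (Finset.mem_powerset.2 ((Finset.erase_subset _ _).trans hsubE))
  have hEc : (E.erase {a, b}).card + 1 = E.card := Finset.card_erase_add_one habE
  have h2 : (tri χ (E.erase {a, b})).card + 2 * k ≤ (tri χ E).card := by
    rw [← hEc] at h1
    push_cast at h1
    have : ((tri χ (E.erase {a, b})).card : ℤ) + 2 * k ≤ (tri χ E).card := by linarith
    exact_mod_cast this
  have h3 := Finset.le_card_sdiff (tri χ (E.erase {a, b})) (tri χ E)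
  have h4 : tri χ E \ tri χ (E.erase {a, b}) ⊆
      (Finset.univ.filter (fun x => A a x ∧ A b x)).image (fun x => insert x {a, b}) := by
    intro T hT
    rw [Finset.mem_sdiff, hmemtri, hmemtri] at hT
    obtain ⟨⟨hT3, hTm, hTE⟩, hn⟩ := hT
    have habT : {a, b} ⊆ T := by
      by_contra hnot
      refine hn ⟨hT3, hTm, fun e he he2 => Finset.mem_erase.2 ⟨?_, hTE e he he2⟩⟩
      rintro rfl
      exact hnot he
    have hc2 := Finset.card_pair hab
    obtain ⟨x, hx⟩ : (T \ {a, b}).Nonempty := by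
      rw [← Finset.card_pos, Finset.card_sdiff_of_subset habT]
      omega
    rw [Finset.mem_sdiff] at hx
    obtain ⟨hxT, hxab⟩ := hx
    have hTeq : insert x {a, b} = T := by
      apply Finset.eq_of_subset_of_card_le
      · exact Finset.insert_subset hxT habT
      · rw [Finset.card_insert_of_notMem hxab]; omega
    have haT : a ∈ T := habT (by simp)
    have hbT : b ∈ T := habT (by simp)
    simp only [Finset.mem_insert, Finset.mem_singleton, not_or] at hxab
    obtain ⟨c, hc⟩ := hTm
    have e1 := hc a haT b hbT hab
    have e2 := hc a haT x hxT (Ne.symm hxab.1)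
    have e3 := hc b hbT x hxT (Ne.symm hxab.2)
    refine Finset.mem_image.2 ⟨x, Finset.mem_filter.2 ⟨Finset.mem_univ _,
      ⟨Ne.symm hxab.1, ?_, by omega⟩, ⟨Ne.symm hxab.2, ?_, by omega⟩⟩, hTeq⟩
    · apply hTE _ _ (Finset.card_pair (Ne.symm hxab.1))
      exact Finset.insert_subset haT (Finset.singleton_subset_iff.2 hxT)
    · apply hTE _ _ (Finset.card_pair (Ne.symm hxab.2))
      exact Finset.insert_subset hbT (Finset.singleton_subset_iff.2 hxT)
  have h5 := (Finset.card_le_card h4).trans Finset.card_image_le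
  have h6 : 2 * k ≤ (Finset.univ.filter (fun x => A a x ∧ A b x)).card := by omega
  convert h6

open Classical in
lemma count {n m : ℕ} (χ : Fin n → Fin n → ℕ) (hm : 3 ≤ m) (hmn : m ≤ n)
    (h : ∀ S : Finset (Fin n), S.card = m → ∃ T ⊆ S, T.card = 3 ∧ MonoSet χ T) :
    n.choose 3 ≤ (tri χ (Finset.univ.powersetCard 2)).card * m.choose 3 := by
  set τ := tri χ (Finset.univ.powersetCard 2) with hτ
  have h1 : (Finset.univ.powersetCard m : Finset (Finset (Fin n))) ⊆
      τ.biUnion (fun T => (Finset.univ.powersetCard m).filter (fun S => T ⊆ S)) := by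
    intro S hS
    obtain ⟨T, hTS, hT3, hTm⟩ := h S (Finset.mem_powersetCard.1 hS).2
    refine Finset.mem_biUnion.2 ⟨T, ?_, Finset.mem_filter.2 ⟨hS, hTS⟩⟩
    simp only [hτ, tri, Finset.mem_filter, Finset.mem_powersetCard, Finset.subset_univ, true_and]
    exact ⟨hT3, hTm, fun e _ he => he⟩
  have h2 : ∀ T ∈ τ, ((Finset.univ.powersetCard m).filter (fun S => T ⊆ S)).card ≤
      (n - 3).choose (m - 3) := by
    intro T hT
    have hT3 : T.card = 3 := by
      simp only [hτ, tri, Finset.mem_filter, Finset.mem_powersetCard] at hT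
      exact hT.1.2
    have : ((Finset.univ \ T).powersetCard (m - 3)).card = (n - 3).choose (m - 3) := by
      rw [Finset.card_powersetCard, Finset.card_sdiff_of_subset (Finset.subset_univ _)]
      simp [hT3]
    rw [← this]
    apply Finset.card_le_card_of_injOn (fun S => S \ T)
    · intro S hS
      simp only [Finset.coe_filter, Finset.mem_powersetCard, Set.mem_ofPred_eq] at hS
      simp only [Finset.mem_coe, Finset.mem_powersetCard]
      refine ⟨Finset.sdiff_subset_sdiff (Finset.subset_univ _) le_rfl, ?_⟩
      rw [Finset.card_sdiff_of_subset hS.2, hT3, hS.1.2]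
    · intro S hS S' hS' he
      simp only [Finset.coe_filter, Finset.mem_powersetCard, Set.mem_ofPred_eq] at hS hS'
      simp only at he
      rw [← Finset.sdiff_union_of_subset hS.2, he, Finset.sdiff_union_of_subset hS'.2]
  have h3 := (Finset.card_le_card h1).trans (Finset.card_biUnion_le_card_mul _ _ _ h2)
  rw [Finset.card_powersetCard, Finset.card_univ, Fintype.card_fin] at h3
  have h4 := Nat.choose_mul (n := n) hm
  have hpos : 0 < (n - 3).choose (m - 3) := Nat.choose_pos (by omega)
  have h5 := Nat.mul_le_mul_right (m.choose 3) h3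
  rw [h4] at h5
  apply Nat.le_of_mul_le_mul_right _ hpos
  calc _ ≤ _ := h5
    _ = _ := by ring

end LRT

/-- There is an absolute constant `C` such that for every `k ≥ 3` and `r ≥ 1`, every
`r`-local edge colouring of `K_n`, where `n ≥ C·k·r^(4r)`, contains a monochromatic copy
of the triangle cycle `T_k`. -/
theorem local_ramsey_triangle_cycle :
    ∃ C : ℝ, 0 < C ∧ ∀ (k r n : ℕ), 3 ≤ k → 1 ≤ r →
      C * (k : ℝ) * (r : ℝ) ^ (4 * r) ≤ (n : ℝ) →
      ∀ χ : Fin n → Fin n → ℕ, (∀ u v, χ u v = χ v u) →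
        (∀ v : Fin n, ((Finset.univ.erase v).image (χ v)).card ≤ r) →
        ∃ (col : ℕ) (f : (Fin k ⊕ Fin k) ↪ Fin n),
          ∀ a b : Fin k ⊕ Fin k, (triangleCycle k).Adj a b → χ (f a) (f b) = col := by
  refine ⟨200, by norm_num, ?_⟩
  intro k r n hk hr hn χ hs hl
  have hn' : 200 * k * (r ^ r) ^ 4 ≤ n := by
    rw [← pow_mul, mul_comm r 4]
    exact_mod_cast hn
  have hR : 1 ≤ r ^ r := Nat.one_le_pow _ _ hr
  have hN := LRT.N_le r
  generalize r ^ r = R at hn' hR hN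
  have hN2 : 2 ≤ LRT.N r := by
    obtain ⟨s, rfl⟩ : ∃ s, r = s + 1 := ⟨r - 1, by omega⟩
    have : 1 ≤ LRT.N s := by cases s <;> simp [LRT.N]
    rw [LRT.N]
    nlinarith
  have hR34 : R ^ 3 ≤ R ^ 4 := Nat.pow_le_pow_right hR (by norm_num)
  have hR14 : R ≤ R ^ 4 := Nat.le_self_pow (by norm_num) R
  have hR3 : 1 ≤ R ^ 3 := Nat.one_le_pow _ _ hR
  have hmn : LRT.N r + 1 ≤ n := by nlinarith
  have hcount := LRT.count (m := LRT.N r + 1) χ (by omega) hmn (by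
    intro S hS
    apply LRT.exists_mono χ hs r S (by omega)
    intro v _
    exact (Finset.card_le_card (Finset.image_subset_image
      (Finset.erase_subset_erase v (Finset.subset_univ S)))).trans (hl v))
  apply LRT.many χ hs k hk (Finset.univ.powersetCard 2)
  rw [Finset.card_powersetCard, Finset.card_univ, Fintype.card_fin]
  by_contra hcon
  push Not at hcon
  have hm3 : (LRT.N r + 1).choose 3 ≤ 27 * R ^ 3 := by
    calc _ ≤ (LRT.N r + 1) ^ 3 := Nat.choose_le_pow _ _
      _ ≤ (3 * R) ^ 3 := Nat.pow_le_pow_left (by omega) 3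
      _ = _ := by ring
  have h3 : n.choose 3 * 3 = n.choose 2 * (n - 2) := Nat.choose_succ_right_eq n 2
  have hn3 : 3 ≤ n := by omega
  have hpos : 0 < n.choose 2 := Nat.choose_pos (by omega)
  have h4 : n.choose 3 ≤ (2 * k * n.choose 2) * (27 * R ^ 3) :=
    hcount.trans (Nat.mul_le_mul hcon hm3)
  have h5 : n.choose 2 * (n - 2) ≤ n.choose 2 * (162 * (k * R ^ 3)) := by
    rw [← h3]
    calc _ ≤ (2 * k * n.choose 2) * (27 * R ^ 3) * 3 := Nat.mul_le_mul_right 3 h4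
      _ = _ := by ring
  have h6 := Nat.le_of_mul_le_mul_left h5 hpos
  have h7 : k * R ^ 3 ≤ k * R ^ 4 := Nat.mul_le_mul_left k hR34
  have h8 : k * 1 ≤ k * R ^ 3 := Nat.mul_le_mul_left k hR3
  rw [mul_assoc] at hn'
  omega
end

section
/- Let G be a finite graph and let A and B be disjoint subsets of its vertex set such that every vertex of A is adjacent in G to every vertex of B. Let P_A be a nonempty path of G contained in A and let P_B be a nonempty path of G contained in B. If |B − V(P_B)| ≤ |A − V(P_A)| ≤ |B| − 1, then G has a cycle whose vertex set is exactly A ∪ B. -/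
theorem aux_ext {V : Type*} [DecidableEq V] (G : SimpleGraph V) (A B : Finset V)
    (hAB : Disjoint A B) (hcomp : ∀ a ∈ A, ∀ b ∈ B, G.Adj a b) (n : ℕ) :
    ∀ (X Y : Finset V) (u v : V) (p : G.Walk u v), p.IsPath → u ∈ A → X ⊆ A → Y ⊆ B →
      X.card = n → Y.card = n → Disjoint X p.support.toFinset → Disjoint Y p.support.toFinset →
      ∃ (u' : V) (q : G.Walk u' v), q.IsPath ∧ u' ∈ A ∧
        q.support.toFinset = p.support.toFinset ∪ X ∪ Y := by
  induction n with
  | zero =>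
    intro X Y u v p hp hu _ _ hX hY _ _
    rw [Finset.card_eq_zero] at hX hY
    subst hX hY
    exact ⟨u, p, hp, hu, by simp⟩
  | succ n ih =>
    intro X Y u v p hp hu hXA hYB hX hY hXp hYp
    obtain ⟨x, X', hx, rfl, hX'⟩ := Finset.card_eq_succ.mp hX
    obtain ⟨y, Y', hy, rfl, hY'⟩ := Finset.card_eq_succ.mp hY
    rw [Finset.insert_subset_iff] at hXA hYB
    rw [Finset.disjoint_left] at hXp hYp hAB
    have hxy : G.Adj x y := hcomp _ hXA.1 _ hYB.1
    have huy : G.Adj y u := (hcomp _ hu _ hYB.1).symm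
    have hxp : x ∉ p.support := fun h => hXp (Finset.mem_insert_self _ _) (by simpa using h)
    have hyp : y ∉ p.support := fun h => hYp (Finset.mem_insert_self _ _) (by simpa using h)
    obtain ⟨u', q, hq, hu', hs⟩ := ih X' Y' x v (.cons hxy (.cons huy p))
      (by simp [SimpleGraph.Walk.cons_isPath_iff, hp, hyp, hxp, hxy.ne]) hXA.1 hXA.2 hYB.2 hX' hY'
      (by
        rw [Finset.disjoint_left]
        intro z hz hz'
        have h1 := hXp (Finset.mem_insert_of_mem hz)
        have h2 := hAB (hXA.2 hz)
        simp at hz' h1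
        rcases hz' with rfl | rfl | h
        · exact hx hz
        · exact h2 hYB.1
        · exact h1 h)
      (by
        rw [Finset.disjoint_left]
        intro z hz hz'
        have h1 := hYp (Finset.mem_insert_of_mem hz)
        have h2 := hYB.2 hz
        simp at hz' h1
        rcases hz' with rfl | rfl | h
        · exact hAB hXA.1 h2
        · exact hy hz
        · exact h1 h)
    refine ⟨u', q, hq, hu', ?_⟩
    rw [hs]
    ext z
    simp
    tauto

theorem aux_close {V : Type*} [DecidableEq V] (G : SimpleGraph V) (u v : V) (q : G.Walk u v)
    (hq : q.IsPath) (h : G.Adj v u) : IsCycleSet G q.support.toFinset := by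
  cases q with
  | nil => exact (h.ne rfl).elim
  | @cons _ w _ h' q' =>
    rw [SimpleGraph.Walk.cons_isPath_iff] at hq
    by_cases hw : w = v
    · subst hw
      have := SimpleGraph.Walk.isPath_iff_eq_nil.mp hq.1
      subst this
      exact Or.inr (Or.inl ⟨u, w, h', by ext z; simp⟩)
    · refine Or.inr (Or.inr ⟨v, .cons h (.cons h' q'), ?_, ?_⟩)
      · rw [SimpleGraph.Walk.cons_isCycle_iff]
        refine ⟨by rw [SimpleGraph.Walk.cons_isPath_iff]; exact hq, ?_⟩
        intro he
        simp only [SimpleGraph.Walk.edges_cons, List.mem_cons] at he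
        rcases he with he | he
        · rw [Sym2.eq_iff] at he
          rcases he with ⟨h1, h2⟩ | ⟨h1, h2⟩
          · exact h.ne h1
          · exact hw h1.symm
        · exact hq.2 (SimpleGraph.Walk.snd_mem_support_of_mem_edges _ he)
      · ext z
        have := q'.end_mem_support
        simp

theorem spanning_cycle_of_paths {V : Type*} [Fintype V] [DecidableEq V]
    (G : SimpleGraph V) (A B : Finset V) (hAB : Disjoint A B)
    (hcomp : ∀ a ∈ A, ∀ b ∈ B, G.Adj a b)
    (a₁ a₂ : V) (pA : G.Walk a₁ a₂) (hpA : pA.IsPath) (hpAsub : pA.support.toFinset ⊆ A)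
    (b₁ b₂ : V) (pB : G.Walk b₁ b₂) (hpB : pB.IsPath) (hpBsub : pB.support.toFinset ⊆ B)
    (h₁ : (B \ pB.support.toFinset).card ≤ (A \ pA.support.toFinset).card)
    (h₂ : (A \ pA.support.toFinset).card + 1 ≤ B.card) :
    IsCycleSet G (A ∪ B) := by
  obtain ⟨w, r, hr, hrB, hcard⟩ : ∃ (w : V) (r : G.Walk b₁ w), r.IsPath ∧
      r.support.toFinset ⊆ B ∧ r.support.toFinset.card + (A \ pA.support.toFinset).card = B.card := by
    have h3 := Finset.card_sdiff_add_card_eq_card hpBsub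
    rw [List.toFinset_card_of_nodup hpB.support_nodup, SimpleGraph.Walk.length_support] at h3
    generalize (A \ pA.support.toFinset).card = a at *
    have hr := hpB.take (B.card - a - 1)
    refine ⟨_, pB.take (B.card - a - 1), hr, ?_, ?_⟩
    · intro z hz
      apply hpBsub
      simp only [List.mem_toFinset] at hz ⊢
      exact (pB.isSubwalk_take _).support_subset hz
    · rw [List.toFinset_card_of_nodup hr.support_nodup, SimpleGraph.Walk.length_support,
        SimpleGraph.Walk.take_length]
      omega
  have ha₁ : a₁ ∈ A := hpAsub (by simp)
  have ha₂ : a₂ ∈ A := hpAsub (by simp)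
  have hb₁ : b₁ ∈ B := hrB (by simp)
  have hw : w ∈ B := hrB (by simp)
  have hs : (pA.append (.cons (hcomp _ ha₂ _ hb₁) r)).support = pA.support ++ r.support := by
    simp [SimpleGraph.Walk.support_append]
  have hY := Finset.card_sdiff_add_card_eq_card hrB
  have hd := Finset.disjoint_left.mp hAB
  obtain ⟨u, q, hq, hu, hqs⟩ := aux_ext G A B hAB hcomp _ (A \ pA.support.toFinset)
    (B \ r.support.toFinset) a₁ w (pA.append (.cons (hcomp _ ha₂ _ hb₁) r))
    (by
      rw [SimpleGraph.Walk.isPath_def, hs, List.nodup_append']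
      refine ⟨hpA.support_nodup, hr.support_nodup, fun z h h' => ?_⟩
      exact hd (hpAsub (by simpa using h)) (hrB (by simpa using h')))
    ha₁ Finset.sdiff_subset Finset.sdiff_subset rfl (by omega)
    (by
      rw [hs, Finset.disjoint_left]
      intro z hz hz'
      simp only [Finset.mem_sdiff, List.toFinset_append, Finset.mem_union] at hz hz'
      exact hz'.elim hz.2 fun h => hd hz.1 (hrB h))
    (by
      rw [hs, Finset.disjoint_left]
      intro z hz hz'
      simp only [Finset.mem_sdiff, List.toFinset_append, Finset.mem_union] at hz hz'
      exact hz'.elim (fun h => hd (hpAsub h) hz.1) hz.2)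
  have hfin : A ∪ B = q.support.toFinset := by
    rw [hqs, hs]
    ext z
    have h1 := @hpAsub z
    have h2 := @hrB z
    simp only [Finset.mem_sdiff, List.toFinset_append, Finset.mem_union]
    tauto
  rw [hfin]
  exact aux_close G u w q hq (hcomp _ hu _ hw).symm
end

section
/- Let G be a finite graph whose edges are coloured with colours 1 and 2, and let A_1, A_2 and B be pairwise disjoint subsets of its vertex set. For i = 1, 2, suppose every vertex of A_i is joined to every vertex of B by an edge of colour i, let P_{A_i} be a nonempty path of colour i contained in A_i, and let P_B^i be a (possibly empty) path of colour i contained in B. If the vertex sets of P_B^1 and P_B^2 partition B, and |A_1 − V(P_{A_1})| + |A_2 − V(P_{A_2})| + 2 ≤ |B|, then A_1 ∪ A_2 ∪ B can be partitioned into two monochromatic cycles, one of colour 1 and one of colour 2. -/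
/-- `S` is the vertex set of a (nonempty) path of `G` all of whose edges have colour `i`
under the edge colouring `χ`. -/
def IsMonoPathSet {V : Type*} [DecidableEq V] (G : SimpleGraph V) (χ : V → V → ℕ)
    (i : ℕ) (S : Finset V) : Prop :=
  ∃ (u v : V) (p : G.Walk u v), p.IsPath ∧ p.support.toFinset = S ∧
    ∀ x y : V, s(x, y) ∈ p.edges → χ x y = i

/-- `S` is the vertex set of a monochromatic cycle of colour `i` in `G` under the edge
colouring `χ`; single vertices and single edges count as degenerate cycles. -/
def IsMonoCycleSet {V : Type*} [DecidableEq V] (G : SimpleGraph V) (χ : V → V → ℕ)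
    (i : ℕ) (S : Finset V) : Prop :=
  (∃ v, S = {v}) ∨
  (∃ v w : V, G.Adj v w ∧ S = {v, w} ∧ χ v w = i) ∨
  (∃ (v : V) (p : G.Walk v v), p.IsCycle ∧ p.support.toFinset = S ∧
    ∀ x y : V, s(x, y) ∈ p.edges → χ x y = i)

theorem tc_walk_to_list {V : Type*} {G : SimpleGraph V} {χ : V → V → ℕ} {i : ℕ}
    {u v : V} (p : G.Walk u v) (h : ∀ x y : V, s(x, y) ∈ p.edges → χ x y = i) :
    p.support.IsChain (fun x y => G.Adj x y ∧ χ x y = i) := by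
  induction p with
  | nil => simp
  | @cons a b c hab q ih =>
    have h1 := ih (fun x y hxy => h x y (by simp [hxy]))
    rw [SimpleGraph.Walk.support_cons]
    rw [← SimpleGraph.Walk.cons_tail_support] at h1 ⊢
    exact List.IsChain.cons_cons ⟨hab, h a b (by simp)⟩ h1

theorem tc_list_to_walk {V : Type*} {G : SimpleGraph V} {χ : V → V → ℕ} {i : ℕ}
    (hsymm : ∀ u v, χ u v = χ v u) (t : List V) : ∀ (x : V),
    (x :: t).IsChain (fun x y => G.Adj x y ∧ χ x y = i) →
    ∃ (v : V) (p : G.Walk x v), v = (x :: t).getLast (by simp) ∧ p.support = x :: t ∧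
      ∀ x y : V, s(x, y) ∈ p.edges → χ x y = i := by
  induction t with
  | nil => intro x _; exact ⟨x, SimpleGraph.Walk.nil, by simp, by simp, by simp⟩
  | cons y t ih =>
    intro x h
    rw [List.isChain_cons_cons] at h
    obtain ⟨v, p, hv, hp, hc⟩ := ih y h.2
    refine ⟨v, SimpleGraph.Walk.cons h.1.1 p, by simp [hv], by simp [hp], ?_⟩
    intro a b hab
    rw [SimpleGraph.Walk.edges_cons, List.mem_cons] at hab
    rcases hab with hab | hab
    · rcases Sym2.eq_iff.1 hab with ⟨rfl, rfl⟩ | ⟨rfl, rfl⟩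
      · exact h.1.2
      · rw [hsymm]; exact h.1.2
    · exact hc a b hab

theorem tc_path {V : Type*} [DecidableEq V] {G : SimpleGraph V} {χ : V → V → ℕ} {i : ℕ}
    {S : Finset V} (h : IsMonoPathSet G χ i S) :
    ∃ l : List V, l ≠ [] ∧ l.Nodup ∧ l.toFinset = S ∧
      l.IsChain (fun x y => G.Adj x y ∧ χ x y = i) := by
  obtain ⟨u, v, p, hp, hS, hc⟩ := h
  exact ⟨p.support, by simp, hp.support_nodup, hS, tc_walk_to_list p hc⟩

theorem tc_cycle {V : Type*} [DecidableEq V] {G : SimpleGraph V} {χ : V → V → ℕ} {i : ℕ}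
    (hsymm : ∀ u v, χ u v = χ v u) (l : List V) (hne : l ≠ []) (hnd : l.Nodup)
    (hch : l.IsChain (fun x y => G.Adj x y ∧ χ x y = i))
    (hcl : G.Adj (l.getLast hne) (l.head hne) ∧ χ (l.getLast hne) (l.head hne) = i) :
    IsMonoCycleSet G χ i l.toFinset := by
  match l, hne, hnd, hch, hcl with
  | [x], _, _, _, _ => left; exact ⟨x, by simp⟩
  | [x, y], _, _, hch, _ =>
    right; left
    simp at hch
    exact ⟨x, y, hch.1, by ext; simp, hch.2⟩
  | x :: y :: z :: t, _, hnd, hch, hcl =>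
    right; right
    rw [List.isChain_cons_cons] at hch
    obtain ⟨v, q, hv, hq, hc⟩ := tc_list_to_walk hsymm _ _ hch.2
    have hlast : (x :: y :: z :: t).getLast (by simp) = (y :: z :: t).getLast (by simp) := by simp
    rw [hlast, ← hv] at hcl
    simp only [List.head_cons] at hcl
    have hxq : x ∉ q.support := by rw [hq]; exact (List.nodup_cons.1 hnd).1
    have hqp : q.IsPath := by
      rw [SimpleGraph.Walk.isPath_def, hq]; exact (List.nodup_cons.1 hnd).2
    have hly : v ≠ y := by
      intro h
      rw [hv] at h
      have h1 : (y :: z :: t).getLast (by simp) ∈ z :: t := by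
        rw [List.getLast_cons (by simp)]; exact List.getLast_mem _
      rw [h] at h1
      exact (List.nodup_cons.1 (List.nodup_cons.1 hnd).2).1 h1
    refine ⟨_, SimpleGraph.Walk.cons hcl.1 (SimpleGraph.Walk.cons hch.1.1 q), ?_, ?_, ?_⟩
    · rw [SimpleGraph.Walk.cons_isCycle_iff]
      refine ⟨hqp.cons hxq, ?_⟩
      rw [SimpleGraph.Walk.edges_cons, List.mem_cons]
      rintro (h | h)
      · rcases Sym2.eq_iff.1 h with ⟨h1, h2⟩ | ⟨h1, h2⟩
        · exact hch.1.1.ne h2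
        · exact hly h1
      · exact hxq (q.snd_mem_support_of_mem_edges h)
    · rw [SimpleGraph.Walk.support_cons, SimpleGraph.Walk.support_cons, hq]
      ext a
      simp only [List.mem_toFinset, List.mem_cons]
      constructor
      · rintro (h | h)
        · have := List.getLast_mem (l := y :: z :: t) (by simp)
          rw [← hv, ← h] at this
          simp at this
          tauto
        · exact h
      · tauto
    · intro a b hab
      rw [SimpleGraph.Walk.edges_cons, SimpleGraph.Walk.edges_cons, List.mem_cons,
        List.mem_cons] at hab
      rcases hab with hab | hab | hab
      · rcases Sym2.eq_iff.1 hab with ⟨rfl, rfl⟩ | ⟨rfl, rfl⟩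
        · exact hcl.2
        · rw [hsymm]; exact hcl.2
      · rcases Sym2.eq_iff.1 hab with ⟨rfl, rfl⟩ | ⟨rfl, rfl⟩
        · exact hch.1.2
        · rw [hsymm]; exact hch.1.2
      · exact hc a b hab

theorem tc_weave {V : Type*} (R : V → V → Prop) (as : List V) : ∀ l : List V,
    as.length < l.length → (l.drop as.length).IsChain R →
    (∀ a ∈ as, ∀ b ∈ l, R a b ∧ R b a) →
    ∃ m : List V, m.IsChain R ∧ m.Perm (as ++ l) ∧ (∀ x ∈ m.head?, x ∈ l) ∧
      (∀ x ∈ m.getLast?, x ∈ l) := by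
  induction as with
  | nil =>
    intro l _ h _
    exact ⟨l, by simpa using h, by simp, fun x hx => List.mem_of_mem_head? hx,
      fun x hx => List.mem_of_getLast? hx⟩
  | cons a as ih =>
    intro l hl hc hR
    match l, hl, hc, hR with
    | b :: l, hl, hc, hR =>
      obtain ⟨m, h1, h2, h3, h4⟩ := ih l (by simpa using hl) (by simpa using hc)
        (fun a ha b hb => hR a (by simp [ha]) b (by simp [hb]))
      refine ⟨b :: a :: m, ?_, ?_, by simp, ?_⟩
      · rw [List.isChain_cons_cons, List.isChain_cons]
        refine ⟨(hR a (by simp) b (by simp)).2, fun y hy => ?_, h1⟩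
        exact (hR a (by simp) y (List.mem_cons_of_mem _ (h3 y hy))).1
      · calc (b :: a :: m).Perm (b :: a :: (as ++ l)) := (h2.cons a).cons b
          _ |>.Perm _ := by
            have : (b :: (a :: as ++ l)).Perm (a :: as ++ b :: l) := List.perm_middle.symm
            simpa using this
      · intro x hx
        have hm : m ≠ [] := by
          rintro rfl
          have := h2.length_eq
          simp only [List.length_nil, List.length_append, List.length_cons] at this hl
          omega
        obtain ⟨c, m', rfl⟩ := List.exists_cons_of_ne_nil hm
        rw [List.getLast?_cons_cons, List.getLast?_cons_cons] at hx
        exact List.mem_cons_of_mem _ (h4 x hx)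

theorem tc_one {V : Type*} [DecidableEq V] {G : SimpleGraph V} {χ : V → V → ℕ} {i : ℕ}
    (hsymm : ∀ u v, χ u v = χ v u) (A B PA : Finset V) (hAB : Disjoint A B)
    (hcomp : ∀ a ∈ A, ∀ b ∈ B, G.Adj a b ∧ χ a b = i)
    (hsub : PA ⊆ A) (hPA : IsMonoPathSet G χ i PA)
    (l : List V) (hnd : l.Nodup) (hlB : ∀ x ∈ l, x ∈ B)
    (hlen : (A \ PA).card < l.length)
    (hch : (l.drop (A \ PA).card).IsChain (fun x y => G.Adj x y ∧ χ x y = i)) :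
    IsMonoCycleSet G χ i (A ∪ l.toFinset) := by
  obtain ⟨p, hp, hpn, hpS, hpc⟩ := tc_path hPA
  have hpm : ∀ x, x ∈ p ↔ x ∈ PA := fun x => by rw [← hpS]; simp
  have hR : ∀ a ∈ A, ∀ b ∈ l, (G.Adj a b ∧ χ a b = i) ∧ (G.Adj b a ∧ χ b a = i) := by
    intro a ha b hb
    have h := hcomp a ha b (hlB b hb)
    exact ⟨h, h.1.symm, by rw [hsymm]; exact h.2⟩
  obtain ⟨m, h1, h2, h3, h4⟩ := tc_weave (fun x y => G.Adj x y ∧ χ x y = i) (A \ PA).toList l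
    (by simpa using hlen) (by simpa using hch)
    (fun a ha b hb => hR a (by simp at ha; exact ha.1) b hb)
  have hmm : ∀ x, x ∈ m ↔ (x ∈ A ∧ x ∉ PA) ∨ x ∈ l := fun x => by rw [h2.mem_iff]; simp
  have hdis : ∀ x, x ∈ A → x ∉ l := fun x hx hl =>
    (Finset.disjoint_left.1 hAB hx) (hlB x hl)
  have hm : m ≠ [] := by
    rintro rfl
    have := h2.length_eq
    simp only [List.length_nil, List.length_append] at this
    omega
  have hmn : m.Nodup := by
    rw [h2.nodup_iff, List.nodup_append']
    refine ⟨Finset.nodup_toList _, hnd, ?_⟩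
    intro x hx hx'
    simp at hx
    exact hdis x hx.1 hx'
  have hset : A ∪ l.toFinset = (p ++ m).toFinset := by
    ext x
    simp only [Finset.mem_union, List.mem_toFinset, List.mem_append, hpm, hmm]
    have := @hsub x
    tauto
  rw [hset]
  refine tc_cycle hsymm (p ++ m) (by simp [hp]) ?_ ?_ ?_
  · rw [List.nodup_append']
    refine ⟨hpn, hmn, ?_⟩
    intro x hx hx'
    rw [hpm] at hx
    rw [hmm] at hx'
    rcases hx' with h | h
    · exact h.2 hx
    · exact hdis x (hsub hx) h
  · rw [List.isChain_append]
    refine ⟨hpc, h1, ?_⟩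
    intro x hx y hy
    exact (hR x (hsub ((hpm x).1 (List.mem_of_getLast? hx))) y (h3 y hy)).1
  · rw [List.getLast_append_of_ne_nil _ hm, List.head_append_of_ne_nil hp]
    exact (hR _ (hsub ((hpm _).1 (List.head_mem hp))) _
      (h4 _ (List.getLast?_eq_getLast_of_ne_nil hm))).2

theorem tc_pathB {V : Type*} [DecidableEq V] {G : SimpleGraph V} {χ : V → V → ℕ} {i : ℕ}
    {S : Finset V} (h : S = ∅ ∨ IsMonoPathSet G χ i S) :
    ∃ l : List V, l.Nodup ∧ l.toFinset = S ∧
      l.IsChain (fun x y => G.Adj x y ∧ χ x y = i) := by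
  rcases h with rfl | h
  · exact ⟨[], by simp⟩
  · obtain ⟨l, _, h⟩ := tc_path h
    exact ⟨l, h⟩

theorem tc_chain_short {V : Type*} (R : V → V → Prop) (l : List V) (h : l.length ≤ 1) :
    l.IsChain R := by
  match l, h with
  | [], _ => simp
  | [x], _ => simp

/-- splitting step -/
theorem tc_split {V : Type*} (R R' : V → V → Prop) (q q' : List V) (r r' : ℕ)
    (hq' : q'.IsChain R') (hr : q.length ≤ r)
    (hs : r + r' + 2 ≤ q.length + q'.length) :
    ∃ l l' : List V, (l ++ l').Perm (q ++ q') ∧ r < l.length ∧ r' < l'.length ∧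
      (l.drop r).IsChain R ∧ (l'.drop r').IsChain R' := by
  refine ⟨q ++ q'.take (r + 1 - q.length), q'.drop (r + 1 - q.length), ?_, ?_, ?_, ?_, ?_⟩
  · simp
  · simp; omega
  · simp; omega
  · apply tc_chain_short; simp; omega
  · exact (hq'.drop _).drop _


/-- Let `G` be a graph coloured with colours `1` and `2` and let `A₁, A₂, B` be pairwise
disjoint vertex sets with all edges between `A_i` and `B` present and of colour `i`.
Given nonempty paths `P_{A_i} ⊆ A_i` of colour `i` and (possibly empty) paths
`P_B^1, P_B^2 ⊆ B` of colours `1` and `2` partitioning `B`, if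
`|A₁ − P_{A₁}| + |A₂ − P_{A₂}| + 2 ≤ |B|`, then `A₁ ∪ A₂ ∪ B` can be partitioned into two
monochromatic cycles, one of each colour. -/
theorem two_cycles_from_paths {V : Type*} [Fintype V] [DecidableEq V]
    (G : SimpleGraph V) (χ : V → V → ℕ)
    (hsymm : ∀ u v, χ u v = χ v u)
    (hcol : ∀ u v, G.Adj u v → χ u v = 1 ∨ χ u v = 2)
    (A₁ A₂ B : Finset V)
    (hd₁₂ : Disjoint A₁ A₂) (hd₁B : Disjoint A₁ B) (hd₂B : Disjoint A₂ B)
    (hcomp₁ : ∀ a ∈ A₁, ∀ b ∈ B, G.Adj a b ∧ χ a b = 1)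
    (hcomp₂ : ∀ a ∈ A₂, ∀ b ∈ B, G.Adj a b ∧ χ a b = 2)
    (PA₁ : Finset V) (hPA₁sub : PA₁ ⊆ A₁) (hPA₁ : IsMonoPathSet G χ 1 PA₁)
    (PA₂ : Finset V) (hPA₂sub : PA₂ ⊆ A₂) (hPA₂ : IsMonoPathSet G χ 2 PA₂)
    (PB₁ : Finset V) (hPB₁ : PB₁ = ∅ ∨ IsMonoPathSet G χ 1 PB₁)
    (PB₂ : Finset V) (hPB₂ : PB₂ = ∅ ∨ IsMonoPathSet G χ 2 PB₂)
    (hBdisj : Disjoint PB₁ PB₂) (hBpart : PB₁ ∪ PB₂ = B)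
    (hsize : (A₁ \ PA₁).card + (A₂ \ PA₂).card + 2 ≤ B.card) :
    ∃ C₁ C₂ : Finset V, IsMonoCycleSet G χ 1 C₁ ∧ IsMonoCycleSet G χ 2 C₂ ∧
      Disjoint C₁ C₂ ∧ C₁ ∪ C₂ = A₁ ∪ A₂ ∪ B := by
  obtain ⟨q₁, hn₁, hs₁, hc₁⟩ := tc_pathB hPB₁
  obtain ⟨q₂, hn₂, hs₂, hc₂⟩ := tc_pathB hPB₂
  have hl₁ : q₁.length = PB₁.card := by rw [← hs₁, List.toFinset_card_of_nodup hn₁]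
  have hl₂ : q₂.length = PB₂.card := by rw [← hs₂, List.toFinset_card_of_nodup hn₂]
  have hB : B.card = q₁.length + q₂.length := by
    rw [hl₁, hl₂, ← hBpart, Finset.card_union_of_disjoint hBdisj]
  have key : ∃ l l' : List V, (l ++ l').Perm (q₁ ++ q₂) ∧ (A₁ \ PA₁).card < l.length ∧
      (A₂ \ PA₂).card < l'.length ∧
      (l.drop (A₁ \ PA₁).card).IsChain (fun x y => G.Adj x y ∧ χ x y = 1) ∧
      (l'.drop (A₂ \ PA₂).card).IsChain (fun x y => G.Adj x y ∧ χ x y = 2) := by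
    by_cases h1 : q₁.length ≤ (A₁ \ PA₁).card
    · exact tc_split _ _ q₁ q₂ _ _ hc₂ h1 (by omega)
    by_cases h2 : q₂.length ≤ (A₂ \ PA₂).card
    · obtain ⟨l, l', h, ha, hb, hc, hd⟩ := tc_split (fun x y => G.Adj x y ∧ χ x y = 2)
        (fun x y => G.Adj x y ∧ χ x y = 1) q₂ q₁ (A₂ \ PA₂).card (A₁ \ PA₁).card hc₁ h2 (by omega)
      exact ⟨l', l, (List.perm_append_comm.trans h).trans List.perm_append_comm, hb, ha, hd, hc⟩
    · exact ⟨q₁, q₂, List.Perm.refl _, by omega, by omega, hc₁.drop _, hc₂.drop _⟩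
  obtain ⟨l, l', hperm, ha, hb, hc, hd⟩ := key
  have hq : (q₁ ++ q₂).Nodup := by
    rw [List.nodup_append']
    refine ⟨hn₁, hn₂, ?_⟩
    intro x hx hx'
    have hbd := Finset.disjoint_left.1 hBdisj
    refine @hbd x ?_ ?_
    · rw [← hs₁]; simpa using hx
    · rw [← hs₂]; simpa using hx'
  have hll := hperm.nodup_iff.2 hq
  rw [List.nodup_append'] at hll
  obtain ⟨hnl, hnl', hdl⟩ := hll
  have hmem : ∀ x, x ∈ B ↔ x ∈ l ∨ x ∈ l' := by
    intro x
    rw [← List.mem_append, hperm.mem_iff, ← hBpart, ← hs₁, ← hs₂]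
    simp
  refine ⟨A₁ ∪ l.toFinset, A₂ ∪ l'.toFinset,
    tc_one hsymm A₁ B PA₁ hd₁B hcomp₁ hPA₁sub hPA₁ l hnl (fun x hx => (hmem x).2 (Or.inl hx)) ha hc,
    tc_one hsymm A₂ B PA₂ hd₂B hcomp₂ hPA₂sub hPA₂ l' hnl' (fun x hx => (hmem x).2 (Or.inr hx))
      hb hd, ?_, ?_⟩
  · rw [Finset.disjoint_left]
    intro x hx hx'
    simp only [Finset.mem_union, List.mem_toFinset] at hx hx'
    rcases hx with hx | hx <;> rcases hx' with hx' | hx'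
    · exact Finset.disjoint_left.1 hd₁₂ hx hx'
    · exact Finset.disjoint_left.1 hd₁B hx ((hmem x).2 (Or.inr hx'))
    · exact Finset.disjoint_left.1 hd₂B hx' ((hmem x).2 (Or.inl hx))
    · exact hdl hx hx'
  · ext x
    simp only [Finset.mem_union, List.mem_toFinset, hmem]
    tauto
end

section
/- Let the edges of the complete graph K_n (n ≥ 3) be 2-locally coloured, and suppose that no single colour sees every vertex (for each colour, some vertex is incident to no edge of that colour). Then there are three distinct colours c_1, c_2, c_3 and a partition of the vertex set into three nonempty sets V_{12}, V_{13}, V_{23} such that: every edge with both endpoints in V_{ij} has colour c_i or c_j; and for distinct i, j, ℓ, every edge between V_{ij} and V_{iℓ} has colour c_i. -/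
/-- If `K_n` (`n ≥ 3`) is `2`-locally coloured and no single colour sees every vertex, then
there are three distinct colours `c₁, c₂, c₃` and a partition of the vertex set into three
nonempty sets `V₁₂, V₁₃, V₂₃` such that every edge inside `V_{ij}` has colour `c_i` or
`c_j`, and every edge between `V_{ij}` and `V_{iℓ}` has colour `c_i`. -/
theorem two_local_structure (n : ℕ) (hn : 3 ≤ n) (χ : Fin n → Fin n → ℕ)
    (hsymm : ∀ u v, χ u v = χ v u)
    (hloc : ∀ v : Fin n, ((Finset.univ.erase v).image (χ v)).card ≤ 2)
    (hnosee : ∀ col : ℕ, ∃ v : Fin n, ∀ u : Fin n, u ≠ v → χ v u ≠ col) :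
    ∃ c₁ c₂ c₃ : ℕ, c₁ ≠ c₂ ∧ c₁ ≠ c₃ ∧ c₂ ≠ c₃ ∧
      ∃ V₁₂ V₁₃ V₂₃ : Finset (Fin n),
        V₁₂.Nonempty ∧ V₁₃.Nonempty ∧ V₂₃.Nonempty ∧
        Disjoint V₁₂ V₁₃ ∧ Disjoint V₁₂ V₂₃ ∧ Disjoint V₁₃ V₂₃ ∧
        V₁₂ ∪ V₁₃ ∪ V₂₃ = Finset.univ ∧
        (∀ u ∈ V₁₂, ∀ w ∈ V₁₂, u ≠ w → χ u w = c₁ ∨ χ u w = c₂) ∧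
        (∀ u ∈ V₁₃, ∀ w ∈ V₁₃, u ≠ w → χ u w = c₁ ∨ χ u w = c₃) ∧
        (∀ u ∈ V₂₃, ∀ w ∈ V₂₃, u ≠ w → χ u w = c₂ ∨ χ u w = c₃) ∧
        (∀ u ∈ V₁₂, ∀ w ∈ V₁₃, χ u w = c₁) ∧
        (∀ u ∈ V₁₂, ∀ w ∈ V₂₃, χ u w = c₂) ∧
        (∀ u ∈ V₁₃, ∀ w ∈ V₂₃, χ u w = c₃) := by
  obtain ⟨S, hSdef⟩ : ∃ S : Fin n → Finset ℕ, ∀ v, S v = (Finset.univ.erase v).image (χ v) :=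
    ⟨_, fun _ => rfl⟩
  have hm : ∀ u v, u ≠ v → χ u v ∈ S u := by
    intro u v h
    rw [hSdef]
    exact Finset.mem_image_of_mem _ (by simp [h.symm])
  have hm' : ∀ u v, u ≠ v → χ u v ∈ S v := by
    intro u v h
    rw [hsymm]
    exact hm v u h.symm
  have hns : ∀ c, ∃ v, c ∉ S v := by
    intro c
    obtain ⟨v, hv⟩ := hnosee c
    refine ⟨v, ?_⟩
    rw [hSdef]
    intro h
    obtain ⟨u, hu, e⟩ := Finset.mem_image.1 h
    exact hv u (Finset.mem_erase.1 hu).1 e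
  have hle : ∀ v, (S v).card ≤ 2 := fun v => by rw [hSdef]; exact hloc v
  have hne : ∀ v, (S v).Nonempty := by
    intro v
    haveI : Nontrivial (Fin n) := Fin.nontrivial_iff_two_le.2 (by omega)
    obtain ⟨u, hu⟩ := exists_ne v
    exact ⟨_, hm v u hu.symm⟩
  have hint : ∀ u v, ∃ c, c ∈ S u ∧ c ∈ S v := by
    intro u v
    by_cases h : u = v
    · subst h
      obtain ⟨c, hc⟩ := hne u
      exact ⟨c, hc, hc⟩
    · exact ⟨_, hm u v h, hm' u v h⟩
  have htwo : ∀ v, ∃ p q, p ≠ q ∧ S v = {p, q} := by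
    intro v
    apply Finset.card_eq_two.1
    have h1 := (hne v).card_pos
    have h2 := hle v
    by_contra h3
    obtain ⟨c, hc⟩ := Finset.card_eq_one.1 (show (S v).card = 1 by omega)
    obtain ⟨w, hw⟩ := hns c
    obtain ⟨d, hd1, hd2⟩ := hint v w
    rw [hc, Finset.mem_singleton] at hd1
    exact hw (hd1 ▸ hd2)
  have hpair : ∀ v p q, p ≠ q → p ∈ S v → q ∈ S v → S v = {p, q} := by
    intro v p q h hp hq
    symm
    apply Finset.eq_of_subset_of_card_le
    · intro x hx
      simp only [Finset.mem_insert, Finset.mem_singleton] at hx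
      rcases hx with rfl | rfl <;> assumption
    · rw [Finset.card_pair h]
      exact hle v
  obtain ⟨a, b, hab, h0⟩ := htwo ⟨0, by omega⟩
  obtain ⟨x, hx⟩ := hns a
  obtain ⟨y, hy⟩ := hns b
  have hbx : b ∈ S x := by
    obtain ⟨d, h1, h2⟩ := hint ⟨0, by omega⟩ x
    grind
  have hay : a ∈ S y := by
    obtain ⟨d, h1, h2⟩ := hint ⟨0, by omega⟩ y
    grind
  obtain ⟨c, hcx, hcy⟩ := hint x y
  have hac : a ≠ c := by grind
  have hbc : b ≠ c := by grind
  have hX := hpair x b c hbc hbx hcx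
  have hY := hpair y a c hac hay hcy
  have hall : ∀ v, S v = {a, b} ∨ S v = {a, c} ∨ S v = {b, c} := by
    intro v
    obtain ⟨d, h1, h2⟩ := hint ⟨0, by omega⟩ v
    obtain ⟨e, h3, h4⟩ := hint x v
    obtain ⟨f, h5, h6⟩ := hint y v
    have p1 := hpair v a b hab
    have p2 := hpair v a c hac
    have p3 := hpair v b c hbc
    rw [h0] at h1
    rw [hX] at h3
    rw [hY] at h5
    simp only [Finset.mem_insert, Finset.mem_singleton] at h1 h3 h5
    grind
  have n1 : ({a, b} : Finset ℕ) ≠ {a, c} := fun h => by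
    have : b ∈ ({a, c} : Finset ℕ) := h ▸ (by simp)
    grind
  have n2 : ({a, b} : Finset ℕ) ≠ {b, c} := fun h => by
    have : a ∈ ({b, c} : Finset ℕ) := h ▸ (by simp)
    grind
  have n3 : ({a, c} : Finset ℕ) ≠ {b, c} := fun h => by
    have : a ∈ ({b, c} : Finset ℕ) := h ▸ (by simp)
    grind
  have hin : ∀ p q u w, S u = {p, q} → u ≠ w → χ u w = p ∨ χ u w = q := by
    intro p q u w hu h
    have := hm u w h
    rw [hu] at this
    simpa using this
  have hin' : ∀ p q u w, S w = {p, q} → u ≠ w → χ u w = p ∨ χ u w = q := by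
    intro p q u w hu h
    have := hm' u w h
    rw [hu] at this
    simpa using this
  refine ⟨a, b, c, hab, hac, hbc, Finset.univ.filter (fun v => S v = {a, b}),
    Finset.univ.filter (fun v => S v = {a, c}), Finset.univ.filter (fun v => S v = {b, c}),
    ⟨⟨0, by omega⟩, by simpa using h0⟩, ⟨y, by simpa using hY⟩, ⟨x, by simpa using hX⟩,
    ?_, ?_, ?_, ?_, ?_, ?_, ?_, ?_, ?_, ?_⟩
  · exact Finset.disjoint_filter.2 fun v _ h h' => n1 (h.symm.trans h')
  · exact Finset.disjoint_filter.2 fun v _ h h' => n2 (h.symm.trans h')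
  · exact Finset.disjoint_filter.2 fun v _ h h' => n3 (h.symm.trans h')
  · ext v
    have := hall v
    simp only [Finset.mem_union, Finset.mem_filter, Finset.mem_univ, true_and, iff_true]
    tauto
  · intro u hu w _ h
    exact hin _ _ u w (Finset.mem_filter.1 hu).2 h
  · intro u hu w _ h
    exact hin _ _ u w (Finset.mem_filter.1 hu).2 h
  · intro u hu w _ h
    exact hin _ _ u w (Finset.mem_filter.1 hu).2 h
  all_goals
    intro u hu w hw
    have h1 := (Finset.mem_filter.1 hu).2
    have h2 := (Finset.mem_filter.1 hw).2
    have h : u ≠ w := by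
      rintro rfl
      have h3 := h1.symm.trans h2
      first
        | exact n1 h3
        | exact n2 h3
        | exact n3 h3
    have h3 := hin _ _ u w h1 h
    have h4 := hin' _ _ u w h2 h
    omega
end

section
/- Let r ≥ 1, let A' be a nonempty finite set, and let N_1, N_2, …, N_{r+1} be subsets of A' each of size at least |A'|/r. Then there exist indices k ≠ ℓ with |N_k ∩ N_ℓ| ≥ |A'|/r³. -/
/-- If `A'` is a nonempty finite set and `N 0, …, N r` are `r + 1` subsets of `A'` each of
size at least `|A'|/r`, then some two of them intersect in at least `|A'|/r³` elements. -/
theorem large_pairwise_intersection {γ : Type*} [DecidableEq γ] (r : ℕ) (hr : 1 ≤ r)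
    (A' : Finset γ) (hA : A'.Nonempty)
    (N : Fin (r + 1) → Finset γ) (hsub : ∀ i, N i ⊆ A')
    (hsize : ∀ i, (A'.card : ℝ) / (r : ℝ) ≤ ((N i).card : ℝ)) :
    ∃ k ℓ : Fin (r + 1), k ≠ ℓ ∧ (A'.card : ℝ) / (r : ℝ) ^ 3 ≤ ((N k ∩ N ℓ).card : ℝ) := by
  by_contra! hcon
  have h1 : ∑ i, ((N i).card : ℝ) = ∑ x ∈ A', ∑ i, (if x ∈ N i then (1 : ℝ) else 0) := by
    rw [Finset.sum_comm]
    refine Finset.sum_congr rfl fun i _ => ?_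
    rw [← Finset.sum_filter, Finset.filter_mem_eq_inter, Finset.inter_eq_right.mpr (hsub i)]
    simp
  have h2 : ∑ i, ∑ j, ((N i ∩ N j).card : ℝ)
      = ∑ x ∈ A', (∑ i, (if x ∈ N i then (1 : ℝ) else 0)) ^ 2 := by
    have : ∀ x ∈ A', (∑ i, (if x ∈ N i then (1 : ℝ) else 0)) ^ 2
        = ∑ i, ∑ j, (if x ∈ N i ∩ N j then (1 : ℝ) else 0) := by
      intro x _
      rw [sq, Finset.sum_mul_sum]
      refine Finset.sum_congr rfl fun i _ => ?_
      refine Finset.sum_congr rfl fun j _ => ?_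
      by_cases hi : x ∈ N i <;> by_cases hj : x ∈ N j <;> simp [hi, hj]
    rw [Finset.sum_congr (rfl : A' = A') this, Finset.sum_comm (s := A')]
    refine Finset.sum_congr rfl fun i _ => ?_
    rw [Finset.sum_comm (s := A')]
    refine Finset.sum_congr rfl fun j _ => ?_
    rw [← Finset.sum_filter, Finset.filter_mem_eq_inter,
      Finset.inter_eq_right.mpr (Finset.inter_subset_left.trans (hsub i))]
    simp
  have h3 : ∀ x ∈ A', 3 * (∑ i, (if x ∈ N i then (1 : ℝ) else 0)) - 2
      ≤ (∑ i, (if x ∈ N i then (1 : ℝ) else 0)) ^ 2 := by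
    intro x _
    rw [Finset.sum_boole]
    generalize (Finset.univ.filter fun i => x ∈ N i).card = d
    rcases Nat.lt_or_ge d 2 with h | h
    · interval_cases d <;> norm_num
    · have : (2 : ℝ) ≤ d := by exact_mod_cast h
      nlinarith
  have h4 := Finset.sum_le_sum h3
  rw [← h2, Finset.sum_sub_distrib, ← Finset.mul_sum, ← h1] at h4
  simp only [Finset.sum_const, nsmul_eq_mul] at h4
  have hr0 : (1 : ℝ) ≤ r := by exact_mod_cast hr
  have ha : (0 : ℝ) < A'.card := by exact_mod_cast hA.card_pos
  have h5 : ∀ i, ∑ j, ((N i ∩ N j).card : ℝ)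
      < (N i).card + r * ((A'.card : ℝ) / (r : ℝ) ^ 3) := by
    intro i
    rw [← Finset.add_sum_erase _ _ (Finset.mem_univ i), Finset.inter_self]
    have hc : (Finset.univ.erase i).card = r := by simp
    have := Finset.sum_lt_sum_of_nonempty (s := Finset.univ.erase i)
      (f := fun j => ((N i ∩ N j).card : ℝ)) (g := fun _ => (A'.card : ℝ) / (r : ℝ) ^ 3)
      (Finset.card_pos.mp (by omega))
      (fun j hj => hcon i j (Finset.ne_of_mem_erase hj).symm)
    rw [Finset.sum_const, hc, nsmul_eq_mul] at this
    linarith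
  have h6 := Finset.sum_lt_sum_of_nonempty (s := Finset.univ) Finset.univ_nonempty
    (fun i _ => h5 i)
  rw [Finset.sum_add_distrib] at h6
  have h7 := Finset.sum_le_sum (s := Finset.univ) (fun i _ => hsize i)
  simp only [Finset.sum_const, nsmul_eq_mul, Finset.card_univ, Fintype.card_fin] at h6 h7
  push_cast at h6 h7
  have e1 : ((r : ℝ) + 1) * (A'.card / r) = A'.card + A'.card / r := by field_simp
  have e2 : ((r : ℝ) + 1) * (r * (A'.card / (r : ℝ) ^ 3)) ≤ 2 * (A'.card / r) := by
    have : ((r : ℝ) + 1) * (r * (A'.card / (r : ℝ) ^ 3)) = ((r + 1) / r) * (A'.card / r) := by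
      field_simp
    rw [this]
    gcongr
    rw [div_le_iff₀ (by linarith)]
    linarith
  linarith
end
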